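/- arXiv:1909.00177 — 2 statements merged into one kernel-verified Lean document; each statement's English description precedes it below -/
import Mathlib

section
/- Let M be a weight sequence satisfying the moderate growth condition and the non-quasianalyticity condition Σ_{j≥0} M_j/((j+1)M_{j+1}) < ∞. Let f be a complex-valued function defined on a neighborhood of the origin in ℝ^n. Suppose there are non-zero natural numbers p and q with gcd(p,q) = 1 and an open neighborhood U of 0 on which both f^p and f^q are smooth and of class C_M. Then there is an open neighborhood V of 0 on which f is smooth and of class C_M. -/
open Set Filter MeasureTheory Topology

/-- A weight sequence: positive, nondecreasing, `M 0 = 1`, logarithmically convex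
(the sequence of ratios `M (j+1) / M j` is nondecreasing), and `M j ^ (1/j) → ∞`. -/
def IsWeightSeq (M : ℕ → ℝ) : Prop :=
  (∀ j, 0 < M j) ∧ Monotone M ∧ M 0 = 1 ∧
  (∀ j, M (j + 1) / M j ≤ M (j + 2) / M (j + 1)) ∧
  Tendsto (fun j : ℕ => (M j) ^ (1 / (j : ℝ))) atTop atTop

/-- The moderate growth condition. -/
def ModerateGrowth (M : ℕ → ℝ) : Prop :=
  ∃ A > 0, ∀ j k : ℕ, M (j + k) ≤ A ^ (j + k) * (M j * M k)

/-- The strong non-quasianalyticity condition. -/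
def StrongNQA (M : ℕ → ℝ) : Prop :=
  ∃ A > 0, ∀ k : ℕ, ∑' j : ℕ, M (k + j) / (((k + j : ℕ) + 1) * M ((k + j) + 1))
      ≤ A * (M k / M (k + 1))

/-- The non-quasianalyticity condition `∑ M j / ((j+1) M (j+1)) < ∞`. -/
def NonQuasianalytic (M : ℕ → ℝ) : Prop :=
  Summable fun j : ℕ => M j / (((j : ℝ) + 1) * M (j + 1))

/-- A function `f` is smooth and of class `C_M` on an open set `Ω ⊆ ℝⁿ`. -/
def IsCMOnRn (n : ℕ) (M : ℕ → ℝ) (f : EuclideanSpace ℝ (Fin n) → ℂ)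
    (Ω : Set (EuclideanSpace ℝ (Fin n))) : Prop :=
  ContDiffOn ℝ (⊤ : ℕ∞) f Ω ∧
  ∀ X : Set (EuclideanSpace ℝ (Fin n)), X ⊆ Ω → IsCompact X →
    ∃ σ > 0, ∃ C ≥ 0, ∀ j : ℕ, ∀ x ∈ X,
      ‖iteratedFDerivWithin ℝ j f Ω x‖ ≤ C * σ ^ j * (j.factorial : ℝ) * M j

namespace IsWeightSeq

variable {M : ℕ → ℝ}

lemma pos (hM : IsWeightSeq M) (j : ℕ) : 0 < M j := hM.1 j

lemma ratio_mono (hM : IsWeightSeq M) : Monotone fun j => M (j + 1) / M j :=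
  monotone_nat_of_le_succ hM.2.2.2.1

lemma one_le (hM : IsWeightSeq M) (j : ℕ) : 1 ≤ M j :=
  hM.2.2.1 ▸ hM.2.1 (Nat.zero_le j)

lemma mul_le_add (hM : IsWeightSeq M) (i j : ℕ) : M i * M j ≤ M (i + j) := by
  induction i with
  | zero => simp [hM.2.2.1]
  | succ i ih =>
    have h := hM.ratio_mono (Nat.le_add_right i j)
    simp only at h
    have hi := hM.pos i
    have hij := hM.pos (i + j)
    have hi1 := hM.pos (i + 1)
    have hj := hM.pos j
    rw [div_le_div_iff₀ hi hij] at h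
    have e : i + 1 + j = i + j + 1 := by ring
    rw [e]
    have : M (i + 1) * M j * M i ≤ M (i + j + 1) * M i := by
      calc M (i + 1) * M j * M i = M (i + 1) * (M i * M j) := by ring
        _ ≤ M (i + 1) * M (i + j) := by gcongr
        _ ≤ M (i + j + 1) * M i := h
    exact le_of_mul_le_mul_right this hi

lemma le_ratio_pow (hM : IsWeightSeq M) {j N : ℕ} (h : j ≤ N) :
    M j ≤ (M (N + 1) / M N) ^ j := by
  induction j with
  | zero => simp [hM.2.2.1]
  | succ j ih =>
    have h1 := hM.ratio_mono (show j ≤ N by omega)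
    simp only at h1
    have hj := hM.pos j
    have e : M (j + 1) = M j * (M (j + 1) / M j) := by field_simp
    rw [e, pow_succ]
    have := hM.pos (j + 1)
    have := hM.pos (N + 1)
    have := hM.pos N
    exact mul_le_mul (ih (by omega)) h1 (by positivity) (by positivity)

lemma pow_le_pow (hM : IsWeightSeq M) {j N : ℕ} (h : j ≤ N) : M j ^ N ≤ M N ^ j := by
  induction N, h using Nat.le_induction with
  | base => exact le_rfl
  | succ N hN ih =>
    have := hM.pos j
    have h0 := hM.pos N
    have := hM.pos (N + 1)
    calc M j ^ (N + 1) = M j ^ N * M j := pow_succ _ _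
      _ ≤ M N ^ j * (M (N + 1) / M N) ^ j := by
        gcongr
        exact hM.le_ratio_pow hN
      _ = M (N + 1) ^ j := by rw [← mul_pow]; congr 1; field_simp

end IsWeightSeq

/-- The `N`-th root of the `N`-th term of the sequence `M`. -/
noncomputable def rootSeq (M : ℕ → ℝ) (N : ℕ) : ℝ := M N ^ (1 / (N : ℝ))

namespace IsWeightSeq

variable {M : ℕ → ℝ}

lemma rootSeq_pow (hM : IsWeightSeq M) {N : ℕ} (hN : N ≠ 0) : rootSeq M N ^ N = M N := by
  rw [rootSeq, one_div]
  exact Real.rpow_inv_natCast_pow (hM.pos N).le hN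

lemma one_le_rootSeq (hM : IsWeightSeq M) (N : ℕ) : 1 ≤ rootSeq M N :=
  Real.one_le_rpow (hM.one_le N) (by positivity)

lemma le_rootSeq_pow (hM : IsWeightSeq M) {j N : ℕ} (hN : N ≠ 0) (h : j ≤ N) :
    M j ≤ rootSeq M N ^ j := by
  have h1 := hM.pow_le_pow h
  have h2 := zero_le_one.trans (hM.one_le_rootSeq N)
  rw [← hM.rootSeq_pow hN, ← pow_mul, mul_comm, pow_mul] at h1
  exact le_of_pow_le_pow_left₀ hN (by positivity) h1

lemma rootSeq_mono (hM : IsWeightSeq M) {j N : ℕ} (hj : j ≠ 0) (h : j ≤ N) :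
    rootSeq M j ≤ rootSeq M N := by
  have h2 := zero_le_one.trans (hM.one_le_rootSeq N)
  have := hM.le_rootSeq_pow (by omega) h
  rw [← hM.rootSeq_pow hj] at this
  exact le_of_pow_le_pow_left₀ hj h2 this

lemma rootSeq_two_mul (hM : IsWeightSeq M) {A : ℝ} (hA : 0 < A)
    (h : ∀ j k : ℕ, M (j + k) ≤ A ^ (j + k) * (M j * M k)) {N : ℕ} (hN : N ≠ 0) :
    rootSeq M (2 * N) ≤ A * rootSeq M N := by
  have h1 := h N N
  have h2 := zero_le_one.trans (hM.one_le_rootSeq N)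
  have hN2 : 2 * N ≠ 0 := by omega
  rw [← two_mul, ← hM.rootSeq_pow hN2, ← hM.rootSeq_pow hN, ← pow_add, ← two_mul, ← mul_pow] at h1
  exact le_of_pow_le_pow_left₀ hN2 (by positivity) h1

lemma tendsto_rootSeq (hM : IsWeightSeq M) : Tendsto (rootSeq M) atTop atTop := hM.2.2.2.2

end IsWeightSeq

/-- The Cauchy–Riemann derivative `∂g/∂z̄` of a function on the complex plane. -/
noncomputable def dbar (g : ℂ → ℂ) (z : ℂ) : ℂ :=
  (fderiv ℝ g z 1 + Complex.I * fderiv ℝ g z Complex.I) / 2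

lemma continuous_dbar {g : ℂ → ℂ} (hg : ContDiff ℝ 1 g) : Continuous (dbar g) := by
  have := hg.continuous_fderiv one_ne_zero
  unfold dbar
  fun_prop

lemma dbar_eq_polar (g : ℂ → ℂ) (w : ℂ) (θ : ℝ) :
    dbar g w / Complex.exp (θ * Complex.I) =
      (fderiv ℝ g w (Complex.exp (θ * Complex.I)) +
        Complex.I * fderiv ℝ g w (Complex.I * Complex.exp (θ * Complex.I))) / 2 := by
  have e1 : Complex.exp (θ * Complex.I) = Real.cos θ • (1 : ℂ) + Real.sin θ • Complex.I := by
    rw [Complex.exp_mul_I]; simp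
  have e2 : Complex.I * Complex.exp (θ * Complex.I) =
      (-Real.sin θ) • (1 : ℂ) + Real.cos θ • Complex.I := by
    rw [e1]; simp only [Complex.real_smul]; push_cast; ring_nf; rw [Complex.I_sq]; ring
  rw [e2, div_eq_iff (Complex.exp_ne_zero _), e1, map_add, map_add, map_smul, map_smul, map_smul,
    map_smul, dbar]
  simp only [Complex.real_smul]
  have hcs : (Real.cos θ : ℂ) ^ 2 = 1 - (Real.sin θ : ℂ) ^ 2 := by
    rw [eq_sub_iff_add_eq]; exact_mod_cast Real.cos_sq_add_sin_sq θ
  generalize fderiv ℝ g w 1 = a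
  generalize fderiv ℝ g w Complex.I = b
  have hI := Complex.I_sq
  push_cast at *
  linear_combination (-(a + Complex.I * b) / 2) * hcs + ((a * Complex.sin θ ^ 2 -
    b * Complex.sin θ * Complex.cos θ) / 2) * hI

/-- The Cauchy–Pompeiu formula for compactly supported functions. -/
theorem cauchy_pompeiu {g : ℂ → ℂ} (hg : ContDiff ℝ 1 g) (hc : HasCompactSupport g) (z : ℂ) :
    ∫ ζ, dbar g ζ / (ζ - z) = -(Real.pi * g z) := by
  have h1 : ∫ ζ, dbar g ζ / (ζ - z) = ∫ ζ, dbar g (z + ζ) / ζ := by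
    rw [← integral_add_left_eq_self (fun ζ => dbar g ζ / (ζ - z)) z]
    simp
  rw [h1, ← Complex.integral_comp_polarCoord_symm]
  set e : ℝ → ℂ := fun θ => Complex.exp (θ * Complex.I) with he
  have hec : Continuous e := by fun_prop
  have hne : ∀ θ, ‖e θ‖ = 1 := fun θ => Complex.norm_exp_ofReal_mul_I θ
  set a : ℝ × ℝ → ℂ := fun p => fderiv ℝ g (z + p.1 * e p.2) (e p.2) with ha
  set b : ℝ × ℝ → ℂ := fun p => fderiv ℝ g (z + p.1 * e p.2) (Complex.I * e p.2) with hb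
  have hfc := hg.continuous_fderiv one_ne_zero
  have hac : Continuous a := by fun_prop
  have hbc : Continuous b := by fun_prop
  obtain ⟨R, hR⟩ : ∃ R : ℝ, ∀ w, R < ‖w‖ → fderiv ℝ g w = 0 := by
    obtain ⟨R, hR⟩ := (hc.fderiv (𝕜 := ℝ)).isCompact.isBounded.subset_closedBall 0
    refine ⟨R, fun w hw => image_eq_zero_of_notMem_tsupport fun h => ?_⟩
    have := hR h
    simp at this; linarith
  have hzero : ∀ p : ℝ × ℝ, R + ‖z‖ < p.1 → fderiv ℝ g (z + p.1 * e p.2) = 0 := by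
    intro p hp
    apply hR
    have h2 : ‖(p.1 : ℂ) * e p.2‖ = |p.1| := by simp [hne]
    have h3 : ‖(p.1 : ℂ) * e p.2‖ ≤ ‖z + p.1 * e p.2‖ + ‖z‖ := by
      have := norm_sub_le (z + p.1 * e p.2) z
      simpa using this
    have := le_abs_self p.1
    linarith
  have hintg : ∀ c : ℝ × ℝ → ℂ, Continuous c → (∀ p : ℝ × ℝ, R + ‖z‖ < p.1 → c p = 0) →
      IntegrableOn c (Ioi (0 : ℝ) ×ˢ Ioo (-Real.pi) Real.pi) := by
    intro c hcc hc0
    have h2 : IntegrableOn c (Icc (0 : ℝ) (R + ‖z‖) ×ˢ Icc (-Real.pi) Real.pi) :=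
      hcc.continuousOn.integrableOn_compact (isCompact_Icc.prod isCompact_Icc)
    refine IntegrableOn.of_forall_sdiff_eq_zero h2 (measurableSet_Ioi.prod measurableSet_Ioo) ?_
    rintro ⟨r, θ⟩ ⟨⟨h3, h4⟩, h5⟩
    apply hc0
    by_contra h6
    exact h5 ⟨⟨le_of_lt h3, not_lt.1 h6⟩, Ioo_subset_Icc_self h4⟩
  have hai := hintg a hac fun p hp => by simp [ha, hzero p hp]
  have hbi := hintg b hbc fun p hp => by simp [hb, hzero p hp]
  have h2 : ∀ p ∈ polarCoord.target, p.1 • (dbar g (z + Complex.polarCoord.symm p) /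
      Complex.polarCoord.symm p) = (a p + Complex.I * b p) / 2 := by
    rintro p ⟨hp, -⟩
    have hp' : (p.1 : ℂ) ≠ 0 := by exact_mod_cast (ne_of_gt hp)
    have h3 : Complex.polarCoord.symm p = p.1 * e p.2 := by
      rw [Complex.polarCoord_symm_apply, he]
      simp only [Complex.exp_mul_I]; push_cast; ring
    rw [h3, ha, hb]
    simp only
    rw [← dbar_eq_polar, Complex.real_smul]
    have h4 : Complex.exp (p.2 * Complex.I) = e p.2 := rfl
    have h5 : e p.2 ≠ 0 := Complex.exp_ne_zero _
    rw [h4]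
    field_simp
  rw [setIntegral_congr_fun polarCoord.open_target.measurableSet h2]
  have hIa : ∫ p in Ioi (0 : ℝ) ×ˢ Ioo (-Real.pi) Real.pi, a p = -(2 * Real.pi * g z) := by
    rw [Measure.volume_eq_prod, ← Measure.prod_restrict, integral_prod_symm]
    · have : ∀ θ : ℝ, ∫ r in Ioi (0 : ℝ), a (r, θ) = - g z := by
        intro θ
        have hd : ∀ r : ℝ, HasDerivAt (fun r : ℝ => g (z + r * e θ)) (a (r, θ)) r := by
          intro r
          have h4 : HasDerivAt (fun r : ℝ => z + r * e θ) (e θ) r := by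
            simpa using ((Complex.ofRealCLM.hasDerivAt (x := r)).mul_const (e θ)).const_add z
          exact ((hg.differentiable one_ne_zero) _).hasFDerivAt.comp_hasDerivAt r h4
        have hcs : HasCompactSupport fun r : ℝ => g (z + r * e θ) := by
          refine hc.comp_isClosedEmbedding (g := fun r : ℝ => z + r * e θ) ?_
          refine Isometry.isClosedEmbedding ?_
          refine Isometry.of_dist_eq fun x y => ?_
          rw [dist_add_left, dist_eq_norm, ← sub_mul, norm_mul, hne, mul_one, ← Complex.ofReal_sub,
            Complex.norm_real, dist_eq_norm]
        have hcd : ContDiff ℝ 1 fun r : ℝ => g (z + r * e θ) := by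
          refine hg.comp ?_
          exact contDiff_const.add (Complex.ofRealCLM.contDiff.mul contDiff_const)
        have := hcs.integral_Ioi_deriv_eq hcd 0
        rw [show (deriv fun r : ℝ => g (z + r * e θ)) = fun r => a (r, θ) from
          funext fun r => (hd r).deriv] at this
        simpa using this
      simp only [this]
      simp [Real.pi_pos.le, ← two_mul]
    · rw [Measure.prod_restrict]; exact hai
  have hIb : ∫ p in Ioi (0 : ℝ) ×ˢ Ioo (-Real.pi) Real.pi, b p = 0 := by
    rw [Measure.volume_eq_prod, setIntegral_prod _ hbi]
    refine setIntegral_eq_zero_of_forall_eq_zero fun r hr => ?_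
    have hr' : (r : ℂ) ≠ 0 := by exact_mod_cast (ne_of_gt hr)
    rw [← integral_Ioc_eq_integral_Ioo, ← intervalIntegral.integral_of_le
      (by linarith [Real.pi_pos])]
    have hd : ∀ θ ∈ uIcc (-Real.pi) Real.pi,
        HasDerivAt (fun θ : ℝ => g (z + r * e θ) / r) (b (r, θ)) θ := by
      intro θ _
      have h5 : HasDerivAt e (Complex.I * e θ) θ := by
        have := ((Complex.ofRealCLM.hasDerivAt (x := θ)).mul_const Complex.I).cexp
        simpa [he, mul_comm] using this
      have h4 : HasDerivAt (fun θ : ℝ => z + r * e θ) ((r : ℝ) • (Complex.I * e θ)) θ := by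
        simpa using (h5.const_mul (r : ℂ)).const_add z
      have := (((hg.differentiable one_ne_zero) _).hasFDerivAt.comp_hasDerivAt θ h4).div_const (r : ℂ)
      rw [map_smul, Complex.real_smul, mul_div_cancel_left₀ _ hr'] at this
      exact this
    rw [intervalIntegral.integral_eq_sub_of_hasDerivAt hd
      ((hbc.comp (by fun_prop : Continuous fun θ : ℝ => (r, θ))).intervalIntegrable _ _)]
    have : e Real.pi = e (-Real.pi) := by
      simp [he, Complex.exp_neg, Complex.exp_pi_mul_I]
    rw [this, sub_self]
  change ∫ p in Ioi (0 : ℝ) ×ˢ Ioo (-Real.pi) Real.pi, (a p + Complex.I * b p) / 2 = _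
  rw [integral_div, integral_add hai (hbi.const_mul _), integral_const_mul, hIa, hIb]
  ring

lemma dbar_mul {f g : ℂ → ℂ} {z : ℂ} (hf : DifferentiableAt ℝ f z) (hg : DifferentiableAt ℝ g z) :
    dbar (fun w => f w * g w) z = f z * dbar g z + g z * dbar f z := by
  unfold dbar
  rw [fderiv_fun_mul hf hg]
  simp only [add_apply, smul_apply, smul_eq_mul]
  ring

lemma DifferentiableAt.dbar_eq_zero {f : ℂ → ℂ} {z : ℂ} (hf : DifferentiableAt ℂ f z) :
    dbar f z = 0 := by
  unfold dbar
  rw [hf.fderiv_restrictScalars ℝ]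
  have : fderiv ℂ f z Complex.I = Complex.I * fderiv ℂ f z 1 := by
    rw [← smul_eq_mul, ← map_smul, smul_eq_mul, mul_one]
  simp only [ContinuousLinearMap.coe_restrictScalars', this]
  linear_combination (fderiv ℂ f z 1 / 2) * Complex.I_sq

lemma Filter.EventuallyEq.dbar_eq {f g : ℂ → ℂ} {z : ℂ} (h : f =ᶠ[𝓝 z] g) :
    dbar f z = dbar g z := by
  unfold dbar
  rw [h.fderiv_eq]

lemma dbar_const (c z : ℂ) : dbar (fun _ => c) z = 0 :=
  (differentiableAt_const c).dbar_eq_zero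

/-- The integral of a Cauchy–Riemann derivative of a compactly supported function vanishes. -/
lemma integral_dbar_eq_zero {g : ℂ → ℂ} (hg : ContDiff ℝ 1 g) (hc : HasCompactSupport g) :
    ∫ z, dbar g z = 0 := by
  have hfc := hg.continuous_fderiv one_ne_zero
  have hi : ∀ v, Integrable fun z => fderiv ℝ g z v := fun v =>
    (by fun_prop : Continuous fun z => fderiv ℝ g z v).integrable_of_hasCompactSupport
      ((hc.fderiv (𝕜 := ℝ)).mono fun z hz => by
        contrapose! hz
        simp only [Function.mem_support, not_not] at hz ⊢
        rw [hz]; rfl)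
  have h0 : ∀ v, ∫ z, fderiv ℝ g z v = 0 := fun v => by
    have := integral_mul_fderiv_eq_neg_fderiv_mul_of_integrable (μ := (volume : Measure ℂ))
      (f := fun _ => (1 : ℂ)) (g := g) (v := v) (by simp) (by simpa using hi v)
      (by simpa using hg.continuous.integrable_of_hasCompactSupport hc)
      (fun _ _ => differentiableAt_const _)
      (fun _ _ => hg.differentiable one_ne_zero _)
    simpa using this
  unfold dbar
  rw [integral_div, integral_add (hi _) ((hi _).const_mul _), integral_const_mul, h0, h0]
  simp

namespace ContDiffBump

/-- A bump function on the complex plane, with complex values. -/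
noncomputable def toComplex (ψ : ContDiffBump (0 : ℂ)) (z : ℂ) : ℂ := (ψ z : ℂ)

variable (ψ : ContDiffBump (0 : ℂ))

lemma contDiff_toComplex {n : ℕ∞} : ContDiff ℝ n ψ.toComplex :=
  Complex.ofRealCLM.contDiff.comp ψ.contDiff

lemma toComplex_eq_zero {z : ℂ} (hz : ψ.rOut ≤ ‖z‖) : ψ.toComplex z = 0 := by
  rw [toComplex, ψ.zero_of_le_dist (by simpa using hz), Complex.ofReal_zero]

lemma toComplex_eq_one {z : ℂ} (hz : ‖z‖ ≤ ψ.rIn) : ψ.toComplex z = 1 := by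
  rw [toComplex, ψ.one_of_mem_closedBall (by simpa using hz), Complex.ofReal_one]

lemma norm_toComplex_le (z : ℂ) : ‖ψ.toComplex z‖ ≤ 1 := by
  rw [toComplex, Complex.norm_real, Real.norm_of_nonneg ψ.nonneg]
  exact ψ.le_one

lemma hasCompactSupport_mul (f : ℂ → ℂ) : HasCompactSupport fun z => ψ.toComplex z * f z := by
  refine ψ.hasCompactSupport.mono fun z hz => ?_
  contrapose! hz
  simp only [Function.mem_support, not_not] at hz ⊢
  simp [toComplex, hz]

lemma dbar_toComplex_eq_zero_of_lt {z : ℂ} (hz : ‖z‖ < ψ.rIn) : dbar ψ.toComplex z = 0 := by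
  rw [← dbar_const 1 z]
  refine Filter.EventuallyEq.dbar_eq ?_
  filter_upwards [continuous_norm.continuousAt.eventually_lt continuousAt_const hz] with w hw
  exact ψ.toComplex_eq_one (le_of_lt hw)

lemma dbar_toComplex_eq_zero_of_gt {z : ℂ} (hz : ψ.rOut < ‖z‖) : dbar ψ.toComplex z = 0 := by
  rw [← dbar_const 0 z]
  refine Filter.EventuallyEq.dbar_eq ?_
  filter_upwards [continuousAt_const.eventually_lt continuous_norm.continuousAt hz] with w hw
  exact ψ.toComplex_eq_zero (le_of_lt hw)

lemma continuous_dbar_toComplex : Continuous (dbar ψ.toComplex) :=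
  continuous_dbar (ψ.contDiff_toComplex (n := 1))

lemma exists_norm_dbar_toComplex_le : ∃ K > 0, ∀ z, ‖dbar ψ.toComplex z‖ ≤ K := by
  obtain ⟨C, hC⟩ := (isCompact_closedBall (0 : ℂ) ψ.rOut).exists_bound_of_continuousOn
    ψ.continuous_dbar_toComplex.continuousOn
  refine ⟨max C 1, by positivity, fun z => ?_⟩
  by_cases hz : ‖z‖ ≤ ψ.rOut
  · exact (hC z (by simpa using hz)).trans (le_max_left _ _)
  · rw [ψ.dbar_toComplex_eq_zero_of_gt (not_le.1 hz), norm_zero]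
    positivity

/-- Interior values of a holomorphic function are controlled by its `L¹` norm. -/
lemma exists_enorm_le_lintegral (ψ : ContDiffBump (0 : ℂ)) {r R : ℝ} (hr : r < ψ.rIn)
    (hR : ψ.rOut < R) :
    ∃ K > 0, ∀ H : ℂ → ℂ, DifferentiableOn ℂ H (Metric.ball 0 R) → ∀ w, ‖w‖ < r →
      ‖H w‖ₑ ≤ ENNReal.ofReal K * ∫⁻ z in Metric.ball 0 R, ‖H z‖ₑ := by
  obtain ⟨K, hK, hKb⟩ := ψ.exists_norm_dbar_toComplex_le
  have hd : 0 < ψ.rIn - r := by linarith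
  refine ⟨K / (ψ.rIn - r), by positivity, fun H hH w hw => ?_⟩
  have hHd : ∀ z, ‖z‖ < R → DifferentiableAt ℂ H z := fun z hz =>
    hH.differentiableAt (Metric.isOpen_ball.mem_nhds (by simpa using hz))
  have hHR : ∀ z, ‖z‖ < R → DifferentiableAt ℝ H z := fun z hz =>
    (hHd z hz).restrictScalars ℝ
  set g : ℂ → ℂ := fun z => ψ.toComplex z * H z with hg
  have hg0 : ∀ z, ψ.rOut < ‖z‖ → g =ᶠ[𝓝 z] fun _ => 0 := by
    intro z hz
    filter_upwards [continuousAt_const.eventually_lt continuous_norm.continuousAt hz] with v hv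
    simp [hg, ψ.toComplex_eq_zero (le_of_lt hv)]
  have hgc : ContDiff ℝ 1 g := by
    rw [contDiff_iff_contDiffAt]
    intro z
    by_cases hz : ‖z‖ < R
    · refine (ψ.contDiff_toComplex (n := 1)).contDiffAt.mul ?_
      exact ((hH.analyticAt (Metric.isOpen_ball.mem_nhds (by simpa using hz))).contDiffAt
        (n := 1)).restrict_scalars ℝ
    · exact contDiffAt_const.congr_of_eventuallyEq (hg0 z (by linarith))
  have hP := cauchy_pompeiu hgc (ψ.hasCompactSupport_mul H) w
  have hgw : g w = H w := by simp [hg, ψ.toComplex_eq_one (show ‖w‖ ≤ ψ.rIn by linarith)]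
  have hbd : ∀ z, ‖dbar g z / (z - w)‖ₑ ≤
      (Metric.ball (0 : ℂ) R).indicator (fun z => ENNReal.ofReal (K / (ψ.rIn - r)) * ‖H z‖ₑ) z := by
    intro z
    by_cases hz : ‖z‖ < R
    · rw [indicator_of_mem (by simpa using hz), hg,
        dbar_mul ((ψ.contDiff_toComplex (n := 1)).differentiable one_ne_zero z) (hHR z hz),
        (hHd z hz).dbar_eq_zero, mul_zero, zero_add]
      by_cases hz2 : ‖z‖ < ψ.rIn
      · simp [ψ.dbar_toComplex_eq_zero_of_lt hz2]
      · rw [← ofReal_norm, ← ofReal_norm, ← ENNReal.ofReal_mul (by positivity)]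
        apply ENNReal.ofReal_le_ofReal
        have h1 : ψ.rIn - r ≤ ‖z - w‖ := by
          have := norm_sub_norm_le z w
          linarith
        rw [norm_div, norm_mul, div_mul_eq_mul_div, mul_comm]
        have := hKb z
        gcongr
    · rw [(hg0 z (by linarith)).dbar_eq, dbar_const]
      simp
  have h2 : ‖H w‖ₑ ≤ ‖((Real.pi : ℂ) * H w)‖ₑ := by
    rw [← ofReal_norm, ← ofReal_norm]
    apply ENNReal.ofReal_le_ofReal
    rw [norm_mul, Complex.norm_real, Real.norm_of_nonneg Real.pi_pos.le]
    have := Real.pi_gt_three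
    nlinarith [norm_nonneg (H w)]
  calc ‖H w‖ₑ ≤ ‖((Real.pi : ℂ) * H w)‖ₑ := h2
    _ = ‖∫ z, dbar g z / (z - w)‖ₑ := by rw [hP, hgw, enorm_neg]
    _ ≤ ∫⁻ z, ‖dbar g z / (z - w)‖ₑ := enorm_integral_le_lintegral_enorm _
    _ ≤ ∫⁻ z, (Metric.ball (0 : ℂ) R).indicator
          (fun z => ENNReal.ofReal (K / (ψ.rIn - r)) * ‖H z‖ₑ) z := lintegral_mono hbd
    _ = _ := by
      rw [lintegral_indicator Metric.isOpen_ball.measurableSet,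
        lintegral_const_mul' _ _ ENNReal.ofReal_ne_top]

end ContDiffBump

/-- The Cauchy kernel is integrable, uniformly over bounded sets. -/
lemma lintegral_enorm_inv_sub_le {ζ : ℂ} (hζ : ‖ζ‖ ≤ 1) {r : ℝ} (hr : r ≤ 1) :
    ∫⁻ z in Metric.ball (0 : ℂ) r, ‖(ζ - z)⁻¹‖ₑ ≤ ENNReal.ofReal (4 * Real.pi) := by
  have h1 : ∫⁻ z in Metric.ball (0 : ℂ) r, ‖(ζ - z)⁻¹‖ₑ ≤
      ∫⁻ z, (Metric.ball (0 : ℂ) 2).indicator (fun w => ‖w⁻¹‖ₑ) (ζ - z) := by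
    rw [← lintegral_indicator Metric.isOpen_ball.measurableSet]
    refine lintegral_mono fun z => ?_
    by_cases hz : z ∈ Metric.ball (0 : ℂ) r
    · rw [indicator_of_mem hz, indicator_of_mem]
      have := norm_sub_le ζ z
      simp only [mem_ball_zero_iff] at hz ⊢
      linarith
    · rw [indicator_of_notMem hz]; exact zero_le
  refine h1.trans ?_
  rw [lintegral_sub_left_eq_self (fun w => (Metric.ball (0 : ℂ) 2).indicator (fun w => ‖w⁻¹‖ₑ) w) ζ,
    ← Complex.lintegral_comp_polarCoord_symm]
  calc ∫⁻ p in polarCoord.target, ENNReal.ofReal p.1 •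
        (Metric.ball (0 : ℂ) 2).indicator (fun w => ‖w⁻¹‖ₑ) (Complex.polarCoord.symm p)
      ≤ ∫⁻ p in polarCoord.target,
        (Ioo (0 : ℝ) 2 ×ˢ Ioo (-Real.pi) Real.pi).indicator (fun _ => 1) p := by
        refine setLIntegral_mono' polarCoord.open_target.measurableSet fun p hp => ?_
        have hn : ‖Complex.polarCoord.symm p‖ = p.1 := by
          rw [Complex.norm_polarCoord_symm, abs_of_pos hp.1]
        by_cases h2 : p.1 < 2
        · have hm : p ∈ Ioo (0 : ℝ) 2 ×ˢ Ioo (-Real.pi) Real.pi := ⟨⟨hp.1, h2⟩, hp.2⟩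
          rw [indicator_of_mem (by rw [mem_ball_zero_iff, hn]; exact h2), indicator_of_mem hm,
            ← ofReal_norm, norm_inv, hn, smul_eq_mul, ← ENNReal.ofReal_mul hp.1.out.le,
            mul_inv_cancel₀ hp.1.out.ne', ENNReal.ofReal_one]
        · rw [indicator_of_notMem (by rw [mem_ball_zero_iff, hn]; exact h2)]
          simp
    _ ≤ ∫⁻ p : ℝ × ℝ, (Ioo (0 : ℝ) 2 ×ˢ Ioo (-Real.pi) Real.pi).indicator (fun _ => 1) p :=
        setLIntegral_le_lintegral _ _
    _ = ENNReal.ofReal (4 * Real.pi) := by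
        rw [lintegral_indicator (measurableSet_Ioo.prod measurableSet_Ioo), setLIntegral_one,
          Measure.volume_eq_prod, Measure.prod_prod, Real.volume_Ioo, Real.volume_Ioo,
          ← ENNReal.ofReal_mul (by norm_num)]
        congr 1; ring

namespace ContDiffBump

variable (ψ : ContDiffBump (0 : ℂ))

/-- The Cauchy transform of `F * ∂̄ψ`, the holomorphic part of `F` near the origin. -/
noncomputable def holomorphicPart (F : ℂ → ℂ) (z : ℂ) : ℂ :=
  -(Real.pi : ℂ)⁻¹ * ∫ ζ, F ζ * dbar ψ.toComplex ζ * (ζ - z)⁻¹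

lemma mul_dbar_eq_zero_of_gt (F : ℂ → ℂ) {ζ : ℂ} (h : ψ.rOut < ‖ζ‖) :
    F ζ * dbar ψ.toComplex ζ = 0 := by
  rw [ψ.dbar_toComplex_eq_zero_of_gt h, mul_zero]

lemma exists_norm_mul_dbar_mul_le {r : ℝ} (hr : r < ψ.rIn) (hR : ψ.rOut < 1) :
    ∃ K > 0, ∀ (B : ℝ) (F : ℂ → ℂ), (∀ z, ‖z‖ < 1 → ‖F z‖ ≤ B) → 0 ≤ B →
      ∀ z ζ, ‖z‖ < r → ‖F ζ * dbar ψ.toComplex ζ * (ζ - z)⁻¹‖ ≤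
        (Metric.ball (0 : ℂ) 1).indicator (fun _ => K * B) ζ ∧
        ‖F ζ * dbar ψ.toComplex ζ * ((ζ - z) ^ 2)⁻¹‖ ≤
        (Metric.ball (0 : ℂ) 1).indicator (fun _ => K * B) ζ := by
  obtain ⟨K, hK, hKb⟩ := ψ.exists_norm_dbar_toComplex_le
  have hd : 0 < ψ.rIn - r := by linarith
  refine ⟨K * (ψ.rIn - r)⁻¹ + K * ((ψ.rIn - r) ^ 2)⁻¹, by positivity, fun B F hF hB z ζ hz => ?_⟩
  by_cases h1 : ‖ζ‖ < 1
  · rw [indicator_of_mem (by simpa using h1)]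
    by_cases h2 : ‖ζ‖ < ψ.rIn
    · rw [ψ.dbar_toComplex_eq_zero_of_lt h2]
      simp only [mul_zero, zero_mul, norm_zero]
      constructor <;> positivity
    · have h3 : ψ.rIn - r ≤ ‖ζ - z‖ := by
        have := norm_sub_norm_le ζ z
        linarith
      have h4 := hF ζ h1
      have h5 := hKb ζ
      constructor
      · calc ‖F ζ * dbar ψ.toComplex ζ * (ζ - z)⁻¹‖ = ‖F ζ‖ * ‖dbar ψ.toComplex ζ‖ * ‖ζ - z‖⁻¹ := by
              rw [norm_mul, norm_mul, norm_inv]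
          _ ≤ B * K * (ψ.rIn - r)⁻¹ := by gcongr
          _ ≤ _ := by
            have : 0 ≤ B * (K * ((ψ.rIn - r) ^ 2)⁻¹) := by positivity
            linarith
      · calc ‖F ζ * dbar ψ.toComplex ζ * ((ζ - z) ^ 2)⁻¹‖
            = ‖F ζ‖ * ‖dbar ψ.toComplex ζ‖ * (‖ζ - z‖ ^ 2)⁻¹ := by
              rw [norm_mul, norm_mul, norm_inv, norm_pow]
          _ ≤ B * K * ((ψ.rIn - r) ^ 2)⁻¹ := by gcongr
          _ ≤ _ := by
            have : 0 ≤ B * (K * (ψ.rIn - r)⁻¹) := by positivity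
            linarith
  · rw [indicator_of_notMem (by simpa using h1), ψ.mul_dbar_eq_zero_of_gt F (by linarith)]
    simp

lemma integrable_indicator_ball_one (c : ℝ) :
    Integrable ((Metric.ball (0 : ℂ) 1).indicator fun _ => c) :=
  (integrable_indicator_iff Metric.isOpen_ball.measurableSet).2
    (integrableOn_const (Metric.isBounded_ball.measure_lt_top.ne))

/-- A bounded function with small `∂̄` is close in `L¹` to a bounded holomorphic function. -/
lemma exists_holomorphicPart_bound {r : ℝ} (hr : r < ψ.rIn) (hR : ψ.rOut < 1) :
    ∃ K > 0, ∀ (B : ℝ) (F : ℂ → ℂ), ContDiff ℝ 1 F → (∀ z, ‖z‖ < 1 → ‖F z‖ ≤ B) → 0 ≤ B →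
      ∀ κ : ℝ, ∫⁻ z, ‖ψ.toComplex z * dbar F z‖ₑ ≤ ENNReal.ofReal κ →
      DifferentiableOn ℂ (ψ.holomorphicPart F) (Metric.ball 0 r) ∧
      (∀ z, ‖z‖ < r → ‖ψ.holomorphicPart F z‖ ≤ K * B) ∧
      ∫⁻ z in Metric.ball 0 r, ‖F z - ψ.holomorphicPart F z‖ₑ ≤ ENNReal.ofReal (K * κ) := by
  obtain ⟨K, hK, hKb⟩ := ψ.exists_norm_mul_dbar_mul_le hr hR
  have hr1 : r ≤ 1 := by linarith [ψ.rIn_lt_rOut]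
  have hpi := Real.pi_gt_three
  have hpin : ‖-(Real.pi : ℂ)⁻¹‖ ≤ 1 := by
    rw [norm_neg, norm_inv, Complex.norm_real, Real.norm_of_nonneg Real.pi_pos.le]
    exact inv_le_one_of_one_le₀ (by linarith)
  refine ⟨K * (volume (Metric.ball (0 : ℂ) 1)).toReal + 4 * Real.pi, by positivity,
    fun B F hFc hFB hB κ hκ => ?_⟩
  have hm : ∀ z, AEStronglyMeasurable (fun ζ => F ζ * dbar ψ.toComplex ζ * (ζ - z)⁻¹) :=
    fun z => ((hFc.continuous.mul ψ.continuous_dbar_toComplex).measurable.mul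
      (measurable_id.sub_const z).inv).aestronglyMeasurable
  have hintg : ∀ z, ‖z‖ < r → Integrable fun ζ => F ζ * dbar ψ.toComplex ζ * (ζ - z)⁻¹ :=
    fun z hz => (integrable_indicator_ball_one (K * B)).mono' (hm z)
      (ae_of_all _ fun ζ => (hKb B F hFB hB z ζ hz).1)
  refine ⟨?_, ?_, ?_⟩
  · intro z hz
    have hball : Metric.ball (0 : ℂ) r ∈ 𝓝 z := Metric.isOpen_ball.mem_nhds hz
    have := hasDerivAt_integral_of_dominated_loc_of_deriv_le (μ := (volume : Measure ℂ))
      (F := fun z ζ => F ζ * dbar ψ.toComplex ζ * (ζ - z)⁻¹)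
      (F' := fun z ζ => F ζ * dbar ψ.toComplex ζ * ((ζ - z) ^ 2)⁻¹)
      (bound := (Metric.ball (0 : ℂ) 1).indicator fun _ => K * B) (x₀ := z)
      hball (Eventually.of_forall hm) (hintg z (by simpa using hz))
      (((hFc.continuous.mul ψ.continuous_dbar_toComplex).measurable.mul
        ((measurable_id.sub_const z).pow_const 2).inv).aestronglyMeasurable)
      (ae_of_all _ fun ζ w hw => (hKb B F hFB hB w ζ (by simpa using hw)).2)
      (integrable_indicator_ball_one _)
      (ae_of_all _ fun ζ w hw => ?_)
    · exact (this.2.const_mul _).differentiableAt.differentiableWithinAt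
    · by_cases h : ζ - w = 0
      · have h2 : ‖ζ‖ < ψ.rIn := by
          rw [sub_eq_zero.1 h]
          have := mem_ball_zero_iff.1 hw
          linarith
        have h3 := ψ.dbar_toComplex_eq_zero_of_lt h2
        simpa [h3] using hasDerivAt_const w (0 : ℂ)
      · have h3 := (((hasDerivAt_id w).const_sub ζ).inv h).const_mul (F ζ * dbar ψ.toComplex ζ)
        rw [neg_neg, one_div] at h3
        exact h3
  · intro z hz
    calc ‖ψ.holomorphicPart F z‖ ≤ 1 * ‖∫ ζ, F ζ * dbar ψ.toComplex ζ * (ζ - z)⁻¹‖ := by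
          rw [holomorphicPart, norm_mul]; gcongr
      _ ≤ 1 * ∫ ζ, (Metric.ball (0 : ℂ) 1).indicator (fun _ => K * B) ζ := by
          gcongr
          exact norm_integral_le_of_norm_le (integrable_indicator_ball_one _)
            (ae_of_all _ fun ζ => (hKb B F hFB hB z ζ hz).1)
      _ = K * (volume (Metric.ball (0 : ℂ) 1)).toReal * B := by
          rw [integral_indicator Metric.isOpen_ball.measurableSet, setIntegral_const,
            Measure.real, smul_eq_mul]
          ring
      _ ≤ _ := by
          have : 0 ≤ 4 * Real.pi * B := by positivity
          linarith
  · set G : ℂ → ℂ := fun z => ψ.toComplex z * dbar F z with hG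
    have hGc : Continuous G := ψ.contDiff_toComplex (n := 1) |>.continuous.mul (continuous_dbar hFc)
    have hG0 : ∀ ζ, ¬ ‖ζ‖ ≤ 1 → G ζ = 0 := fun ζ h => by
      simp [hG, ψ.toComplex_eq_zero (show ψ.rOut ≤ ‖ζ‖ by linarith)]
    have hgc : ContDiff ℝ 1 fun z => ψ.toComplex z * F z :=
      (ψ.contDiff_toComplex (n := 1)).mul hFc
    have hdb : ∀ ζ, dbar (fun z => ψ.toComplex z * F z) ζ = G ζ + F ζ * dbar ψ.toComplex ζ :=
      fun ζ => dbar_mul ((ψ.contDiff_toComplex (n := 1)).differentiable one_ne_zero ζ)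
        (hFc.differentiable one_ne_zero ζ)
    obtain ⟨C, hC⟩ := (isCompact_closedBall (0 : ℂ) 1).exists_bound_of_continuousOn hGc.continuousOn
    have hGi : ∀ z, ‖z‖ ≤ 1 → Integrable fun ζ => G ζ * (ζ - z)⁻¹ := by
      intro z hz
      refine ⟨(hGc.measurable.mul (measurable_id.sub_const z).inv).aestronglyMeasurable, ?_⟩
      calc ∫⁻ ζ, ‖G ζ * (ζ - z)⁻¹‖ₑ
          ≤ ∫⁻ ζ, (Metric.ball (0 : ℂ) 1).indicator
              (fun ζ => ENNReal.ofReal C * ‖(z - ζ)⁻¹‖ₑ) ζ := by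
            refine lintegral_mono fun ζ => ?_
            by_cases hζ : ‖ζ‖ < 1
            · rw [indicator_of_mem (by simpa using hζ), enorm_mul, ← enorm_neg (ζ - z)⁻¹,
                ← inv_neg, neg_sub, ← ofReal_norm (G ζ)]
              gcongr
              exact hC ζ (by simpa using hζ.le)
            · simp [hG, ψ.toComplex_eq_zero (show ψ.rOut ≤ ‖ζ‖ by linarith)]
        _ = ENNReal.ofReal C * ∫⁻ ζ in Metric.ball (0 : ℂ) 1, ‖(z - ζ)⁻¹‖ₑ := by
            rw [lintegral_indicator Metric.isOpen_ball.measurableSet,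
              lintegral_const_mul' _ _ ENNReal.ofReal_ne_top]
        _ ≤ ENNReal.ofReal C * ENNReal.ofReal (4 * Real.pi) := by
            gcongr
            exact lintegral_enorm_inv_sub_le hz le_rfl
        _ < ⊤ := ENNReal.mul_lt_top ENNReal.ofReal_lt_top ENNReal.ofReal_lt_top
    have hkey : ∀ z, ‖z‖ < r → F z - ψ.holomorphicPart F z =
        -(Real.pi : ℂ)⁻¹ * ∫ ζ, G ζ * (ζ - z)⁻¹ := by
      intro z hz
      have hP := cauchy_pompeiu hgc (ψ.hasCompactSupport_mul F) z
      simp only [hdb, div_eq_mul_inv, add_mul] at hP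
      rw [integral_add (hGi z (by linarith)) (hintg z hz),
        ψ.toComplex_eq_one (show ‖z‖ ≤ ψ.rIn by linarith), one_mul] at hP
      have hpi0 : (Real.pi : ℂ) ≠ 0 := by exact_mod_cast Real.pi_ne_zero
      rw [holomorphicPart, eq_sub_of_add_eq hP]
      field_simp
      ring
    calc ∫⁻ z in Metric.ball 0 r, ‖F z - ψ.holomorphicPart F z‖ₑ
        ≤ ∫⁻ z in Metric.ball 0 r, ∫⁻ ζ, ‖G ζ‖ₑ * ‖(ζ - z)⁻¹‖ₑ := by
          refine setLIntegral_mono' Metric.isOpen_ball.measurableSet fun z hz => ?_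
          rw [hkey z (by simpa using hz), enorm_mul]
          calc _ ≤ 1 * ∫⁻ ζ, ‖G ζ * (ζ - z)⁻¹‖ₑ := by
                gcongr
                · rw [← ofReal_norm]
                  exact ENNReal.ofReal_le_one.2 hpin
                · exact enorm_integral_le_lintegral_enorm _
            _ = _ := by simp only [one_mul, enorm_mul]
      _ = ∫⁻ ζ, ∫⁻ z in Metric.ball 0 r, ‖G ζ‖ₑ * ‖(ζ - z)⁻¹‖ₑ := by
          refine lintegral_lintegral_swap ?_
          refine Measurable.aemeasurable ?_
          have h1 : Measurable fun p : ℂ × ℂ => ‖G p.2‖ₑ :=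
            (hGc.measurable.comp measurable_snd).enorm
          have h2 : Measurable fun p : ℂ × ℂ => ‖(p.2 - p.1)⁻¹‖ₑ :=
            (measurable_snd.sub measurable_fst).inv.enorm
          exact h1.mul h2
      _ ≤ ∫⁻ ζ, ‖G ζ‖ₑ * ENNReal.ofReal (4 * Real.pi) := by
          refine lintegral_mono fun ζ => ?_
          by_cases hζ : ‖ζ‖ ≤ 1
          · rw [lintegral_const_mul' _ _ enorm_ne_top]
            gcongr
            exact lintegral_enorm_inv_sub_le hζ hr1
          · simp [hG0 ζ hζ]
      _ = (∫⁻ ζ, ‖G ζ‖ₑ) * ENNReal.ofReal (4 * Real.pi) :=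
          lintegral_mul_const' _ _ ENNReal.ofReal_ne_top
      _ ≤ ENNReal.ofReal κ * ENNReal.ofReal (4 * Real.pi) := by gcongr
      _ ≤ _ := by
        by_cases hκ0 : 0 ≤ κ
        · rw [← ENNReal.ofReal_mul hκ0]
          apply ENNReal.ofReal_le_ofReal
          have : 0 ≤ K * (volume (Metric.ball (0 : ℂ) 1)).toReal * κ := by positivity
          linarith
        · simp [ENNReal.ofReal_of_nonpos (not_le.1 hκ0).le]

end ContDiffBump

open ComplexConjugate in
lemma dbar_conj {P : ℂ → ℂ} {z : ℂ} (hP : DifferentiableAt ℂ P z) :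
    dbar (fun w => conj (P w)) z = conj (deriv P z) := by
  have h : HasFDerivAt (fun w => conj (P w))
      ((Complex.conjCLE : ℂ →L[ℝ] ℂ).comp ((fderiv ℂ P z).restrictScalars ℝ)) z :=
    (Complex.conjCLE : ℂ →L[ℝ] ℂ).hasFDerivAt.comp z (hP.hasFDerivAt.restrictScalars ℝ)
  unfold dbar
  rw [h.fderiv]
  have h1 : fderiv ℂ P z Complex.I = Complex.I * deriv P z := by
    rw [← fderiv_apply_one_eq_deriv, ← smul_eq_mul, ← map_smul, smul_eq_mul, mul_one]
  simp only [ContinuousLinearMap.comp_apply, ContinuousLinearMap.coe_restrictScalars', h1,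
    fderiv_apply_one_eq_deriv, ContinuousLinearEquiv.coe_coe, Complex.conjCLE_apply, map_mul,
    Complex.conj_I]
  linear_combination (-conj (deriv P z) / 2) * Complex.I_sq

lemma dbar_comp {φ g : ℂ → ℂ} {φ' z : ℂ} (hφ : HasDerivAt φ φ' (g z))
    (hg : DifferentiableAt ℝ g z) : dbar (fun w => φ (g w)) z = φ' * dbar g z := by
  have h : HasFDerivAt (fun w => φ (g w)) _ z :=
    (hφ.hasFDerivAt.restrictScalars ℝ).comp z hg.hasFDerivAt
  unfold dbar
  rw [h.fderiv]
  simp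
  ring

section Regularization

open ComplexConjugate

variable {P : ℂ → ℂ} {ρ : ℂ → ℝ} {s : ℝ}

lemma dbar_of_pow_four_eq (hP : Differentiable ℂ P) (hρ : ContDiff ℝ 1 ρ)
    (h4 : ∀ z, ρ z ^ 4 = ‖P z‖ ^ 2 + s ^ 2) (z : ℂ) :
    4 * (ρ z : ℂ) ^ 3 * dbar (fun w => (ρ w : ℂ)) z = P z * conj (deriv P z) := by
  have hρd : DifferentiableAt ℝ (fun w => (ρ w : ℂ)) z :=
    Complex.ofRealCLM.differentiableAt.comp z (hρ.differentiable one_ne_zero z)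
  have hc : DifferentiableAt ℝ (fun w => conj (P w)) z :=
    (Complex.conjCLE : ℂ →L[ℝ] ℂ).differentiableAt.comp z ((hP z).restrictScalars ℝ)
  have h1 := dbar_comp (hasDerivAt_pow 4 (ρ z : ℂ)) hρd
  have h2 : (fun w => (ρ w : ℂ) ^ 4) = fun w => P w * conj (P w) + (s : ℂ) ^ 2 := by
    ext w
    rw [Complex.mul_conj, Complex.normSq_eq_norm_sq]
    exact_mod_cast h4 w
  have h3 : dbar (fun w => P w * conj (P w) + (s : ℂ) ^ 2) z = P z * conj (deriv P z) := by
    have : dbar (fun w => P w * conj (P w) + (s : ℂ) ^ 2) z =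
        dbar (fun w => P w * conj (P w)) z := by
      unfold dbar
      rw [fderiv_add_const]
    rw [this, dbar_mul ((hP z).restrictScalars ℝ) hc, dbar_conj (hP z), (hP z).dbar_eq_zero]
    ring
  rw [h2, h3] at h1
  rw [h1]
  push_cast
  ring

lemma contDiff_ofReal_inv_pow (hρ : ContDiff ℝ 1 ρ) (h0 : ∀ z, 0 < ρ z) (k : ℕ) :
    ContDiff ℝ 1 fun z => ((ρ z : ℂ) ^ k)⁻¹ :=
  ((Complex.ofRealCLM.contDiff.comp hρ).pow k).inv fun z =>
    pow_ne_zero _ (Complex.ofReal_ne_zero.2 (h0 z).ne')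

lemma dbar_mul_conj_mul_inv_pow {G : ℂ → ℂ} (hG : Differentiable ℂ G)
    (hP : Differentiable ℂ P) (hρ : ContDiff ℝ 1 ρ) (h0 : ∀ z, 0 < ρ z)
    (h4 : ∀ z, ρ z ^ 4 = ‖P z‖ ^ 2 + s ^ 2) (k : ℕ) (z : ℂ) :
    dbar (fun w => G w * (conj (P w) * ((ρ w : ℂ) ^ k)⁻¹)) z =
      G z * (conj (deriv P z) * (((4 - k) * ‖P z‖ ^ 2 + 4 * s ^ 2 : ℝ) : ℂ)) /
        (4 * (ρ z : ℂ) ^ (k + 4)) := by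
  have hz : (ρ z : ℂ) ≠ 0 := Complex.ofReal_ne_zero.2 (h0 z).ne'
  have hρd : DifferentiableAt ℝ (fun w => (ρ w : ℂ)) z :=
    Complex.ofRealCLM.differentiableAt.comp z (hρ.differentiable one_ne_zero z)
  have hc : DifferentiableAt ℝ (fun w => conj (P w)) z :=
    (Complex.conjCLE : ℂ →L[ℝ] ℂ).differentiableAt.comp z ((hP z).restrictScalars ℝ)
  have hi : DifferentiableAt ℝ (fun w => ((ρ w : ℂ) ^ k)⁻¹) z :=
    (contDiff_ofReal_inv_pow hρ h0 k).differentiable one_ne_zero z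
  have h1 := dbar_comp ((hasDerivAt_pow k (ρ z : ℂ)).inv (pow_ne_zero _ hz)) hρd
  have h2 := dbar_of_pow_four_eq hP hρ h4 z
  have h5 : (ρ z : ℂ) ^ 4 = P z * conj (P z) + (s : ℂ) ^ 2 := by
    rw [Complex.mul_conj, Complex.normSq_eq_norm_sq]
    exact_mod_cast h4 z
  have h6 : ((‖P z‖ : ℝ) : ℂ) ^ 2 = P z * conj (P z) := by
    rw [Complex.mul_conj, Complex.normSq_eq_norm_sq]; push_cast; rfl
  have h7 : (k : ℂ) * (ρ z : ℂ) ^ (k - 1) * ρ z = k * (ρ z : ℂ) ^ k := by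
    rcases k with _ | k
    · simp
    · simp [pow_succ]; ring
  have h8 : dbar (fun w => ((ρ w : ℂ) ^ k)⁻¹) z =
      -(k * (P z * conj (deriv P z))) / (4 * (ρ z : ℂ) ^ (k + 4)) := by
    refine Eq.trans h1 ?_
    rw [← h2, div_mul_eq_mul_div, div_eq_div_iff (pow_ne_zero _ (pow_ne_zero _ hz))
      (mul_ne_zero (by norm_num) (pow_ne_zero _ hz))]
    linear_combination (-4 * (ρ z : ℂ) ^ (k + 3) * dbar (fun w => (ρ w : ℂ)) z) * h7
  rw [dbar_mul ((hG z).restrictScalars ℝ) (hc.fun_mul hi), dbar_mul hc hi, dbar_conj (hP z), h8,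
    (hG z).dbar_eq_zero]
  push_cast
  rw [h6]
  field_simp
  linear_combination (4 * G z * conj (deriv P z) * (ρ z : ℂ) ^ k) * h5

end Regularization

section Regularization

open ComplexConjugate

variable {P : ℂ → ℂ} {ρ : ℂ → ℝ} {s : ℝ}

lemma norm_le_sq_of_pow_four_eq
    (h4 : ∀ z, ρ z ^ 4 = ‖P z‖ ^ 2 + s ^ 2) (z : ℂ) : ‖P z‖ ≤ ρ z ^ 2 :=
  abs_le_of_sq_le_sq' (by nlinarith [h4 z, sq_nonneg s]) (sq_nonneg _) |>.2

/-- A Caccioppoli inequality for holomorphic functions. -/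
lemma ContDiffBump.exists_caccioppoli (ψ : ContDiffBump (0 : ℂ)) (hψ : ψ.rOut < 1) :
    ∃ K > 0, ∀ (P : ℂ → ℂ) (ρ : ℂ → ℝ) (s B : ℝ), Differentiable ℂ P → ContDiff ℝ 1 ρ →
      (∀ z, 0 < ρ z) → (∀ z, ρ z ^ 4 = ‖P z‖ ^ 2 + s ^ 2) → (∀ z, ‖z‖ < 1 → ρ z ≤ B) → 0 ≤ B →
      ∫⁻ z, ENNReal.ofReal (ψ z ^ 2 * (‖deriv P z‖ ^ 2 / ρ z ^ 3)) ≤ ENNReal.ofReal (K * B) := by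
  obtain ⟨K, hK, hKb⟩ := ψ.exists_norm_dbar_toComplex_le
  set V := (volume (Metric.ball (0 : ℂ) 1)).toReal with hV
  refine ⟨64 * K ^ 2 * V + 1, by positivity, fun P ρ s B hP hρ h0 h4 hB hB0 => ?_⟩
  have hP' : Differentiable ℂ (deriv P) := (hP.contDiff (n := 2)).deriv' (n := 1) |>.differentiable one_ne_zero
  set W : ℂ → ℂ := fun w => deriv P w * (conj (P w) * ((ρ w : ℂ) ^ 3)⁻¹) with hW
  set g : ℂ → ℂ := fun z => ψ.toComplex z * (ψ.toComplex z * W z) with hg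
  have hψc := ψ.contDiff_toComplex (n := 1)
  have hWc : ContDiff ℝ 1 W :=
    (hP'.contDiff.restrict_scalars ℝ).mul (((Complex.conjCLE : ℂ →L[ℝ] ℂ).contDiff.comp
      (hP.contDiff.restrict_scalars ℝ)).mul (contDiff_ofReal_inv_pow hρ h0 3))
  have hgc : ContDiff ℝ 1 g := hψc.mul (hψc.mul hWc)
  have hsupp : HasCompactSupport g := ψ.hasCompactSupport_mul _
  have hintg := integral_dbar_eq_zero hgc hsupp
  set E : ℂ → ℝ := fun z => ψ z ^ 2 * (‖deriv P z‖ ^ 2 / ρ z ^ 3) with hE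
  have hEc : Continuous E := by
    have h1 : Continuous (deriv P) := hP'.continuous
    have h2 := hρ.continuous
    have h3 : Continuous ψ := ψ.contDiff (n := 1) |>.continuous
    refine (h3.pow 2).mul ((h1.norm.pow 2).div (h2.pow 3) fun z => (pow_pos (h0 z) 3).ne')
  have hEi : Integrable E := hEc.integrable_of_hasCompactSupport
    (ψ.hasCompactSupport.mono fun z hz => by
      contrapose! hz
      simp only [Function.mem_support, not_not] at hz ⊢
      simp [hE, hz])
  have hE0 : ∀ z, 0 ≤ E z := fun z => by have := h0 z; positivity
  have hpt : ∀ z, E z / 8 - (Metric.ball (0 : ℂ) 1).indicator (fun _ => 8 * K ^ 2 * B) z ≤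
      (dbar g z).re := by
    intro z
    have hr := h0 z
    have hd : dbar g z = ((E z * (‖P z‖ ^ 2 + 4 * s ^ 2) / (4 * ρ z ^ 4) : ℝ) : ℂ) +
        2 * (ψ.toComplex z * W z * dbar ψ.toComplex z) := by
      have h1 := hψc.differentiable one_ne_zero z
      have h2 := hWc.differentiable one_ne_zero z
      rw [hg, dbar_mul h1 (h1.fun_mul h2), dbar_mul h1 h2, hW,
        dbar_mul_conj_mul_inv_pow hP' hP hρ h0 h4 3 z]
      have h5 : ((‖deriv P z‖ : ℝ) : ℂ) ^ 2 = deriv P z * conj (deriv P z) := by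
        rw [Complex.mul_conj, Complex.normSq_eq_norm_sq]; push_cast; rfl
      have hz : (ρ z : ℂ) ≠ 0 := Complex.ofReal_ne_zero.2 hr.ne'
      simp only [hE, ContDiffBump.toComplex]
      push_cast
      rw [h5]
      field_simp
      ring
    have h6 : E z / 4 ≤ E z * (‖P z‖ ^ 2 + 4 * s ^ 2) / (4 * ρ z ^ 4) := by
      rw [h4 z, div_le_div_iff₀ (by norm_num) (by rw [← h4 z]; positivity)]
      nlinarith [mul_nonneg (hE0 z) (sq_nonneg s)]
    by_cases hz : ‖z‖ < 1
    · rw [indicator_of_mem (by simpa using hz), hd, Complex.add_re, Complex.ofReal_re]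
      have h7 : -(2 * (ψ z * (‖deriv P z‖ / ρ z) * ‖dbar ψ.toComplex z‖)) ≤
          (2 * (ψ.toComplex z * W z * dbar ψ.toComplex z)).re := by
        refine neg_le_of_abs_le ((Complex.abs_re_le_norm _).trans ?_)
        have hψn : ‖ψ.toComplex z‖ = ψ z := by
          rw [ContDiffBump.toComplex, Complex.norm_real, Real.norm_of_nonneg ψ.nonneg]
        have hWn : ‖W z‖ ≤ ‖deriv P z‖ / ρ z := by
          rw [hW]
          simp only [norm_mul, norm_inv, norm_pow, Complex.norm_conj, Complex.norm_real,
            Real.norm_of_nonneg hr.le]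
          have := norm_le_sq_of_pow_four_eq h4 z
          calc ‖deriv P z‖ * (‖P z‖ * (ρ z ^ 3)⁻¹) ≤ ‖deriv P z‖ * (ρ z ^ 2 * (ρ z ^ 3)⁻¹) := by
                gcongr
            _ = _ := by field_simp
        rw [norm_mul, norm_mul, norm_mul, hψn, Complex.norm_ofNat]
        have := ψ.nonneg (x := z)
        gcongr
      have h8 : 2 * (ψ z * (‖deriv P z‖ / ρ z) * ‖dbar ψ.toComplex z‖) ≤
          E z / 8 + 8 * (‖dbar ψ.toComplex z‖ ^ 2 * ρ z) := by
        have : E z / 8 + 8 * (‖dbar ψ.toComplex z‖ ^ 2 * ρ z) -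
          2 * (ψ z * (‖deriv P z‖ / ρ z) * ‖dbar ψ.toComplex z‖) =
          (ψ z * ‖deriv P z‖ - 8 * ‖dbar ψ.toComplex z‖ * ρ z ^ 2) ^ 2 / (8 * ρ z ^ 3) := by
          simp only [hE]
          field_simp
          ring
        have : 0 ≤ (ψ z * ‖deriv P z‖ - 8 * ‖dbar ψ.toComplex z‖ * ρ z ^ 2) ^ 2 / (8 * ρ z ^ 3) := by
          positivity
        linarith
      have h9 : ‖dbar ψ.toComplex z‖ ^ 2 * ρ z ≤ K ^ 2 * B := by
        have := hKb z
        have := hB z hz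
        gcongr
      linarith
    · rw [indicator_of_notMem (by simpa using hz), hd]
      have h1 : ψ z = 0 := ψ.zero_of_le_dist (by rw [dist_zero_right]; linarith)
      simp [hE, ContDiffBump.toComplex, h1]
  have hmain : ∫ z, (E z / 8 -
      (Metric.ball (0 : ℂ) 1).indicator (fun _ => 8 * K ^ 2 * B) z) ≤ 0 := by
    have hdi : Integrable (dbar g) := (continuous_dbar hgc).integrable_of_hasCompactSupport
      ((hsupp.fderiv (𝕜 := ℝ)).mono fun z hz => by
        contrapose! hz
        simp only [Function.mem_support, not_not] at hz ⊢
        simp [dbar, hz])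
    calc _ ≤ ∫ z, (dbar g z).re :=
          integral_mono ((hEi.div_const 8).sub (ContDiffBump.integrable_indicator_ball_one _))
            hdi.re hpt
      _ = (∫ z, dbar g z).re := integral_re hdi
      _ = 0 := by rw [hintg, Complex.zero_re]
  rw [integral_sub (hEi.div_const 8) (ContDiffBump.integrable_indicator_ball_one _), integral_div,
    integral_indicator Metric.isOpen_ball.measurableSet, setIntegral_const, Measure.real,
    smul_eq_mul, ← hV] at hmain
  rw [← ofReal_integral_eq_lintegral_ofReal hEi (ae_of_all _ hE0)]
  apply ENNReal.ofReal_le_ofReal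
  linarith

end Regularization

/-- If the polynomial identity `P ^ 3 = Q ^ 2` nearly holds on the unit disc, then `P` and `Q`
are near the square and the cube of a holomorphic function on a smaller disc. -/
lemma exists_holomorphic_near_root {B : ℝ} (hB : 0 ≤ B) :
    ∃ K > 0, ∀ P Q : ℂ → ℂ, Differentiable ℂ P → Differentiable ℂ Q →
      (∀ z, ‖z‖ < 1 → ‖P z‖ ≤ B) → ∀ υ : ℝ, 0 < υ → υ ≤ 1 →
      (∀ z, ‖z‖ < 1 → ‖P z ^ 3 - Q z ^ 2‖ ≤ υ ^ 12) →
      ∃ F : ℂ → ℂ, DifferentiableOn ℂ F (Metric.ball 0 (1 / 16)) ∧ ∀ z, ‖z‖ < 1 / 16 →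
        ‖F z‖ ≤ K ∧ ‖F z ^ 2 - P z‖ ≤ K * υ ∧ ‖F z * P z - Q z‖ ≤ K * υ := by
  let ψ₀ : ContDiffBump (0 : ℂ) := ⟨1 / 8, 3 / 16, by norm_num, by norm_num⟩
  let ψ : ContDiffBump (0 : ℂ) := ⟨1 / 2, 5 / 8, by norm_num, by norm_num⟩
  let ψ₁ : ContDiffBump (0 : ℂ) := ⟨5 / 8, 3 / 4, by norm_num, by norm_num⟩
  obtain ⟨K₁, hK₁, hcac⟩ := ψ₁.exists_caccioppoli (by norm_num [ψ₁])
  obtain ⟨K₂, hK₂, happ⟩ := ψ.exists_holomorphicPart_bound (r := 1 / 4) (by norm_num [ψ])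
    (by norm_num [ψ])
  obtain ⟨K₃, hK₃, hsup⟩ := ψ₀.exists_enorm_le_lintegral (r := 1 / 16) (R := 1 / 4)
    (by norm_num [ψ₀]) (by norm_num [ψ₀])
  set V := (volume (Metric.ball (0 : ℂ) 1)).toReal with hV
  have hVt : volume (Metric.ball (0 : ℂ) 1) = ENNReal.ofReal V :=
    (ENNReal.ofReal_toReal Metric.isBounded_ball.measure_lt_top.ne).symm
  set R := B + 1 with hR
  set c := K₂ * (2 * R) + 2 * R + B with hc
  set κ := K₁ * R + V with hκ
  have hR0 : 0 ≤ R := by positivity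
  have hκ0 : 0 ≤ κ := by positivity
  have hc0 : 0 ≤ c := by positivity
  refine ⟨K₃ * (c * (K₂ * κ) + 3 * V) + K₂ * (2 * R) + 1, by positivity,
    fun P Q hP hQ hPB υ hυ hυ1 hPQ => ?_⟩
  set ρ : ℂ → ℝ := fun z => √√(‖P z‖ ^ 2 + (υ ^ 4) ^ 2) with hρdef
  have hN0 : ∀ z, 0 < ‖P z‖ ^ 2 + (υ ^ 4) ^ 2 := fun z => by positivity
  have h0 : ∀ z, 0 < ρ z := fun z => Real.sqrt_pos.2 (Real.sqrt_pos.2 (hN0 z))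
  have h4 : ∀ z, ρ z ^ 4 = ‖P z‖ ^ 2 + (υ ^ 4) ^ 2 := fun z => by
    calc ρ z ^ 4 = ((ρ z) ^ 2) ^ 2 := by ring
      _ = _ := by rw [hρdef, Real.sq_sqrt (Real.sqrt_nonneg _), Real.sq_sqrt (hN0 z).le]
  have hρ : ContDiff ℝ 1 ρ :=
    ((((hP.contDiff.restrict_scalars ℝ).norm_sq ℝ).add contDiff_const).sqrt
      fun z => (hN0 z).ne').sqrt fun z => (Real.sqrt_pos.2 (hN0 z)).ne'
  have hPρ := norm_le_sq_of_pow_four_eq h4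
  have hυρ : ∀ z, υ ^ 2 ≤ ρ z := fun z => by
    refine le_of_pow_le_pow_left₀ four_ne_zero (h0 z).le ?_
    rw [h4 z]
    nlinarith [sq_nonneg ‖P z‖]
  have hρR : ∀ z, ‖z‖ < 1 → ρ z ≤ R := fun z hz => by
    refine le_of_pow_le_pow_left₀ four_ne_zero hR0 ?_
    rw [h4 z]
    have h1 : ‖P z‖ ^ 2 ≤ B ^ 2 := by have := hPB z hz; gcongr
    have h2 : (υ ^ 4) ^ 2 ≤ 1 := by rw [← pow_mul]; exact pow_le_one₀ hυ.le hυ1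
    nlinarith [mul_nonneg hB hB, mul_nonneg hB (mul_nonneg hB hB),
      mul_nonneg (mul_nonneg hB hB) (mul_nonneg hB hB)]
  have hQρ : ∀ z, ‖z‖ < 1 → ‖Q z‖ ≤ 2 * ρ z ^ 3 := fun z hz => by
    have hr := h0 z
    refine le_of_pow_le_pow_left₀ two_ne_zero (by positivity) ?_
    have h1 : ‖Q z‖ ^ 2 ≤ ‖P z‖ ^ 3 + υ ^ 12 := by
      rw [← norm_pow, ← norm_pow]
      have := norm_sub_norm_le (Q z ^ 2) (P z ^ 3)
      rw [norm_sub_rev] at this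
      linarith [hPQ z hz]
    have h2 : ‖P z‖ ^ 3 ≤ (ρ z ^ 2) ^ 3 := by have := hPρ z; gcongr
    have h3 : (υ ^ 2) ^ 6 ≤ ρ z ^ 6 := by have := hυρ z; gcongr
    have h5 : (2 * ρ z ^ 3) ^ 2 = 4 * ρ z ^ 6 := by ring
    have h6 : (ρ z ^ 2) ^ 3 = ρ z ^ 6 := by ring
    have h7 : (υ ^ 2) ^ 6 = υ ^ 12 := by ring
    have h8 : 0 < ρ z ^ 6 := by positivity
    linarith
  set F₀ : ℂ → ℂ := fun z => Q z * (starRingEnd ℂ (P z) * ((ρ z : ℂ) ^ 4)⁻¹) with hF₀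
  have hF₀c : ContDiff ℝ 1 F₀ :=
    (hQ.contDiff.restrict_scalars ℝ).mul (((Complex.conjCLE : ℂ →L[ℝ] ℂ).contDiff.comp
      (hP.contDiff.restrict_scalars ℝ)).mul (contDiff_ofReal_inv_pow hρ h0 4))
  have hρc : ∀ z k, ‖((ρ z : ℂ) ^ k)⁻¹‖ = (ρ z ^ k)⁻¹ := fun z k => by
    rw [norm_inv, norm_pow, Complex.norm_real, Real.norm_of_nonneg (h0 z).le]
  have hF₀R : ∀ z, ‖z‖ < 1 → ‖F₀ z‖ ≤ 2 * R := fun z hz => by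
    have hr := h0 z
    rw [hF₀, norm_mul, norm_mul, hρc, Complex.norm_conj]
    calc ‖Q z‖ * (‖P z‖ * (ρ z ^ 4)⁻¹) ≤ 2 * ρ z ^ 3 * (ρ z ^ 2 * (ρ z ^ 4)⁻¹) := by
          gcongr
          · exact hQρ z hz
          · exact hPρ z
      _ = 2 * ρ z := by field_simp
      _ ≤ 2 * R := by linarith [hρR z hz]
  have hconj : ∀ z, ((ρ z : ℂ)) ^ 4 = P z * starRingEnd ℂ (P z) + (υ : ℂ) ^ 8 := fun z => by
    rw [Complex.mul_conj, Complex.normSq_eq_norm_sq]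
    have : ρ z ^ 4 = ‖P z‖ ^ 2 + υ ^ 8 := by rw [h4 z]; ring
    exact_mod_cast this
  have hsq : ∀ z, ‖z‖ < 1 → ‖F₀ z ^ 2 - P z‖ ≤ 3 * υ := fun z hz => by
    have hr := h0 z
    have hrc : (ρ z : ℂ) ≠ 0 := Complex.ofReal_ne_zero.2 hr.ne'
    have h1 : F₀ z ^ 2 - P z = -(P z ^ 3 - Q z ^ 2) * starRingEnd ℂ (P z) ^ 2 *
        ((ρ z : ℂ) ^ 8)⁻¹ - P z * υ ^ 8 * (P z * starRingEnd ℂ (P z) + (ρ z : ℂ) ^ 4) *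
        ((ρ z : ℂ) ^ 8)⁻¹ := by
      rw [hF₀]
      field_simp
      linear_combination (P z * ((ρ z : ℂ) ^ 4 + P z * starRingEnd ℂ (P z))) * (-hconj z)
    have h2 : ‖P z * starRingEnd ℂ (P z) + (ρ z : ℂ) ^ 4‖ ≤ 2 * ρ z ^ 4 := by
      refine (norm_add_le _ _).trans ?_
      rw [norm_mul, Complex.norm_conj, norm_pow, Complex.norm_real, Real.norm_of_nonneg hr.le]
      nlinarith [hPρ z, norm_nonneg (P z)]
    rw [h1]
    refine (norm_sub_le _ _).trans ?_
    simp only [norm_mul, norm_neg, hρc]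
    rw [norm_pow, Complex.norm_conj, norm_pow, Complex.norm_real, Real.norm_of_nonneg hυ.le]
    have hυ3 : υ ^ 4 ≤ υ := by simpa using pow_le_pow_of_le_one hυ.le hυ1 (show 1 ≤ 4 by norm_num)
    have hυ4 := hυρ z
    calc _ ≤ υ ^ 12 * (ρ z ^ 2) ^ 2 * (ρ z ^ 8)⁻¹ +
          ρ z ^ 2 * υ ^ 8 * (2 * ρ z ^ 4) * (ρ z ^ 8)⁻¹ := by
          gcongr
          · exact hPQ z hz
          · exact hPρ z
          · exact hPρ z
      _ = υ ^ 4 * (υ ^ 2 / ρ z) ^ 4 + 2 * υ ^ 4 * (υ ^ 2 / ρ z) ^ 2 := by field_simp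
      _ ≤ υ ^ 4 * 1 ^ 4 + 2 * υ ^ 4 * 1 ^ 2 := by
          have : υ ^ 2 / ρ z ≤ 1 := (div_le_one hr).2 hυ4
          gcongr
      _ ≤ _ := by linarith
  have hcu : ∀ z, ‖z‖ < 1 → ‖F₀ z * P z - Q z‖ ≤ 3 * υ := fun z hz => by
    have hr := h0 z
    have hrc : (ρ z : ℂ) ≠ 0 := Complex.ofReal_ne_zero.2 hr.ne'
    have h1 : F₀ z * P z - Q z = -(Q z * υ ^ 8 * ((ρ z : ℂ) ^ 4)⁻¹) := by
      rw [hF₀]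
      field_simp
      linear_combination (-Q z) * hconj z
    rw [h1, norm_neg, norm_mul, norm_mul, hρc, norm_pow, Complex.norm_real,
      Real.norm_of_nonneg hυ.le]
    have hυ3 : υ ^ 6 ≤ υ := by simpa using pow_le_pow_of_le_one hυ.le hυ1 (show 1 ≤ 6 by norm_num)
    have hυ4 := hυρ z
    calc ‖Q z‖ * υ ^ 8 * (ρ z ^ 4)⁻¹ ≤ 2 * ρ z ^ 3 * υ ^ 8 * (ρ z ^ 4)⁻¹ := by
          gcongr
          exact hQρ z hz
      _ = 2 * υ ^ 6 * (υ ^ 2 / ρ z) := by field_simp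
      _ ≤ 2 * υ ^ 6 * 1 := by
          have : υ ^ 2 / ρ z ≤ 1 := (div_le_one hr).2 hυ4
          gcongr
      _ ≤ _ := by linarith
  have hdF : ∀ z, ‖z‖ < 1 → ‖dbar F₀ z‖ ≤ υ * (‖deriv P z‖ ^ 2 / ρ z ^ 3 + 1) := fun z hz => by
    have hr := h0 z
    have hrc : (ρ z : ℂ) ≠ 0 := Complex.ofReal_ne_zero.2 hr.ne'
    have h1 : dbar F₀ z = Q z * starRingEnd ℂ (deriv P z) * υ ^ 8 * ((ρ z : ℂ) ^ 8)⁻¹ := by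
      rw [hF₀, dbar_mul_conj_mul_inv_pow hQ hP hρ h0 h4 4 z]
      push_cast
      field_simp
      ring
    rw [h1, norm_mul, norm_mul, norm_mul, hρc, norm_pow, Complex.norm_real,
      Real.norm_of_nonneg hυ.le, Complex.norm_conj]
    calc ‖Q z‖ * ‖deriv P z‖ * υ ^ 8 * (ρ z ^ 8)⁻¹
        ≤ 2 * ρ z ^ 3 * ‖deriv P z‖ * υ ^ 8 * (ρ z ^ 8)⁻¹ := by
          gcongr
          exact hQρ z hz
      _ = υ * ((‖deriv P z‖ ^ 2 / ρ z ^ 3 + (υ ^ 2 / ρ z) ^ 7) -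
            (‖deriv P z‖ * ρ z ^ 2 - υ ^ 7) ^ 2 / ρ z ^ 7) := by field_simp; ring
      _ ≤ υ * ((‖deriv P z‖ ^ 2 / ρ z ^ 3 + 1 ^ 7) - 0) := by
          have : υ ^ 2 / ρ z ≤ 1 := (div_le_one hr).2 (hυρ z)
          have : 0 ≤ (‖deriv P z‖ * ρ z ^ 2 - υ ^ 7) ^ 2 / ρ z ^ 7 := by positivity
          gcongr
      _ = _ := by ring
  have hκυ : ∫⁻ z, ‖ψ.toComplex z * dbar F₀ z‖ₑ ≤ ENNReal.ofReal (υ * κ) := by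
    calc ∫⁻ z, ‖ψ.toComplex z * dbar F₀ z‖ₑ
        ≤ ∫⁻ z, ENNReal.ofReal υ * (ENNReal.ofReal (ψ₁ z ^ 2 * (‖deriv P z‖ ^ 2 / ρ z ^ 3)) +
            (Metric.ball (0 : ℂ) 1).indicator (fun _ => 1) z) := by
          refine lintegral_mono fun z => ?_
          by_cases hz : ‖z‖ < 5 / 8
          · have hψ1 : ψ₁ z = 1 := ψ₁.one_of_mem_closedBall (by simpa [ψ₁] using hz.le)
            have hr := h0 z
            rw [hψ1, indicator_of_mem (by rw [mem_ball_zero_iff]; linarith), ← ofReal_norm,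
              ← ENNReal.ofReal_one, ← ENNReal.ofReal_add (by positivity) zero_le_one,
              ← ENNReal.ofReal_mul hυ.le, norm_mul]
            apply ENNReal.ofReal_le_ofReal
            have h1 := ψ.norm_toComplex_le z
            have h2 := hdF z (by linarith)
            nlinarith [norm_nonneg (dbar F₀ z)]
          · have : ψ.toComplex z = 0 := ψ.toComplex_eq_zero (by simpa [ψ] using hz)
            simp [this]
      _ = ENNReal.ofReal υ * ((∫⁻ z, ENNReal.ofReal (ψ₁ z ^ 2 *
            (‖deriv P z‖ ^ 2 / ρ z ^ 3))) + ENNReal.ofReal V) := by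
          rw [lintegral_const_mul' _ _ ENNReal.ofReal_ne_top, lintegral_add_right _
            (measurable_const.indicator Metric.isOpen_ball.measurableSet),
            lintegral_indicator Metric.isOpen_ball.measurableSet, setLIntegral_one, hVt]
      _ ≤ ENNReal.ofReal υ * (ENNReal.ofReal (K₁ * R) + ENNReal.ofReal V) := by
          gcongr
          exact hcac P ρ (υ ^ 4) R hP hρ h0 h4 hρR hR0
      _ = _ := by
          rw [← ENNReal.ofReal_add (by positivity) (by positivity), ← ENNReal.ofReal_mul hυ.le]
  obtain ⟨hFd, hFB, hFL⟩ := happ (2 * R) F₀ hF₀c hF₀R (by positivity) _ hκυ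
  set F := ψ.holomorphicPart F₀
  have hfin : ∀ H : ℂ → ℂ, DifferentiableOn ℂ H (Metric.ball 0 (1 / 4)) →
      (∀ z, ‖z‖ < 1 / 4 → ‖H z‖ ≤ c * ‖F₀ z - F z‖ + 3 * υ) →
      ∀ w, ‖w‖ < 1 / 16 → ‖H w‖ ≤ K₃ * (c * (K₂ * κ) + 3 * V) * υ := by
    intro H hHd hHb w hw
    have h1 : ∫⁻ z in Metric.ball 0 (1 / 4), ‖H z‖ₑ ≤
        ENNReal.ofReal ((c * (K₂ * κ) + 3 * V) * υ) := by
      calc ∫⁻ z in Metric.ball 0 (1 / 4), ‖H z‖ₑ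
          ≤ ∫⁻ z in Metric.ball 0 (1 / 4),
            (ENNReal.ofReal c * ‖F₀ z - F z‖ₑ + ENNReal.ofReal (3 * υ)) := by
            refine setLIntegral_mono' Metric.isOpen_ball.measurableSet fun z hz => ?_
            rw [← ofReal_norm, ← ofReal_norm, ← ENNReal.ofReal_mul hc0,
              ← ENNReal.ofReal_add (by positivity) (by positivity)]
            exact ENNReal.ofReal_le_ofReal (hHb z (by simpa using hz))
        _ = ENNReal.ofReal c * (∫⁻ z in Metric.ball 0 (1 / 4), ‖F₀ z - F z‖ₑ) +
            ENNReal.ofReal (3 * υ) * volume (Metric.ball (0 : ℂ) (1 / 4)) := by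
            rw [lintegral_add_right _ measurable_const,
              lintegral_const_mul' _ _ ENNReal.ofReal_ne_top, setLIntegral_const]
        _ ≤ ENNReal.ofReal c * ENNReal.ofReal (K₂ * (υ * κ)) +
            ENNReal.ofReal (3 * υ) * ENNReal.ofReal V := by
            gcongr
            rw [← hVt]
            exact measure_mono (Metric.ball_subset_ball (by norm_num))
        _ = _ := by
            rw [← ENNReal.ofReal_mul hc0, ← ENNReal.ofReal_mul (by positivity),
              ← ENNReal.ofReal_add (by positivity) (by positivity)]
            congr 1; ring
    have h2 := (hsup H hHd w hw).trans (mul_le_mul_right h1 _)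
    rw [← ENNReal.ofReal_mul hK₃.le, ← ofReal_norm,
      ENNReal.ofReal_le_ofReal_iff (by positivity)] at h2
    linarith
  have hV0 : 0 ≤ V := ENNReal.toReal_nonneg
  have hx : 0 ≤ K₃ * (c * (K₂ * κ) + 3 * V) := by positivity
  have hy : 0 ≤ K₂ * (2 * R) := by positivity
  refine ⟨F, hFd.mono (Metric.ball_subset_ball (by norm_num)), fun z hz => ⟨?_, ?_, ?_⟩⟩
  · linarith [hFB z (by linarith)]
  · refine (hfin (fun z => F z ^ 2 - P z) ((hFd.pow 2).sub hP.differentiableOn) ?_ z hz).trans ?_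
    · intro w hw
      calc ‖F w ^ 2 - P w‖ = ‖(F₀ w ^ 2 - P w) - (F₀ w - F w) * (F w + F₀ w)‖ := by
            congr 1; ring
        _ ≤ 3 * υ + ‖F₀ w - F w‖ * (K₂ * (2 * R) + 2 * R) := by
            refine (norm_sub_le _ _).trans ?_
            rw [norm_mul]
            gcongr
            · exact hsq w (by linarith)
            · exact (norm_add_le _ _).trans (add_le_add (hFB w hw) (hF₀R w (by linarith)))
        _ ≤ _ := by
            have := mul_nonneg (norm_nonneg (F₀ w - F w)) hB
            rw [hc]; linarith
    · nlinarith
  · refine (hfin (fun z => F z * P z - Q z) ((hFd.mul hP.differentiableOn).sub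
      hQ.differentiableOn) ?_ z hz).trans ?_
    · intro w hw
      calc ‖F w * P w - Q w‖ = ‖(F₀ w * P w - Q w) - (F₀ w - F w) * P w‖ := by
            congr 1; ring
        _ ≤ 3 * υ + ‖F₀ w - F w‖ * B := by
            refine (norm_sub_le _ _).trans ?_
            rw [norm_mul]
            gcongr
            · exact hcu w (by linarith)
            · exact hPB w (by linarith)
        _ ≤ _ := by
            have := mul_nonneg (norm_nonneg (F₀ w - F w)) (show 0 ≤ K₂ * (2 * R) + 2 * R by
              positivity)
            rw [hc]; linarith
    · nlinarith

/-- Approximate square and cube roots determine a number. -/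
lemma norm_sub_le_of_sq_of_cube {F G : ℂ} {B L τ : ℝ} (hL : 0 ≤ L) (hτ : 0 < τ)
    (hF : ‖F‖ ≤ B) (hG : ‖G‖ ≤ B) (h2 : ‖F ^ 2 - G ^ 2‖ ≤ L * τ ^ 3)
    (h3 : ‖F ^ 3 - G ^ 3‖ ≤ L * τ ^ 3) : ‖F - G‖ ≤ (4 + L * (1 + B)) * τ := by
  have hB : 0 ≤ B := (norm_nonneg F).trans hF
  have key : ∀ {F G : ℂ}, ‖F‖ ≤ B → ‖F ^ 2 - G ^ 2‖ ≤ L * τ ^ 3 → ‖F ^ 3 - G ^ 3‖ ≤ L * τ ^ 3 →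
      2 * τ < ‖G‖ → ‖F - G‖ ≤ (4 + L * (1 + B)) * τ := by
    intro F G hF h2 h3 hG
    have h1 : ‖G‖ ^ 2 * ‖F - G‖ ≤ L * (1 + B) * τ ^ 3 := by
      calc ‖G‖ ^ 2 * ‖F - G‖ = ‖(F ^ 3 - G ^ 3) - F * (F ^ 2 - G ^ 2)‖ := by
            rw [← norm_pow, ← norm_mul]; congr 1; ring
        _ ≤ ‖F ^ 3 - G ^ 3‖ + ‖F‖ * ‖F ^ 2 - G ^ 2‖ := by
            rw [← norm_mul]; exact norm_sub_le _ _
        _ ≤ L * τ ^ 3 + B * (L * τ ^ 3) := by gcongr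
        _ = _ := by ring
    have h4 : τ ^ 2 * ‖F - G‖ ≤ τ ^ 2 * (L * (1 + B) * τ) := by
      calc τ ^ 2 * ‖F - G‖ ≤ ‖G‖ ^ 2 * ‖F - G‖ := by
            gcongr
            linarith
        _ ≤ _ := h1
        _ = _ := by ring
    have h5 := le_of_mul_le_mul_left h4 (by positivity)
    linarith
  by_cases hG2 : 2 * τ < ‖G‖
  · exact key hF h2 h3 hG2
  by_cases hF2 : 2 * τ < ‖F‖
  · rw [norm_sub_rev] at h2 h3 ⊢
    exact key hG h2 h3 hF2
  · have h0 : 0 ≤ L * (1 + B) * τ := by positivity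
    have := norm_sub_le F G
    linarith [not_lt.1 hG2, not_lt.1 hF2]

open Polynomial in
/-- A Schwarz lemma for polynomials vanishing to high order along the positive axis. -/
lemma Polynomial.norm_eval_le_of_forall_pos {D : ℂ[X]} {N : ℕ} {L B ε : ℝ} (hε : 0 < ε)
    (hL : ∀ t : ℝ, 0 < t → t ≤ ε → ‖D.eval (t : ℂ)‖ ≤ L * t ^ N)
    (hB : ∀ z, ‖z‖ ≤ ε → ‖D.eval z‖ ≤ B) {z : ℂ} (hz : ‖z‖ ≤ ε) :
    ‖D.eval z‖ ≤ B * (‖z‖ / ε) ^ N := by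
  have hdvd : X ^ N ∣ D := by
    clear hB hz
    induction N generalizing L with
    | zero => simp
    | succ N ih =>
      have hL0 : 0 ≤ L := by
        have := (norm_nonneg _).trans (hL ε hε le_rfl)
        exact nonneg_of_mul_nonneg_left this (by positivity)
      obtain ⟨E, rfl⟩ := ih (L := L * ε) fun t ht hte => (hL t ht hte).trans (by
        rw [pow_succ]
        have : t ^ N * t ≤ t ^ N * ε := by gcongr
        nlinarith)
      have hE : ∀ t : ℝ, 0 < t → t ≤ ε → ‖E.eval (t : ℂ)‖ ≤ L * t := by
        intro t ht hte
        have h1 := hL t ht hte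
        rw [eval_mul, eval_pow, eval_X, norm_mul, norm_pow, Complex.norm_real,
          Real.norm_of_nonneg ht.le, pow_succ, mul_left_comm] at h1
        exact le_of_mul_le_mul_left h1 (by positivity)
      have h0 : E.eval 0 = 0 := by
        have hc : Tendsto (fun t : ℝ => ‖E.eval (t : ℂ)‖) (𝓝[>] 0) (𝓝 ‖E.eval 0‖) := by
          have : Continuous fun t : ℝ => ‖E.eval (t : ℂ)‖ :=
            (E.continuous.comp Complex.continuous_ofReal).norm
          simpa using (this.tendsto 0).mono_left nhdsWithin_le_nhds
        have hc2 : Tendsto (fun t : ℝ => L * t) (𝓝[>] 0) (𝓝 0) := by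
          have : Continuous fun t : ℝ => L * t := by fun_prop
          simpa using (this.tendsto 0).mono_left nhdsWithin_le_nhds
        have := le_of_tendsto_of_tendsto hc hc2 (by
          filter_upwards [Ioc_mem_nhdsGT hε] with t ht
          exact hE t ht.1 ht.2)
        simpa using this
      rw [pow_succ]
      exact mul_dvd_mul_left _ (X_dvd_iff.2 (by rw [coeff_zero_eq_eval_zero, h0]))
  obtain ⟨E, rfl⟩ := hdvd
  have hE : ‖E.eval z‖ ≤ B / ε ^ N := by
    refine Complex.norm_le_of_forall_mem_frontier_norm_le (U := Metric.ball 0 ε)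
      Metric.isBounded_ball (E.differentiable.diffContOnCl) (fun w hw => ?_)
      (by rw [closure_ball _ hε.ne']; simpa using hz)
    rw [frontier_ball _ hε.ne', mem_sphere_zero_iff_norm] at hw
    have := hB w hw.le
    rw [eval_mul, eval_pow, eval_X, norm_mul, norm_pow, hw] at this
    rw [le_div_iff₀ (by positivity)]
    linarith
  calc ‖(X ^ N * E).eval z‖ = ‖z‖ ^ N * ‖E.eval z‖ := by
        rw [eval_mul, eval_pow, eval_X, norm_mul, norm_pow]
    _ ≤ ‖z‖ ^ N * (B / ε ^ N) := by gcongr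
    _ = _ := by rw [div_pow]; ring

/-- The finite difference of order `J` of a sequence. -/
noncomputable def altSum (J : ℕ) (g : ℕ → ℂ) : ℂ :=
  ∑ k ∈ Finset.range (J + 1), ((-1) ^ (J - k) * (J.choose k : ℂ)) * g k

lemma altSum_sub (J : ℕ) (g h : ℕ → ℂ) :
    altSum J (fun k => g k - h k) = altSum J g - altSum J h := by
  simp [altSum, mul_sub, Finset.sum_sub_distrib]

lemma altSum_const_mul (J : ℕ) (c : ℂ) (g : ℕ → ℂ) :
    altSum J (fun k => c * g k) = c * altSum J g := by
  simp only [altSum, Finset.mul_sum]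
  exact Finset.sum_congr rfl fun _ _ => by ring

lemma altSum_sum {ι : Type*} (J : ℕ) (s : Finset ι) (g : ι → ℕ → ℂ) :
    altSum J (fun k => ∑ i ∈ s, g i k) = ∑ i ∈ s, altSum J (g i) := by
  simp only [altSum, Finset.mul_sum]
  exact Finset.sum_comm

lemma norm_altSum_le {J : ℕ} {g : ℕ → ℂ} {c : ℝ} (h : ∀ k ≤ J, ‖g k‖ ≤ c) :
    ‖altSum J g‖ ≤ 2 ^ J * c := by
  calc ‖altSum J g‖ ≤ ∑ k ∈ Finset.range (J + 1), (J.choose k : ℝ) * c := by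
        refine norm_sum_le_of_le _ fun k hk => ?_
        rw [norm_mul, norm_mul, norm_pow, norm_neg, norm_one, one_pow, one_mul,
          Complex.norm_natCast]
        gcongr
        exact h k (Nat.lt_succ_iff.1 (Finset.mem_range.1 hk))
    _ = 2 ^ J * c := by
        rw [← Finset.sum_mul]
        congr 1
        exact_mod_cast Nat.sum_range_choose J

lemma altSum_eq_fwdDiff (J : ℕ) (F : ℂ → ℂ) :
    altSum J (fun k => F k) = (fwdDiff 1)^[J] F 0 := by
  rw [fwdDiff_iter_eq_sum_shift]
  refine Finset.sum_congr rfl fun k _ => ?_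
  simp [zsmul_eq_mul]

lemma altSum_pow_of_lt {J m : ℕ} (h : m < J) : altSum J (fun k => (k : ℂ) ^ m) = 0 := by
  rw [altSum_eq_fwdDiff J fun z => z ^ m, fwdDiff_iter_pow_eq_zero_of_lt h, Pi.zero_apply]

lemma altSum_pow_self (J : ℕ) : altSum J (fun k => (k : ℂ) ^ J) = J.factorial := by
  rw [altSum_eq_fwdDiff J fun z => z ^ J, fwdDiff_iter_eq_factorial, Pi.natCast_apply]

/-- Finite differences of bounded holomorphic functions. -/
lemma norm_altSum_le_of_differentiableOn {G : ℂ → ℂ} {R B h : ℝ} {J : ℕ} (hR : 0 < R) (hh : 0 < h)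
    (hG : DifferentiableOn ℂ G (Metric.ball 0 (2 * R))) (hB : ∀ z, ‖z‖ ≤ R → ‖G z‖ ≤ B)
    (hJ : h * J ≤ R / 2) :
    ‖altSum J (fun k => G ((k * h : ℝ) : ℂ))‖ ≤ 2 ^ J * (2 * B * (h * J / R) ^ J) := by
  have hB0 : 0 ≤ B := (norm_nonneg _).trans (hB 0 (by simpa using hR.le))
  set c : ℕ → ℂ := fun n => (n.factorial : ℂ)⁻¹ * iteratedDeriv n G 0 with hc
  have hcb : ∀ n, ‖c n‖ ≤ B / R ^ n := by
    intro n
    have := Complex.norm_iteratedDeriv_le_of_forall_mem_sphere_norm_le (c := 0) n hR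
      ((hG.mono (Metric.closedBall_subset_ball (by linarith))).diffContOnCl_ball subset_rfl)
      (fun z hz => hB z (mem_sphere_zero_iff_norm.1 hz).le)
    rw [hc, norm_mul, norm_inv, Complex.norm_natCast, inv_mul_le_iff₀ (by positivity)]
    rwa [← mul_div_assoc]
  have hsum : ∀ t : ℝ, 0 ≤ t → t ≤ R / 2 → HasSum (fun n => c n * (t : ℂ) ^ n) (G t) := by
    intro t ht htR
    have hm : (t : ℂ) ∈ Metric.ball (0 : ℂ) (2 * R) := by
      rw [mem_ball_zero_iff, Complex.norm_real, Real.norm_of_nonneg ht]; linarith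
    have := Complex.hasSum_taylorSeries_on_ball hG hm
    have he : (fun n => c n * (t : ℂ) ^ n) = fun n : ℕ =>
        (n.factorial : ℂ)⁻¹ • ((t : ℂ) - 0) ^ n • iteratedDeriv n G 0 := by
      ext n
      simp only [hc, sub_zero, smul_eq_mul]
      ring
    rwa [he]
  have htail : ∀ t : ℝ, 0 ≤ t → t ≤ R / 2 →
      ‖G t - ∑ n ∈ Finset.range J, c n * (t : ℂ) ^ n‖ ≤ 2 * B * (t / R) ^ J := by
    intro t ht htR
    have h1 := (hasSum_nat_add_iff' J).2 (hsum t ht htR)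
    rw [← h1.tsum_eq]
    have hgeo : HasSum (fun n : ℕ => B * (t / R) ^ J * (1 / 2) ^ n) (B * (t / R) ^ J * 2) :=
      hasSum_geometric_two.mul_left _
    refine (tsum_of_norm_bounded hgeo fun n => ?_).trans_eq (by ring)
    rw [norm_mul, norm_pow, Complex.norm_real, Real.norm_of_nonneg ht]
    calc ‖c (n + J)‖ * t ^ (n + J) ≤ B / R ^ (n + J) * t ^ (n + J) := by
          gcongr; exact hcb _
      _ = B * (t / R) ^ J * (t / R) ^ n := by rw [div_pow, div_pow, pow_add, pow_add]; field_simp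
      _ ≤ _ := by
          have : t / R ≤ 1 / 2 := by rw [div_le_iff₀ hR]; linarith
          gcongr
  have hz : altSum J (fun k => ∑ n ∈ Finset.range J, c n * ((k * h : ℝ) : ℂ) ^ n) = 0 := by
    rw [altSum_sum]
    refine Finset.sum_eq_zero fun n hn => ?_
    have : (fun k : ℕ => c n * ((k * h : ℝ) : ℂ) ^ n) = fun k : ℕ => (c n * (h : ℂ) ^ n) * (k : ℂ) ^ n := by
      ext k; push_cast; ring
    rw [this, altSum_const_mul, altSum_pow_of_lt (Finset.mem_range.1 hn), mul_zero]
  rw [← sub_zero (altSum J _), ← hz, ← altSum_sub]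
  refine norm_altSum_le fun k hk => ?_
  have h1 : (k : ℝ) * h ≤ h * J := by
    rw [mul_comm]; gcongr
  refine (htail _ (by positivity) (h1.trans hJ)).trans ?_
  gcongr

lemma norm_altSum_le_of_ladder {w : ℝ → ℂ} {G : ℕ → ℂ → ℂ} {R : ℕ → ℝ} {K θ A : ℝ} {J : ℕ}
    (hJ : 1 ≤ J) (hA : 1 ≤ A) (hθ0 : 0 < θ) (hθ : θ * A ≤ 1 / 2) (hR0 : ∀ i, 0 < R i)
    (hRA : ∀ i, R i ≤ A * R (i + 1)) (hR : ∀ i, R (i + 1) ≤ R i) (hRlim : Tendsto R atTop (𝓝 0))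
    (hG : ∀ i, DifferentiableOn ℂ (G i) (Metric.ball 0 (2 * R i)))
    (hGK : ∀ z, ‖z‖ ≤ R 0 → ‖G 0 z‖ ≤ K)
    (hGG : ∀ i z, ‖z‖ ≤ R (i + 1) → ‖G i z - G (i + 1) z‖ ≤ K * θ ^ (2 ^ i * J))
    (hw : ∀ i t, 0 ≤ t → t ≤ R i → ‖w t - G i (t : ℂ)‖ ≤ K * θ ^ (2 ^ i * J))
    {h : ℝ} (hh : 0 < h) (hhJ : h * J ≤ R 0 / 2) :
    ‖altSum J fun k => w (k * h)‖ ≤ 5 * K * 4 ^ J * (h * J / R 0) ^ J := by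
  have hK : 0 ≤ K := (norm_nonneg _).trans (hGK 0 (by simpa using (hR0 0).le))
  have hJ0 : (0 : ℝ) < J := by exact_mod_cast hJ
  have hR00 := hR0 0
  have hA0 : 0 < A := by linarith
  have hθ1 : θ ≤ 1 := by nlinarith
  set X := (h * J / R 0) ^ J with hX
  have hX0 : 0 ≤ X := by positivity
  have hRi : ∀ i, R 0 ≤ A ^ i * R i := by
    intro i
    induction i with
    | zero => simp
    | succ i ih =>
      calc R 0 ≤ A ^ i * R i := ih
        _ ≤ A ^ i * (A * R (i + 1)) := by gcongr; exact hRA i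
        _ = _ := by ring
  have hpow : ∀ i, θ ^ (2 ^ i * J) * (h * J / R (i + 1)) ^ J ≤ ((1 / 2) ^ (i + 1)) ^ J * X := by
    intro i
    have h1 := hR0 (i + 1)
    have h2 : θ ^ 2 ^ i ≤ θ ^ (i + 1) :=
      pow_le_pow_of_le_one hθ0.le hθ1 (Nat.lt_two_pow_self)
    have h3 : h * J / R (i + 1) ≤ A ^ (i + 1) * (h * J / R 0) := by
      rw [div_le_iff₀ h1]
      calc h * J = h * J / R 0 * R 0 := by field_simp
        _ ≤ h * J / R 0 * (A ^ (i + 1) * R (i + 1)) := by gcongr; exact hRi _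
        _ = _ := by ring
    rw [pow_mul, ← mul_pow, hX, ← mul_pow]
    refine pow_le_pow_left₀ (by positivity) ?_ J
    calc θ ^ 2 ^ i * (h * J / R (i + 1)) ≤ θ ^ (i + 1) * (A ^ (i + 1) * (h * J / R 0)) := by gcongr
      _ = (θ * A) ^ (i + 1) * (h * J / R 0) := by rw [mul_pow]; ring
      _ ≤ _ := by gcongr
  have hclaim : ∀ i, h * J ≤ R i / 2 → ‖altSum J fun k => G i ((k * h : ℝ) : ℂ)‖ ≤
      2 ^ J * (2 * K * (2 - (1 / 2) ^ i) * X) := by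
    intro i
    induction i with
    | zero =>
      intro _
      refine (norm_altSum_le_of_differentiableOn hR00 hh (hG 0) hGK hhJ).trans_eq ?_
      rw [hX]; norm_num
    | succ i ih =>
      intro hi
      have h1 := norm_altSum_le_of_differentiableOn (hR0 (i + 1)) hh
        (((hG i).mono (Metric.ball_subset_ball (by linarith [hR i]))).fun_sub (hG (i + 1)))
        (hGG i) hi
      rw [altSum_sub J (fun k => G i ((k * h : ℝ) : ℂ)) fun k => G (i + 1) ((k * h : ℝ) : ℂ)] at h1
      have h2 := ih (hi.trans (by linarith [hR i]))
      have h3 : ((1 / 2 : ℝ) ^ (i + 1)) ^ J ≤ (1 / 2) ^ (i + 1) :=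
        pow_le_of_le_one (by positivity) (pow_le_one₀ (by norm_num) (by norm_num)) (by omega)
      have h4 : 2 * (K * θ ^ (2 ^ i * J)) * (h * J / R (i + 1)) ^ J ≤
          2 * K * ((1 / 2) ^ (i + 1) * X) := by
        calc _ = 2 * K * (θ ^ (2 ^ i * J) * (h * J / R (i + 1)) ^ J) := by ring
          _ ≤ 2 * K * (((1 / 2) ^ (i + 1)) ^ J * X) :=
            mul_le_mul_of_nonneg_left (hpow i) (by positivity)
          _ ≤ _ := by gcongr
      have h5 : ‖altSum J fun k => G (i + 1) ((k * h : ℝ) : ℂ)‖ ≤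
          2 ^ J * (2 * K * (2 - (1 / 2) ^ i) * X) + 2 ^ J * (2 * K * ((1 / 2) ^ (i + 1) * X)) := by
        rw [norm_sub_rev] at h1
        have h6 := norm_sub_norm_le (altSum J fun k => G (i + 1) ((k * h : ℝ) : ℂ))
          (altSum J fun k => G i ((k * h : ℝ) : ℂ))
        have h7 : (2 : ℝ) ^ J * (2 * (K * θ ^ (2 ^ i * J)) * (h * J / R (i + 1)) ^ J) ≤
          2 ^ J * (2 * K * ((1 / 2) ^ (i + 1) * X)) := by gcongr
        linarith
      refine h5.trans_eq ?_
      ring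
  have hex : ∃ i, R (i + 1) / 2 < h * J := by
    have h1 : Tendsto (fun i => R (i + 1) / 2) atTop (𝓝 0) := by
      simpa using (hRlim.comp (tendsto_add_atTop_nat 1)).div_const 2
    exact (h1.eventually_lt_const (by positivity)).exists
  classical
  obtain ⟨I, hI1, hI2⟩ : ∃ I, R (I + 1) / 2 < h * J ∧ h * J ≤ R I / 2 := by
    refine ⟨Nat.find hex, Nat.find_spec hex, ?_⟩
    rcases hI : Nat.find hex with _ | k
    · exact hhJ
    · exact not_lt.1 (Nat.find_min hex (show k < Nat.find hex by omega))
  have h1 := hclaim I hI2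
  have h2 : ‖altSum J (fun k => w (k * h)) - altSum J fun k => G I ((k * h : ℝ) : ℂ)‖ ≤
      2 ^ J * (K * θ ^ (2 ^ I * J)) := by
    rw [← altSum_sub]
    refine norm_altSum_le fun k hk => hw I _ (by positivity) ?_
    have : (k : ℝ) * h ≤ h * J := by rw [mul_comm]; gcongr
    linarith [hR0 I]
  have h3 : θ ^ (2 ^ I * J) ≤ 2 ^ J * X := by
    have h4 := hR0 (I + 1)
    have h5 : 1 ≤ (2 * (h * J / R (I + 1))) ^ J := by
      refine one_le_pow₀ ?_
      rw [← mul_div_assoc, one_le_div h4]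
      linarith
    calc θ ^ (2 ^ I * J) ≤ θ ^ (2 ^ I * J) * (2 * (h * J / R (I + 1))) ^ J :=
          le_mul_of_one_le_right (by positivity) h5
      _ = 2 ^ J * (θ ^ (2 ^ I * J) * (h * J / R (I + 1)) ^ J) := by rw [mul_pow]; ring
      _ ≤ 2 ^ J * (((1 / 2) ^ (I + 1)) ^ J * X) :=
          mul_le_mul_of_nonneg_left (hpow I) (by positivity)
      _ ≤ 2 ^ J * (1 * X) := by
          have : ((1 / 2 : ℝ) ^ (I + 1)) ^ J ≤ 1 :=
            pow_le_one₀ (by positivity) (pow_le_one₀ (by norm_num) (by norm_num))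
          gcongr
      _ = _ := by ring
  have h4 : (4 : ℝ) ^ J = 2 ^ J * 2 ^ J := by rw [← mul_pow]; norm_num
  have h5 : (1 : ℝ) ≤ 2 ^ J := one_le_pow₀ (by norm_num)
  have h6 := norm_sub_norm_le (altSum J fun k => w (k * h)) (altSum J fun k => G I ((k * h : ℝ) : ℂ))
  have h7 : (2 : ℝ) ^ J * (K * θ ^ (2 ^ I * J)) ≤ 2 ^ J * (K * (2 ^ J * X)) := by gcongr
  have h8 : (2 : ℝ) ^ J * (2 * K * (2 - (1 / 2) ^ I) * X) ≤ 2 ^ J * (2 * K * 2 * X) := by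
    have : (0 : ℝ) ≤ (1 / 2) ^ I := by positivity
    gcongr
    linarith
  have h9 : (2 : ℝ) ^ J * (2 * K * 2 * X) ≤ 2 ^ J * (2 ^ J * (2 * K * 2 * X)) :=
    mul_le_mul_of_nonneg_left (le_mul_of_one_le_left (by positivity) h5) (by positivity)
  calc _ ≤ 2 ^ J * (K * (2 ^ J * X)) + 2 ^ J * (2 ^ J * (2 * K * 2 * X)) := by linarith
    _ = _ := by rw [h4]; ring

open Polynomial in
/-- Polynomials satisfying `P ^ 3 = Q ^ 2` to order `N` have an exponentially accurate
approximate root on a disc of comparable radius. -/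
lemma exists_holomorphic_near_root_of_polynomial {B θ : ℝ} (hB : 0 ≤ B) (hθ0 : 0 < θ)
    (hθ1 : θ ≤ 1) :
    ∃ K > 0, ∃ c > 0, c ≤ θ ^ 3 ∧ c ≤ 1 ∧ ∀ (P Q : ℂ[X]) (N : ℕ) (ε L : ℝ), N ≠ 0 → 0 < ε →
      (∀ z, ‖z‖ ≤ ε → ‖P.eval z‖ ≤ B) → (∀ z, ‖z‖ ≤ ε → ‖Q.eval z‖ ≤ B) →
      (∀ t : ℝ, 0 < t → t ≤ ε → ‖P.eval (t : ℂ) ^ 3 - Q.eval (t : ℂ) ^ 2‖ ≤ L * t ^ N) →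
      ∃ F : ℂ → ℂ, DifferentiableOn ℂ F (Metric.ball 0 (2 * (c * ε))) ∧
        ∀ z, ‖z‖ ≤ c * ε → ‖F z‖ ≤ K ∧ ‖F z ^ 2 - P.eval z‖ ≤ K * (θ ^ N) ^ 3 ∧
          ‖F z ^ 3 - Q.eval z‖ ≤ K * (θ ^ N) ^ 3 := by
  obtain ⟨K, hK, hroot⟩ := exists_holomorphic_near_root hB
  set D := B ^ 3 + B ^ 2 + 1 with hD
  have hD1 : 1 ≤ D := by have : 0 ≤ B ^ 3 + B ^ 2 := by positivity
                         linarith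
  set δ := θ ^ 36 / D with hδ
  have hδ0 : 0 < δ := by positivity
  have hδθ : δ ≤ θ ^ 36 := div_le_self (by positivity) hD1
  have hδ1 : δ ≤ 1 := hδθ.trans (pow_le_one₀ hθ0.le hθ1)
  have hθ3 : θ ^ 36 ≤ θ ^ 3 := pow_le_pow_of_le_one hθ0.le hθ1 (by norm_num)
  refine ⟨K ^ 2 + K, by positivity, δ / 32, by positivity, by linarith, by linarith,
    fun P Q N ε L hN hε hP hQ hL => ?_⟩
  have hs : δ * ε ≠ 0 := by positivity
  have hsch : ∀ z, ‖z‖ ≤ ε → ‖(P ^ 3 - Q ^ 2).eval z‖ ≤ D * (‖z‖ / ε) ^ N := fun z hz =>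
    Polynomial.norm_eval_le_of_forall_pos (L := L) hε
      (fun t ht hte => by simpa using hL t ht hte)
      (fun z hz => by
        rw [eval_sub, eval_pow, eval_pow]
        refine (norm_sub_le _ _).trans ?_
        rw [norm_pow, norm_pow]
        have h1 : ‖P.eval z‖ ^ 3 ≤ B ^ 3 := by have := hP z hz; gcongr
        have h2 : ‖Q.eval z‖ ^ 2 ≤ B ^ 2 := by have := hQ z hz; gcongr
        linarith) hz
  have hscale : ∀ z : ℂ, ‖(δ * ε : ℝ) * z‖ = δ * ε * ‖z‖ := fun z => by
    rw [norm_mul, Complex.norm_real, Real.norm_of_nonneg (by positivity)]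
  have hle : ∀ z : ℂ, ‖z‖ < 1 → ‖(δ * ε : ℝ) * z‖ ≤ ε := fun z hz => by
    rw [hscale]
    calc δ * ε * ‖z‖ ≤ 1 * ε * 1 := by gcongr
      _ = ε := by ring
  obtain ⟨F, hFd, hF⟩ := hroot (fun z => P.eval ((δ * ε : ℝ) * z)) (fun z => Q.eval ((δ * ε : ℝ) * z))
    (P.differentiable.comp (by fun_prop)) (Q.differentiable.comp (by fun_prop))
    (fun z hz => hP _ (hle z hz)) ((θ ^ N) ^ 3) (by positivity)
    (pow_le_one₀ (by positivity) (pow_le_one₀ hθ0.le hθ1)) (fun z hz => by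
      have h1 := hsch _ (hle z hz)
      rw [eval_sub, eval_pow, eval_pow, hscale] at h1
      refine h1.trans ?_
      calc D * (δ * ε * ‖z‖ / ε) ^ N ≤ D ^ N * δ ^ N := by
            have h2 : δ * ε * ‖z‖ / ε ≤ δ := by
              rw [div_le_iff₀ hε]
              exact mul_le_of_le_one_right (by positivity) hz.le
            gcongr
            exact le_self_pow₀ hD1 hN
        _ = ((θ ^ N) ^ 3) ^ 12 := by
            rw [← mul_pow, hδ, mul_div_cancel₀ _ (by positivity), ← pow_mul, ← pow_mul, ← pow_mul]
            congr 1; ring)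
  have hinv : ∀ z : ℂ, ((δ * ε : ℝ) : ℂ) * (z / (δ * ε : ℝ)) = z := fun z => by
    rw [mul_div_cancel₀]
    exact Complex.ofReal_ne_zero.2 hs
  have hnd : ∀ z : ℂ, ‖z / (δ * ε : ℝ)‖ = ‖z‖ / (δ * ε) := fun z => by
    rw [norm_div, Complex.norm_real, Real.norm_of_nonneg (by positivity)]
  refine ⟨fun z => F (z / (δ * ε : ℝ)), ?_, fun z hz => ?_⟩
  · refine hFd.comp (by fun_prop) fun z hz => ?_
    rw [mem_ball_zero_iff] at hz ⊢
    rw [hnd, div_lt_iff₀ (by positivity)]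
    linarith
  · obtain ⟨h1, h2, h3⟩ := hF (z / (δ * ε : ℝ)) (by
      rw [hnd, div_lt_iff₀ (by positivity)]
      have : 0 < δ * ε := by positivity
      linarith)
    simp only [hinv] at h2 h3
    have h0 : 0 ≤ (θ ^ N) ^ 3 := by positivity
    refine ⟨by nlinarith, by nlinarith [mul_nonneg (sq_nonneg K) h0], ?_⟩
    calc _ = ‖F (z / (δ * ε : ℝ)) * (F (z / (δ * ε : ℝ)) ^ 2 - P.eval z) +
          (F (z / (δ * ε : ℝ)) * P.eval z - Q.eval z)‖ := by congr 1; ring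
      _ ≤ K * (K * (θ ^ N) ^ 3) + K * (θ ^ N) ^ 3 := by
        refine (norm_add_le _ _).trans ?_
        rw [norm_mul]
        gcongr
      _ = _ := by ring

/-- `u` has the one-sided formal Taylor expansion `a` at the origin, with coefficients and
remainders on `[0, r]` controlled by the weight sequence `M`. -/
def HasJet (M : ℕ → ℝ) (C σ r : ℝ) (u : ℝ → ℂ) (a : ℕ → ℂ) : Prop :=
  (∀ j, ‖a j‖ ≤ C * σ ^ j * M j) ∧ ∀ (N : ℕ) (t : ℝ), 0 ≤ t → t ≤ r →
    ‖u t - ∑ j ∈ Finset.range N, a j * (t : ℂ) ^ j‖ ≤ C * σ ^ N * M N * t ^ N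

namespace HasJet

variable {M : ℕ → ℝ} {C σ r : ℝ} {u : ℝ → ℂ} {a : ℕ → ℂ}

lemma norm_le (h : HasJet M C σ r u a) (hM : IsWeightSeq M) {t : ℝ} (ht : 0 ≤ t) (htr : t ≤ r) :
    ‖u t‖ ≤ C := by
  simpa [hM.2.2.1] using h.2 0 t ht htr

lemma norm_sum_Ico_le (h : HasJet M C σ r u a) (hM : IsWeightSeq M) (hC : 0 ≤ C) (hσ : 0 < σ)
    {N : ℕ} (hN : N ≠ 0) {z : ℂ} {q : ℝ} (hz : ‖z‖ * (σ * rootSeq M N) ≤ q) (hq : q ≤ 1 / 2)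
    (m : ℕ) : ‖∑ j ∈ Finset.Ico m N, a j * z ^ j‖ ≤ 2 * C * q ^ m := by
  have hμ := zero_le_one.trans (hM.one_le_rootSeq N)
  have hq0 : 0 ≤ q := le_trans (by positivity) hz
  calc _ ≤ ∑ j ∈ Finset.Ico m N, C * q ^ j := by
        refine norm_sum_le_of_le _ fun j hj => ?_
        rw [Finset.mem_Ico] at hj
        rw [norm_mul, norm_pow]
        calc ‖a j‖ * ‖z‖ ^ j ≤ (C * σ ^ j * rootSeq M N ^ j) * ‖z‖ ^ j := by
              gcongr
              refine (h.1 j).trans ?_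
              gcongr
              exact hM.le_rootSeq_pow hN hj.2.le
          _ = C * (‖z‖ * (σ * rootSeq M N)) ^ j := by rw [mul_pow, mul_pow]; ring
          _ ≤ _ := by gcongr
    _ = C * ∑ j ∈ Finset.Ico m N, q ^ j := by rw [Finset.mul_sum]
    _ ≤ C * (q ^ m / (1 - q)) := by
        gcongr
        exact geom_sum_Ico_le_of_lt_one hq0 (by linarith)
    _ ≤ C * (q ^ m / (1 / 2)) := by
        gcongr
        linarith
    _ = _ := by ring

lemma norm_sub_sum_le (h : HasJet M C σ r u a) (hM : IsWeightSeq M) (hC : 0 ≤ C) (hσ : 0 < σ)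
    {N : ℕ} (hN : N ≠ 0) {t q : ℝ} (ht : 0 ≤ t) (htr : t ≤ r)
    (htq : t * (σ * rootSeq M N) ≤ q) :
    ‖u t - ∑ j ∈ Finset.range N, a j * (t : ℂ) ^ j‖ ≤ C * q ^ N := by
  have hμ := zero_le_one.trans (hM.one_le_rootSeq N)
  refine (h.2 N t ht htr).trans ?_
  rw [← hM.rootSeq_pow hN]
  calc _ = C * (t * (σ * rootSeq M N)) ^ N := by rw [mul_pow, mul_pow]; ring
    _ ≤ _ := by gcongr

end HasJet

open Polynomial in
lemma exists_holomorphic_near_root_of_hasJet {M : ℕ → ℝ} (hM : IsWeightSeq M) {C σ r θ : ℝ}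
    (hC : 1 ≤ C) (hσ : 0 < σ) (hr : 1 ≤ 2 * σ * r) (hθ0 : 0 < θ) (hθ1 : θ ≤ 1) :
    ∃ K > 0, ∃ c > 0, c ≤ θ ^ 3 ∧ c ≤ 1 ∧ ∀ (w : ℝ → ℂ) (a b : ℕ → ℂ),
      HasJet M C σ r (fun t => w t ^ 2) a → HasJet M C σ r (fun t => w t ^ 3) b →
      ∀ N : ℕ, N ≠ 0 → ∃ F : ℂ → ℂ,
        DifferentiableOn ℂ F (Metric.ball 0 (2 * (c / (2 * σ * rootSeq M N)))) ∧
        ∀ z, ‖z‖ ≤ c / (2 * σ * rootSeq M N) → ‖F z‖ ≤ K ∧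
          ‖F z ^ 2 - ∑ j ∈ Finset.range N, a j * z ^ j‖ ≤ K * (θ ^ N) ^ 3 ∧
          ‖F z ^ 3 - ∑ j ∈ Finset.range N, b j * z ^ j‖ ≤ K * (θ ^ N) ^ 3 := by
  have hC0 : 0 ≤ C := by linarith
  obtain ⟨K, hK, c, hc, hcθ, hc1, H⟩ :=
    exists_holomorphic_near_root_of_polynomial (B := 2 * C) (by positivity) hθ0 hθ1
  refine ⟨K, hK, c, hc, hcθ, hc1, fun w a b ha hb N hN => ?_⟩
  have hμ := hM.one_le_rootSeq N
  have hμ0 : 0 < rootSeq M N := by linarith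
  have hεr : 1 / (2 * σ * rootSeq M N) ≤ r := by
    rw [div_le_iff₀ (by positivity)]
    have : 0 ≤ r := by
      by_contra! h
      nlinarith
    nlinarith [mul_nonneg (by linarith : 0 ≤ 2 * σ * r) (by linarith : 0 ≤ rootSeq M N - 1)]
  have heval : ∀ (e : ℕ → ℂ) (z : ℂ),
      (∑ j ∈ Finset.range N, Polynomial.C (e j) * X ^ j).eval z =
        ∑ j ∈ Finset.range N, e j * z ^ j := fun e z => by
    simp [eval_finsetSum]
  have hbd : ∀ {u : ℝ → ℂ} {e : ℕ → ℂ}, HasJet M C σ r u e →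
      ∀ z, ‖z‖ ≤ 1 / (2 * σ * rootSeq M N) →
        ‖∑ j ∈ Finset.range N, e j * z ^ j‖ ≤ 2 * C := fun he z hz => by
    have h1 : ‖z‖ * (σ * rootSeq M N) ≤ 1 / 2 := by
      rw [le_div_iff₀ (by positivity)] at hz
      linarith
    simpa using he.norm_sum_Ico_le hM hC0 hσ hN h1 le_rfl 0
  obtain ⟨F, hF, hF'⟩ := H (∑ j ∈ Finset.range N, Polynomial.C (a j) * X ^ j)
    (∑ j ∈ Finset.range N, Polynomial.C (b j) * X ^ j) N (1 / (2 * σ * rootSeq M N))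
    (C * σ ^ N * M N * (12 * C ^ 2 + 4 * C)) hN (by positivity)
    (fun z hz => by rw [heval]; exact hbd ha z hz) (fun z hz => by rw [heval]; exact hbd hb z hz)
    (fun t ht htε => by
      rw [heval, heval]
      have htn : ‖(t : ℂ)‖ ≤ 1 / (2 * σ * rootSeq M N) := by
        rwa [Complex.norm_real, Real.norm_of_nonneg ht.le]
      have e1 := ha.2 N t ht.le (htε.trans hεr)
      have e2 := hb.2 N t ht.le (htε.trans hεr)
      have p1 := hbd ha t htn
      have p2 := hbd hb t htn
      have w1 := ha.norm_le hM ht.le (htε.trans hεr)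
      have w2 := hb.norm_le hM ht.le (htε.trans hεr)
      simp only at e1 e2 w1 w2
      set P := ∑ j ∈ Finset.range N, a j * (t : ℂ) ^ j
      set Q := ∑ j ∈ Finset.range N, b j * (t : ℂ) ^ j
      set E := C * σ ^ N * M N * t ^ N
      have hE : 0 ≤ E := (norm_nonneg _).trans e1
      have h1 : P ^ 3 - Q ^ 2 = -((w t ^ 2 - P) * (P ^ 2 + P * w t ^ 2 + (w t ^ 2) ^ 2)) +
          (w t ^ 3 - Q) * (Q + w t ^ 3) := by ring
      have h2 : ‖P ^ 2 + P * w t ^ 2 + (w t ^ 2) ^ 2‖ ≤ 12 * C ^ 2 := by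
        calc _ ≤ ‖P‖ ^ 2 + ‖P‖ * ‖w t ^ 2‖ + ‖w t ^ 2‖ ^ 2 := by
              refine (norm_add₃_le).trans ?_
              rw [norm_mul, norm_pow P, norm_pow (w t ^ 2)]
          _ ≤ (2 * C) ^ 2 + (2 * C) * C + C ^ 2 := by gcongr
          _ ≤ _ := by nlinarith
      have h3 : ‖Q + w t ^ 3‖ ≤ 4 * C := (norm_add_le _ _).trans (by linarith)
      rw [h1]
      refine (norm_add_le _ _).trans ?_
      rw [norm_neg, norm_mul, norm_mul]
      calc _ ≤ E * (12 * C ^ 2) + E * (4 * C) := by gcongr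
        _ = _ := by simp only [E]; ring)
  refine ⟨F, by simpa [div_eq_mul_inv] using hF, fun z hz => ?_⟩
  have := hF' z (by rwa [← mul_div_assoc, mul_one])
  rwa [heval, heval] at this

lemma exists_altSum_bound_of_hasJet {M : ℕ → ℝ} (hM : IsWeightSeq M) (hMG : ModerateGrowth M)
    {C σ r : ℝ} (hC : 1 ≤ C) (hσ : 0 < σ) (hr : 1 ≤ 2 * σ * r) :
    ∃ C' > 0, ∃ σ' > 0, ∀ J : ℕ, 1 ≤ J → ∃ η > 0, ∀ (w : ℝ → ℂ) (a b : ℕ → ℂ),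
      HasJet M C σ r (fun t => w t ^ 2) a → HasJet M C σ r (fun t => w t ^ 3) b →
      ∀ h : ℝ, 0 < h → h ≤ η →
        ‖altSum J fun k => w (k * h)‖ ≤ C' * σ' ^ J * J.factorial * M J * h ^ J := by
  have hC0 : 0 ≤ C := by linarith
  obtain ⟨A₀, hA₀, hMG⟩ := hMG
  set A := max A₀ 1 with hA
  have hA1 : 1 ≤ A := le_max_right _ _
  have hA0 : 0 < A := by linarith
  set θ := 1 / (2 * A) with hθ
  have hθ0 : 0 < θ := by positivity
  have hθA : θ * A ≤ 1 / 2 := by rw [hθ]; field_simp; rfl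
  have hθ1 : θ ≤ 1 := by nlinarith
  obtain ⟨K, hK, c, hc, hcθ, hc1, H⟩ :=
    exists_holomorphic_near_root_of_hasJet hM hC hσ hr hθ0 hθ1
  set K₁ := 4 + (2 * K + 2 * C) * (1 + (K + C)) with hK₁
  have hK₁0 : 0 < K₁ := by positivity
  refine ⟨5 * K₁, by positivity, 8 * σ * Real.exp 1 / c, by positivity, fun J hJ => ?_⟩
  have hμ : ∀ N, 0 < rootSeq M N := fun N => zero_lt_one.trans_le (hM.one_le_rootSeq N)
  have hJ0 : (0 : ℝ) < J := by exact_mod_cast hJ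
  have hN : ∀ i, 2 ^ i * J ≠ 0 := fun i => by positivity
  set R : ℕ → ℝ := fun i => c / (2 * σ * rootSeq M (2 ^ i * J)) with hR
  have hR0 : ∀ i, 0 < R i := fun i => by have := hμ (2 ^ i * J); simp only [hR]; positivity
  refine ⟨R 0 / 2 / J, by have := hR0 0; positivity, fun w a b ha hb h hh hhη => ?_⟩
  choose! F hF hF' using H w a b ha hb
  have hRr : ∀ i, R i ≤ r := fun i => by
    simp only [hR]
    have h1 := hM.one_le_rootSeq (2 ^ i * J)
    rw [div_le_iff₀ (by positivity)]
    nlinarith [mul_nonneg (by linarith : 0 ≤ 2 * σ * r)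
      (by linarith : 0 ≤ rootSeq M (2 ^ i * J) - 1)]
  have hRmul : ∀ i t, t ≤ R i → t * (σ * rootSeq M (2 ^ i * J)) ≤ c / 2 := fun i t ht => by
    have := hμ (2 ^ i * J)
    simp only [hR] at ht
    rw [le_div_iff₀ (by positivity)] at ht
    linarith
  have hqθ : ∀ N : ℕ, (c / 2) ^ N ≤ (θ ^ N) ^ 3 := fun N => by
    rw [← pow_mul, mul_comm, pow_mul]
    exact pow_le_pow_left₀ (by positivity) (by linarith) N
  have hsucc : ∀ i, 2 ^ (i + 1) * J = 2 * (2 ^ i * J) := fun i => by ring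
  have hRanti : ∀ i, R (i + 1) ≤ R i := fun i => by
    have := hμ (2 ^ i * J)
    simp only [hR]
    gcongr
    refine hM.rootSeq_mono (hN i) ?_
    rw [hsucc]; omega
  have hKK₁ : K ≤ K₁ := by
    have : 0 ≤ (2 * K + 2 * C) * (K + C) := by positivity
    rw [hK₁, mul_add]
    linarith
  have key := norm_altSum_le_of_ladder (w := w) (G := fun i => F (2 ^ i * J)) (R := R) (K := K₁)
    hJ hA1 hθ0 hθA hR0
    (fun i => by
      have h1 := hμ (2 ^ i * J)
      have h2 := hμ (2 ^ (i + 1) * J)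
      simp only [hR]
      rw [← mul_div_assoc, div_le_div_iff₀ (by positivity) (by positivity)]
      have h3 := hM.rootSeq_two_mul hA₀ hMG (hN i)
      rw [← hsucc] at h3
      have h4 : rootSeq M (2 ^ (i + 1) * J) ≤ A * rootSeq M (2 ^ i * J) :=
        h3.trans (by gcongr; exact le_max_left _ _)
      nlinarith [mul_le_mul_of_nonneg_left h4 (by positivity : 0 ≤ c * (2 * σ))])
    hRanti
    (by
      simp only [hR]
      refine Tendsto.const_div_atTop ?_ c
      refine Tendsto.const_mul_atTop (by positivity) (hM.tendsto_rootSeq.comp ?_)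
      refine tendsto_atTop_mono (fun i => ?_) (tendsto_pow_atTop_atTop_of_one_lt one_lt_two)
      exact Nat.le_mul_of_pos_right _ hJ)
    (fun i => hF _ (hN i))
    (fun z hz => ((hF' _ (hN 0) z hz).1).trans hKK₁)
    (fun i z hz => by
      obtain ⟨h1, h2, h3⟩ := hF' _ (hN i) z (hz.trans (hRanti i))
      obtain ⟨h4, h5, h6⟩ := hF' _ (hN (i + 1)) z hz
      have hle : 2 ^ i * J ≤ 2 ^ (i + 1) * J := by rw [hsucc]; omega
      have hθle : (θ ^ (2 ^ (i + 1) * J)) ^ 3 ≤ (θ ^ (2 ^ i * J)) ^ 3 := by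
        gcongr ?_ ^ 3
        exact pow_le_pow_of_le_one hθ0.le hθ1 hle
      have hsum : ∀ {u : ℝ → ℂ} {e : ℕ → ℂ}, HasJet M C σ r u e →
          ‖∑ j ∈ Finset.range (2 ^ (i + 1) * J), e j * z ^ j -
            ∑ j ∈ Finset.range (2 ^ i * J), e j * z ^ j‖ ≤ 2 * C * (θ ^ (2 ^ i * J)) ^ 3 :=
        fun he => by
          rw [← Finset.sum_Ico_eq_sub _ hle]
          refine (he.norm_sum_Ico_le hM hC0 hσ (hN (i + 1)) (hRmul _ _ hz) (by linarith) _).trans ?_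
          gcongr
          exact hqθ _
      have tri : ∀ x y p p' : ℂ, ‖x - p‖ ≤ K * (θ ^ (2 ^ i * J)) ^ 3 →
          ‖y - p'‖ ≤ K * (θ ^ (2 ^ (i + 1) * J)) ^ 3 →
          ‖p' - p‖ ≤ 2 * C * (θ ^ (2 ^ i * J)) ^ 3 →
          ‖x - y‖ ≤ (2 * K + 2 * C) * (θ ^ (2 ^ i * J)) ^ 3 := fun x y p p' k1 k2 k3 => by
        have e : x - y = (x - p) - (y - p') - (p' - p) := by ring
        rw [e]
        refine (norm_sub_le _ _).trans ((add_le_add_left (norm_sub_le _ _) _).trans ?_)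
        have := mul_le_mul_of_nonneg_left hθle hK.le
        linarith
      exact norm_sub_le_of_sq_of_cube (B := K + C) (by positivity) (by positivity)
        (by linarith) (by linarith) (tri _ _ _ _ h2 h5 (hsum ha)) (tri _ _ _ _ h3 h6 (hsum hb)))
    (fun i t ht htR => by
      have htn : ‖(t : ℂ)‖ ≤ R i := by rwa [Complex.norm_real, Real.norm_of_nonneg ht]
      obtain ⟨h1, h2, h3⟩ := hF' _ (hN i) t htn
      have hw : ‖w t‖ ≤ C := by
        have h4 := ha.norm_le hM ht (htR.trans (hRr i))
        rw [norm_pow] at h4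
        by_contra! h5
        nlinarith
      have tri : ∀ {u : ℝ → ℂ} {e : ℕ → ℂ} (y : ℂ), HasJet M C σ r u e →
          ‖y - ∑ j ∈ Finset.range (2 ^ i * J), e j * (t : ℂ) ^ j‖ ≤ K * (θ ^ (2 ^ i * J)) ^ 3 →
          ‖u t - y‖ ≤ (2 * K + 2 * C) * (θ ^ (2 ^ i * J)) ^ 3 := fun {u e} y he hy => by
        have h4 := he.norm_sub_sum_le hM hC0 hσ (hN i) ht (htR.trans (hRr i)) (hRmul _ _ htR)
        have h5 : C * (c / 2) ^ (2 ^ i * J) ≤ C * (θ ^ (2 ^ i * J)) ^ 3 := by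
          gcongr
          exact hqθ _
        have e : u t - y = (u t - ∑ j ∈ Finset.range (2 ^ i * J), e j * (t : ℂ) ^ j) -
          (y - ∑ j ∈ Finset.range (2 ^ i * J), e j * (t : ℂ) ^ j) := by ring
        rw [e]
        refine (norm_sub_le _ _).trans ?_
        have : 0 ≤ (K + C) * (θ ^ (2 ^ i * J)) ^ 3 := by positivity
        linarith
      exact norm_sub_le_of_sq_of_cube (B := K + C) (by positivity) (by positivity)
        (by linarith) (by linarith) (tri _ ha h2) (tri _ hb h3))
    hh (by rwa [le_div_iff₀ hJ0] at hhη)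
  refine key.trans ?_
  have h1 := hμ J
  have h2 : (J : ℝ) ^ J ≤ Real.exp 1 ^ J * J.factorial := by
    have := Real.pow_div_factorial_le_exp (J : ℝ) hJ0.le J
    rw [div_le_iff₀ (by positivity)] at this
    rwa [← Real.exp_nat_mul, mul_one]
  have h3 : (h * J / R 0) ^ J = (2 * σ / c) ^ J * h ^ J * M J * J ^ J := by
    rw [← hM.rootSeq_pow (N := J) (by omega), ← mul_pow, ← mul_pow, ← mul_pow]
    congr 1
    simp only [hR, pow_zero, one_mul]
    field_simp
  rw [h3]
  have hMJ := hM.pos J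
  calc _ ≤ 5 * K₁ * 4 ^ J * ((2 * σ / c) ^ J * h ^ J * M J * (Real.exp 1 ^ J * J.factorial)) := by
        gcongr
    _ = 5 * K₁ * (4 * (2 * σ / c) * Real.exp 1) ^ J * J.factorial * M J * h ^ J := by
        rw [mul_pow, mul_pow]; ring
    _ = _ := by congr 4; ring

lemma norm_sub_sum_le_of_hasDerivAt {N : ℕ} {T B : ℝ} :
    ∀ {g : ℕ → ℝ → ℂ}, (∀ k < N, ∀ t ∈ Icc 0 T, HasDerivAt (g k) (g (k + 1) t) t) →
      (∀ t ∈ Icc 0 T, ‖g N t‖ ≤ B) → ∀ t ∈ Icc 0 T,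
        ‖g 0 t - ∑ j ∈ Finset.range N, g j 0 / j.factorial * (t : ℂ) ^ j‖ ≤
          B / N.factorial * t ^ N := by
  induction N with
  | zero => intro g _ hB t ht; simpa using hB t ht
  | succ N ih =>
    intro g hd hB
    have h1 := ih (g := fun k => g (k + 1)) (fun k hk => hd (k + 1) (by omega)) hB
    have hder : ∀ t ∈ Icc 0 T, HasDerivAt
        (fun t : ℝ => g 0 t - ∑ j ∈ Finset.range (N + 1), g j 0 / j.factorial * (t : ℂ) ^ j)
        (g 1 t - ∑ j ∈ Finset.range N, g (j + 1) 0 / j.factorial * (t : ℂ) ^ j) t := fun t ht => by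
      refine (hd 0 (by omega) t ht).sub ?_
      have h2 : ∀ j ∈ Finset.range (N + 1), HasDerivAt
          (fun t : ℝ => g j 0 / j.factorial * (t : ℂ) ^ j)
          (g j 0 / j.factorial * (j * (t : ℂ) ^ (j - 1) * 1)) t := fun j _ =>
        ((Complex.ofRealCLM.hasDerivAt (x := t)).pow j).const_mul _
      refine (HasDerivAt.fun_sum h2).congr_deriv ?_
      rw [Finset.sum_range_succ']
      simp only [Nat.cast_zero, zero_mul, mul_zero, add_zero]
      refine Finset.sum_congr rfl fun j _ => ?_
      have : (j.factorial : ℂ) ≠ 0 := by exact_mod_cast j.factorial_ne_zero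
      have : (j : ℂ) + 1 ≠ 0 := by exact_mod_cast j.succ_ne_zero
      rw [Nat.factorial_succ]
      push_cast
      field_simp
    refine image_norm_le_of_norm_deriv_right_le_deriv_boundary
      (B' := fun t => B / N.factorial * t ^ N)
      (fun t ht => (hder t ht).continuousAt.continuousWithinAt)
      (fun t ht => (hder t ⟨ht.1, ht.2.le⟩).hasDerivWithinAt) ?_ (fun t => ?_)
      (fun t ht => h1 t ⟨ht.1, ht.2.le⟩)
    · simp [Finset.sum_range_succ']
    · refine ((hasDerivAt_pow (N + 1) t).const_mul (B / (N + 1).factorial)).congr_deriv ?_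
      have : (N.factorial : ℝ) ≠ 0 := by exact_mod_cast N.factorial_ne_zero
      have : (N : ℝ) + 1 ≠ 0 := by exact_mod_cast N.succ_ne_zero
      rw [Nat.factorial_succ]
      push_cast
      field_simp

section

variable {E : Type*} [NormedAddCommGroup E] [NormedSpace ℝ E]

lemma hasDerivAt_iteratedFDeriv_line {u : E → ℂ} {x v : E} {k : ℕ} {t : ℝ}
    (hu : ContDiffAt ℝ (k + 1) u (x + t • v)) :
    HasDerivAt (fun s : ℝ => iteratedFDeriv ℝ k u (x + s • v) fun _ => v)
      (iteratedFDeriv ℝ (k + 1) u (x + t • v) fun _ => v) t := by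
  rw [← hu.deriv_fderiv_add_smul]
  have h_diff : DifferentiableAt ℝ (iteratedFDeriv ℝ k u) (x + t • v) :=
    hu.differentiableAt_iteratedFDeriv (by norm_cast; exact k.lt_succ_self)
  refine DifferentiableAt.hasDerivAt ?_
  fun_prop

lemma norm_sub_sum_iteratedFDeriv_le {u : E → ℂ} {x v : E} {T B : ℝ} {N : ℕ}
    (hu : ∀ t ∈ Icc 0 T, ContDiffAt ℝ N u (x + t • v))
    (hB : ∀ t ∈ Icc 0 T, ‖iteratedFDeriv ℝ N u (x + t • v) fun _ => v‖ ≤ B) :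
    ∀ t ∈ Icc 0 T, ‖u (x + t • v) - ∑ j ∈ Finset.range N,
      (iteratedFDeriv ℝ j u x fun _ => v) / j.factorial * (t : ℂ) ^ j‖ ≤
        B / N.factorial * t ^ N := by
  intro t ht
  simpa using norm_sub_sum_le_of_hasDerivAt
    (g := fun k s => iteratedFDeriv ℝ k u (x + s • v) fun _ => v)
    (fun k hk t ht => hasDerivAt_iteratedFDeriv_line ((hu t ht).of_le (by exact_mod_cast hk)))
    hB t ht

/-- Bounds for the finite differences along a line bound the corresponding derivative. -/
lemma norm_iteratedFDeriv_diag_le_of_altSum {u : E → ℂ} {x v : E} {B η : ℝ} {J : ℕ} (hη : 0 < η)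
    (hu : ContDiffAt ℝ (⊤ : ℕ∞) u x)
    (hB : ∀ h : ℝ, 0 < h → h ≤ η → ‖altSum J fun k => u (x + (k * h) • v)‖ ≤ B * h ^ J) :
    ‖iteratedFDeriv ℝ J u x fun _ => v‖ ≤ B := by
  have hc1 : ContDiffAt ℝ (J + 2 : ℕ) u x := contDiffAt_infty.1 hu (J + 2)
  have hev : ∀ᶠ y in 𝓝 x, ContDiffAt ℝ (J + 2 : ℕ) u y := hc1.eventually
    fun h => ENat.natCast_ne_top (J + 2) (WithTop.coe_injective h)
  have hcont : ContinuousAt (fun y => iteratedFDeriv ℝ (J + 1) u y fun _ => v) x :=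
    ((hc1.iteratedFDeriv_right (i := J + 1) (m := 0)
      (by norm_cast; simp)).continuousAt).eval_const _
  have hev2 := hcont.norm.eventually_lt_const (lt_add_one _)
  set D := ‖iteratedFDeriv ℝ (J + 1) u x fun _ => v‖ + 1 with hD
  have hline : Tendsto (fun t : ℝ => x + t • v) (𝓝 0) (𝓝 x) := by
    have : Continuous fun t : ℝ => x + t • v := by fun_prop
    simpa using this.tendsto 0
  obtain ⟨T, hT, hT'⟩ := Metric.eventually_nhds_iff_ball.1 (hline.eventually (hev.and hev2))
  have hTI : ∀ t ∈ Icc 0 (T / 2), t ∈ Metric.ball (0 : ℝ) T := fun t ht => by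
    rw [Metric.mem_ball, dist_zero_right, Real.norm_of_nonneg ht.1]
    linarith [ht.2]
  have htay := norm_sub_sum_iteratedFDeriv_le (N := J + 1) (B := D)
    (fun t ht => (hT' t (hTI t ht)).1.of_le (by exact_mod_cast (by omega : J + 1 ≤ J + 2)))
    (fun t ht => (hT' t (hTI t ht)).2.le)
  set a : ℕ → ℂ := fun j => (iteratedFDeriv ℝ j u x fun _ => v) / j.factorial with ha
  have hfac : (J.factorial : ℂ) ≠ 0 := by exact_mod_cast J.factorial_ne_zero
  set W := D / (J + 1).factorial with hW
  have hW0 : 0 ≤ W := by positivity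
  have key : ∀ h : ℝ, 0 < h → h ≤ η → h * (J + 1) ≤ T / 2 →
      ‖iteratedFDeriv ℝ J u x fun _ => v‖ ≤ B + 2 ^ J * (W * (J + 1) ^ (J + 1)) * h := by
    intro h hh hhη hhT
    have h1 : ‖(altSum J fun k => u (x + (k * h) • v)) -
        altSum J fun k => ∑ j ∈ Finset.range (J + 1), a j * ((k * h : ℝ) : ℂ) ^ j‖ ≤
        2 ^ J * (W * (h * (J + 1)) ^ (J + 1)) := by
      rw [← altSum_sub]
      refine norm_altSum_le fun k hk => ?_
      have hk' : (k : ℝ) * h ≤ h * (J + 1) := by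
        rw [mul_comm]
        gcongr
        exact_mod_cast hk.trans J.le_succ
      refine (htay (k * h) ⟨by positivity, hk'.trans hhT⟩).trans ?_
      gcongr
    have h2 : (altSum J fun k => ∑ j ∈ Finset.range (J + 1), a j * ((k * h : ℝ) : ℂ) ^ j) =
        (iteratedFDeriv ℝ J u x fun _ => v) * (h : ℂ) ^ J := by
      have e : (fun k : ℕ => ∑ j ∈ Finset.range (J + 1), a j * ((k * h : ℝ) : ℂ) ^ j) =
          fun k : ℕ => ∑ j ∈ Finset.range (J + 1), (a j * (h : ℂ) ^ j) * (k : ℂ) ^ j := by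
        funext k
        refine Finset.sum_congr rfl fun j _ => ?_
        push_cast
        rw [mul_pow]
        ring
      rw [e, altSum_sum]
      simp_rw [altSum_const_mul]
      rw [Finset.sum_range_succ, Finset.sum_eq_zero, altSum_pow_self]
      · simp only [ha]
        field_simp
        ring
      · intro j hj
        rw [altSum_pow_of_lt (Finset.mem_range.1 hj), mul_zero]
    rw [h2] at h1
    have h3 := norm_sub_norm_le ((iteratedFDeriv ℝ J u x fun _ => v) * (h : ℂ) ^ J)
      (altSum J fun k => u (x + (k * h) • v))
    rw [norm_sub_rev, norm_mul, norm_pow, Complex.norm_real, Real.norm_of_nonneg hh.le] at h3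
    have h4 := hB h hh hhη
    have h5 : ‖iteratedFDeriv ℝ J u x fun _ => v‖ * h ^ J ≤
        (B + 2 ^ J * (W * (J + 1) ^ (J + 1)) * h) * h ^ J := by
      have : (2 : ℝ) ^ J * (W * (h * (J + 1)) ^ (J + 1)) =
        2 ^ J * (W * (J + 1) ^ (J + 1)) * h * h ^ J := by rw [mul_pow]; ring
      linarith
    exact le_of_mul_le_mul_right h5 (by positivity)
  have hlim : Tendsto (fun h : ℝ => B + 2 ^ J * (W * (J + 1) ^ (J + 1)) * h) (𝓝[>] 0) (𝓝 B) := by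
    have : Continuous fun h : ℝ => B + 2 ^ J * (W * (J + 1) ^ (J + 1)) * h := by fun_prop
    simpa using (this.tendsto 0).mono_left nhdsWithin_le_nhds
  refine ge_of_tendsto hlim ?_
  have h1 : ∀ᶠ h in 𝓝[>] (0 : ℝ), h < min η (T / 2 / (J + 1)) :=
    mem_nhdsWithin_of_mem_nhds (Iio_mem_nhds (by positivity))
  filter_upwards [h1, self_mem_nhdsWithin] with h hh hh0
  refine key h hh0 (hh.le.trans (min_le_left _ _)) ?_
  rw [← le_div_iff₀ (by positivity)]
  exact hh.le.trans (min_le_right _ _)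

end

lemma iteratedFDeriv_comp_perm_of_contDiff {E F : Type*} [NormedAddCommGroup E] [NormedSpace ℝ E]
    [NormedAddCommGroup F] [NormedSpace ℝ F] {u : E → F} (hu : ContDiff ℝ (⊤ : ℕ∞) u) {n : ℕ} :
    ∀ (x : E) (v : Fin n → E) (σ : Equiv.Perm (Fin n)),
      iteratedFDeriv ℝ n u x (v ∘ σ) = iteratedFDeriv ℝ n u x v := by
  have hdiff : ∀ (k : ℕ) (x : E), DifferentiableAt ℝ (iteratedFDeriv ℝ k u) x := fun k x =>
    hu.contDiffAt.differentiableAt_iteratedFDeriv (WithTop.coe_lt_coe.2 (ENat.natCast_lt_top k))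
  induction n with
  | zero => intro x v σ; rw [Subsingleton.elim σ 1]; rfl
  | succ n ih =>
    have gen : ∀ (i : Fin n) (x : E) (v : Fin (n + 1) → E),
        iteratedFDeriv ℝ (n + 1) u x (v ∘ Equiv.swap i.castSucc i.succ) =
          iteratedFDeriv ℝ (n + 1) u x v := by
      intro i x v
      rcases n with _ | n
      · exact i.elim0
      induction i using Fin.cases with
      | zero =>
        have h2 : ContDiffAt ℝ 2 (iteratedFDeriv ℝ n u) x :=
          (hu.iteratedFDeriv_right (m := 2) (by
            exact WithTop.coe_le_coe.2 (le_top : ((2 + n : ℕ) : ℕ∞) ≤ ⊤))).contDiffAt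
        have hsymm : IsSymmSndFDerivAt ℝ (iteratedFDeriv ℝ n u) x :=
          h2.isSymmSndFDerivAt (by simp)
        have hform : ∀ w : Fin (n + 2) → E, iteratedFDeriv ℝ (n + 2) u x w =
            fderiv ℝ (fderiv ℝ (iteratedFDeriv ℝ n u)) x (w 0) (w 1) (Fin.tail (Fin.tail w)) := by
          intro w
          rw [(hdiff (n + 1) x).iteratedFDeriv_succ_apply_left']
          have e : (fun y => iteratedFDeriv ℝ (n + 1) u y (Fin.tail w)) = fun y =>
              (fderiv ℝ (iteratedFDeriv ℝ n u) y (w 1)) (Fin.tail (Fin.tail w)) := by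
            funext y
            rw [iteratedFDeriv_succ_apply_left]
            rfl
          have h3 : DifferentiableAt ℝ (fderiv ℝ (iteratedFDeriv ℝ n u)) x :=
            (h2.fderiv_right (m := 1) (by norm_num)).differentiableAt (by simp)
          have h4 : HasFDerivAt (fun y => fderiv ℝ (iteratedFDeriv ℝ n u) y (w 1))
              ((fderiv ℝ (fderiv ℝ (iteratedFDeriv ℝ n u)) x).flip (w 1)) x := by
            simpa using h3.hasFDerivAt.clm_apply (hasFDerivAt_const (w 1) x)
          rw [e, (h4.continuousMultilinear_apply_const (Fin.tail (Fin.tail w))).fderiv]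
          rfl
        rw [hform, hform]
        have e0 : (v ∘ Equiv.swap (0 : Fin (n + 1)).castSucc (0 : Fin (n + 1)).succ) 0 = v 1 := by
          simp [Equiv.swap_apply_left]
        have e1 : (v ∘ Equiv.swap (0 : Fin (n + 1)).castSucc (0 : Fin (n + 1)).succ) 1 = v 0 := by
          simp
        have e2 : Fin.tail (Fin.tail
            (v ∘ Equiv.swap (0 : Fin (n + 1)).castSucc (0 : Fin (n + 1)).succ)) =
            Fin.tail (Fin.tail v) := by
          funext k
          simp only [Fin.tail, Function.comp]
          rw [Equiv.swap_apply_of_ne_of_ne]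
          · simp [Fin.ext_iff]
          · simp [Fin.ext_iff]
        rw [e0, e1, e2, hsymm.eq]
      | succ i =>
        rw [(hdiff (n + 1) x).iteratedFDeriv_succ_apply_left',
          (hdiff (n + 1) x).iteratedFDeriv_succ_apply_left']
        have e0 : (v ∘ Equiv.swap i.succ.castSucc i.succ.succ) 0 = v 0 := by
          simp only [Function.comp]
          rw [Equiv.swap_apply_of_ne_of_ne]
          · simp [Fin.ext_iff]
          · simp [Fin.ext_iff]
        have e1 : Fin.tail (v ∘ Equiv.swap i.succ.castSucc i.succ.succ) =
            Fin.tail v ∘ Equiv.swap i.castSucc i.succ := by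
          funext k
          simp only [Fin.tail, Function.comp]
          congr 1
          rw [← Fin.succ_castSucc]
          exact ((Fin.succ_injective _).swap_apply _ _ _)
        rw [e0, e1]
        simp_rw [ih]
    intro x v σ
    have hσ : σ ∈ Submonoid.closure
        (Set.range fun i : Fin n => Equiv.swap i.castSucc i.succ) := by
      rw [Equiv.Perm.mclosure_swap_castSucc_succ]; trivial
    induction hσ using Submonoid.closure_induction generalizing v with
    | mem σ h => obtain ⟨i, rfl⟩ := h; exact gen i x v
    | one => rfl
    | mul σ τ _ _ h1 h2 =>
      rw [Equiv.Perm.coe_mul, ← Function.comp_assoc, h2, h1]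

/-- The polarization formula for symmetric multilinear maps. -/
lemma MultilinearMap.factorial_smul_eq_sum_of_symm {E F : Type*} [AddCommGroup E] [Module ℝ E]
    [AddCommGroup F] [Module ℝ F] {J : ℕ} (m : MultilinearMap ℝ (fun _ : Fin J => E) F)
    (hm : ∀ (v : Fin J → E) (σ : Equiv.Perm (Fin J)), m (v ∘ σ) = m v) (v : Fin J → E) :
    (J.factorial : ℝ) • m v =
      ∑ S : Finset (Fin J), (-1 : ℝ) ^ Sᶜ.card • m fun _ => ∑ i ∈ S, v i := by
  have h1 : ∀ S : Finset (Fin J), (m fun _ => ∑ i ∈ S, v i) =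
      ∑ r : Fin J → Fin J, (if ∀ j, r j ∈ S then (1 : ℝ) else 0) • m (v ∘ r) := fun S => by
    rw [m.map_sum_finset (fun _ i => v i) fun _ => S]
    simp_rw [ite_smul, one_smul, zero_smul]
    rw [← Finset.sum_filter]
    refine Finset.sum_congr ?_ fun r _ => rfl
    ext r
    simp [Fintype.mem_piFinset]
  have h2 : ∀ r : Fin J → Fin J, ∑ S : Finset (Fin J),
      (-1 : ℝ) ^ Sᶜ.card * (if ∀ j, r j ∈ S then (1 : ℝ) else 0) =
        if Function.Surjective r then 1 else 0 := by
    intro r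
    split_ifs with hr
    · rw [Finset.sum_eq_single Finset.univ]
      · simp
      · intro S _ hS
        rw [if_neg, mul_zero]
        intro h
        refine hS (Finset.eq_univ_of_forall fun i => ?_)
        obtain ⟨j, rfl⟩ := hr i
        exact h j
      · simp
    · obtain ⟨i, hi⟩ := not_forall.1 hr
      have hne : ∀ j, r j ≠ i := fun j hj => hi ⟨j, hj⟩
      refine Finset.sum_involution (fun S _ => symmDiff S {i}) (fun S _ => ?_) (fun S _ _ h => ?_)
        (fun _ _ => Finset.mem_univ _) fun S _ => ?_
      · have e : (∀ j, r j ∈ symmDiff S {i}) ↔ ∀ j, r j ∈ S := by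
          simp [Finset.mem_symmDiff, hne]
        simp only [e]
        rw [← add_mul]
        by_cases hS : i ∈ S
        · have e2 : (symmDiff S {i})ᶜ = insert i Sᶜ := by
            ext k
            by_cases hk : k = i <;> simp [hk, hS]
          rw [e2, Finset.card_insert_of_notMem (by simpa using hS), pow_succ]
          ring
        · have e2 : Sᶜ = insert i (symmDiff S {i})ᶜ := by
            ext k
            by_cases hk : k = i <;> simp [hk, hS]
          rw [e2, Finset.card_insert_of_notMem (by simp [hS]), pow_succ]
          ring
      · rw [symmDiff_eq_left] at h
        exact Finset.singleton_ne_empty i h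
      · rw [symmDiff_assoc, symmDiff_self, symmDiff_bot]
  calc (J.factorial : ℝ) • m v = ∑ σ : Equiv.Perm (Fin J), m v := by
        rw [Finset.sum_const, Finset.card_univ, Fintype.card_perm, Fintype.card_fin,
          Nat.cast_smul_eq_nsmul]
    _ = ∑ r : Fin J → Fin J, (if Function.Surjective r then (1 : ℝ) else 0) • m (v ∘ r) := by
        refine Fintype.sum_of_injective (fun σ : Equiv.Perm (Fin J) => (σ : Fin J → Fin J))
          DFunLike.coe_injective _ _ (fun r hr => ?_) fun σ => ?_
        · rw [if_neg, zero_smul]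
          exact fun h => hr ⟨Equiv.ofBijective r (Finite.surjective_iff_bijective.1 h), rfl⟩
        · rw [if_pos σ.surjective, one_smul, hm]
    _ = _ := by
        simp_rw [h1, Finset.smul_sum, smul_smul]
        rw [Finset.sum_comm]
        simp_rw [← Finset.sum_smul, h2]

lemma ContinuousMultilinearMap.norm_le_of_symm_of_diag {E F : Type*} [NormedAddCommGroup E]
    [NormedSpace ℝ E] [NormedAddCommGroup F] [NormedSpace ℝ F] {J : ℕ} {B : ℝ}
    (m : ContinuousMultilinearMap ℝ (fun _ : Fin J => E) F)
    (hm : ∀ (v : Fin J → E) (σ : Equiv.Perm (Fin J)), m (v ∘ σ) = m v)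
    (hB : ∀ v, ‖v‖ ≤ 1 → ‖m fun _ => v‖ ≤ B) : ‖m‖ ≤ (2 * Real.exp 1) ^ J * B := by
  have hB0 : 0 ≤ B := (norm_nonneg _).trans (hB 0 (by simp))
  have hfac : (0 : ℝ) < J.factorial := by positivity
  have hunit : ∀ w : Fin J → E, (∀ i, ‖w i‖ ≤ 1) → ‖m w‖ ≤ (2 * Real.exp 1) ^ J * B := by
    intro w hw
    have h1 : ∀ S : Finset (Fin J), ‖m fun _ => ∑ i ∈ S, w i‖ ≤ (J : ℝ) ^ J * B := fun S => by
      have hS : ‖∑ i ∈ S, w i‖ ≤ J := by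
        refine (norm_sum_le_of_le _ fun i _ => hw i).trans ?_
        rw [Finset.sum_const, nsmul_eq_mul, mul_one]
        exact_mod_cast S.card_le_univ.trans_eq (Fintype.card_fin J)
      have e : (fun _ : Fin J => ∑ i ∈ S, w i) =
          fun _ : Fin J => (J : ℝ) • ((J : ℝ)⁻¹ • ∑ i ∈ S, w i) := by
        funext k
        have : (J : ℝ) ≠ 0 := by exact_mod_cast (Fin.pos k).ne'
        rw [smul_inv_smul₀ this]
      rw [e, m.map_smul_univ, norm_smul, Finset.prod_const, Finset.card_univ, Fintype.card_fin,
        norm_pow, Real.norm_natCast]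
      gcongr
      refine hB _ ?_
      rw [norm_smul, norm_inv, Real.norm_natCast]
      exact inv_mul_le_one_of_le₀ hS (by positivity)
    have h2 : J.factorial * ‖m w‖ ≤ 2 ^ J * (J ^ J * B) := by
      have h3 := m.toMultilinearMap.factorial_smul_eq_sum_of_symm hm w
      have h4 : ‖(J.factorial : ℝ) • m w‖ ≤ ∑ S : Finset (Fin J), (J : ℝ) ^ J * B := by
        rw [show (J.factorial : ℝ) • m w = _ from h3]
        refine norm_sum_le_of_le _ fun S _ => ?_
        rw [norm_smul, norm_pow, norm_neg, norm_one, one_pow, one_mul]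
        exact h1 S
      rw [norm_smul, Real.norm_natCast, Finset.sum_const, Finset.card_univ, Fintype.card_finset,
        Fintype.card_fin, nsmul_eq_mul] at h4
      exact_mod_cast h4
    have h3 : (J : ℝ) ^ J ≤ Real.exp 1 ^ J * J.factorial := by
      have := Real.pow_div_factorial_le_exp (J : ℝ) (by positivity) J
      rw [div_le_iff₀ (by positivity)] at this
      rwa [← Real.exp_nat_mul, mul_one]
    have h4 : J.factorial * ‖m w‖ ≤ J.factorial * ((2 * Real.exp 1) ^ J * B) := by
      refine h2.trans ?_
      calc (2 : ℝ) ^ J * (J ^ J * B) ≤ 2 ^ J * (Real.exp 1 ^ J * J.factorial * B) := by gcongr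
        _ = _ := by rw [mul_pow]; ring
    exact le_of_mul_le_mul_left h4 hfac
  refine m.opNorm_le_bound (by positivity) fun v => ?_
  have e : v = fun i => ‖v i‖ • (‖v i‖⁻¹ • v i) := by
    funext i
    by_cases h : v i = 0
    · simp [h]
    · rw [smul_inv_smul₀ (norm_ne_zero_iff.2 h)]
  conv_lhs => rw [e, m.map_smul_univ, norm_smul, norm_prod]
  simp_rw [norm_norm]
  rw [mul_comm]
  gcongr
  refine hunit _ fun i => ?_
  rw [norm_smul, norm_inv, norm_norm]
  exact inv_mul_le_one

/-- A pointwise limit of smooth functions whose derivatives of every order are uniformly bounded is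
smooth, with the same bounds. -/
lemma contDiffOn_of_tendsto_of_iteratedFDeriv_le {E : Type*} [NormedAddCommGroup E]
    [NormedSpace ℝ E] [FiniteDimensional ℝ E] {V : Set E} (hV : IsOpen V) (hVc : Convex ℝ V)
    {u : ℕ → E → ℂ} (hu : ∀ k, ContDiff ℝ (⊤ : ℕ∞) (u k)) {B : ℕ → ℝ}
    (hB : ∀ k j, ∀ x ∈ V, ‖iteratedFDeriv ℝ j (u k) x‖ ≤ B j) {f : E → ℂ}
    (hf : ∀ x ∈ V, Tendsto (fun k => u k x) atTop (𝓝 (f x))) :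
    ContDiffOn ℝ (⊤ : ℕ∞) f V ∧ ∀ j, ∀ x ∈ V, ‖iteratedFDerivWithin ℝ j f V x‖ ≤ B j := by
  have hlim : ∀ j x, ∃ L : E [×j]→L[ℝ] ℂ, x ∈ V →
      Tendsto (fun k => iteratedFDeriv ℝ j (u k) x) (hyperfilter ℕ) (𝓝 L) ∧ ‖L‖ ≤ B j := by
    intro j x
    by_cases hx : x ∈ V
    · have : FiniteDimensional ℝ (E [×j]→L[ℝ] ℂ) := FiniteDimensional.of_injective
        (ContinuousMultilinearMap.toMultilinearMapLinear :
          (E [×j]→L[ℝ] ℂ) →ₗ[ℝ] MultilinearMap ℝ (fun _ : Fin j => E) ℂ)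
        (fun a b h => ContinuousMultilinearMap.toMultilinearMap_injective h)
      have : ProperSpace (E [×j]→L[ℝ] ℂ) := FiniteDimensional.proper_real _
      obtain ⟨L, hL, hle⟩ := (isCompact_closedBall (0 : E [×j]→L[ℝ] ℂ) (B j)).ultrafilter_le_nhds
        ((hyperfilter ℕ).map fun k => iteratedFDeriv ℝ j (u k) x)
        (le_principal_iff.2 (Ultrafilter.mem_map.2 (univ_mem' fun k => by
          simpa using hB k j x hx)))
      exact ⟨L, fun _ => ⟨hle, by simpa using hL⟩⟩
    · exact ⟨0, fun h => absurd h hx⟩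
  choose D hD using hlim
  have hder : ∀ k m x, HasFDerivAt (iteratedFDeriv ℝ m (u k))
      (iteratedFDeriv ℝ (m + 1) (u k) x).curryLeft x := fun k m x =>
    ((hu k).contDiffAt.differentiableAt_iteratedFDeriv
      (WithTop.coe_lt_coe.2 (ENat.natCast_lt_top m))).hasFDerivAt
  have hlip : ∀ k m, ∀ x ∈ V, ∀ y ∈ V,
      ‖iteratedFDeriv ℝ m (u k) y - iteratedFDeriv ℝ m (u k) x‖ ≤ B (m + 1) * ‖y - x‖ :=
    fun k m x hx y hy => hVc.norm_image_sub_le_of_norm_hasFDerivWithin_le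
      (fun z _ => (hder k m z).hasFDerivWithinAt)
      (fun z hz => by rw [ContinuousMultilinearMap.curryLeft_norm]; exact hB k (m + 1) z hz) hx hy
  have htay : ∀ k m, ∀ x ∈ V, ∀ y ∈ V, ‖iteratedFDeriv ℝ m (u k) y - iteratedFDeriv ℝ m (u k) x
      - (iteratedFDeriv ℝ (m + 1) (u k) x).curryLeft (y - x)‖ ≤ B (m + 2) * ‖y - x‖ ^ 2 := by
    intro k m x hx y hy
    have hB0 : 0 ≤ B (m + 2) := (norm_nonneg _).trans (hB k (m + 2) x hx)
    have := (convex_segment x y).norm_image_sub_le_of_norm_hasFDerivWithin_le'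
      (f := iteratedFDeriv ℝ m (u k)) (C := B (m + 2) * ‖y - x‖)
      (φ := (iteratedFDeriv ℝ (m + 1) (u k) x).curryLeft)
      (fun z _ => (hder k m z).hasFDerivWithinAt) (fun z hz => by
        have h1 := hlip k (m + 1) x hx z (hVc.segment_subset hx hy hz)
        have h2 : ‖z - x‖ ≤ ‖y - x‖ := by
          obtain ⟨t, ht, rfl⟩ := (segment_eq_image' ℝ x y) ▸ hz
          simp only [add_sub_cancel_left, norm_smul, Real.norm_eq_abs, abs_of_nonneg ht.1]
          exact mul_le_of_le_one_left (norm_nonneg _) ht.2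
        have h3 : (iteratedFDeriv ℝ (m + 1) (u k) z).curryLeft
            - (iteratedFDeriv ℝ (m + 1) (u k) x).curryLeft =
            (iteratedFDeriv ℝ (m + 1) (u k) z - iteratedFDeriv ℝ (m + 1) (u k) x).curryLeft := by
          ext; rfl
        rw [h3, ContinuousMultilinearMap.curryLeft_norm]
        exact h1.trans (by gcongr)) (left_mem_segment ℝ x y) (right_mem_segment ℝ x y)
    linarith [this, sq (‖y - x‖)]
  have hcurry : ∀ m, Continuous fun L : E [×(m + 1)]→L[ℝ] ℂ => L.curryLeft := fun m =>
    (continuousMultilinearCurryLeftEquiv ℝ (fun _ : Fin (m + 1) => E) ℂ).continuous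
  have hDtay : ∀ m, ∀ x ∈ V, ∀ y ∈ V,
      ‖D m y - D m x - (D (m + 1) x).curryLeft (y - x)‖ ≤ B (m + 2) * ‖y - x‖ ^ 2 := by
    intro m x hx y hy
    have h3 : Tendsto (fun k => (iteratedFDeriv ℝ (m + 1) (u k) x).curryLeft (y - x))
        (hyperfilter ℕ) (𝓝 ((D (m + 1) x).curryLeft (y - x))) :=
      (((hcurry m).clm_apply continuous_const).tendsto _).comp (hD (m + 1) x hx).1
    exact le_of_tendsto (((hD m y hy).1.sub (hD m x hx).1).sub h3).norm
      (Eventually.of_forall fun k => htay k m x hx y hy)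
  have hDder : ∀ m, ∀ x ∈ V, HasFDerivAt (D m) (D (m + 1) x).curryLeft x := by
    intro m x hx
    rw [hasFDerivAt_iff_isLittleO]
    refine Asymptotics.IsBigO.trans_isLittleO ?_
      (Asymptotics.isLittleO_pow_sub_sub x one_lt_two)
    refine Asymptotics.IsBigO.of_bound (B (m + 2)) ?_
    filter_upwards [hV.mem_nhds hx] with y hy
    simpa using hDtay m x hx y hy
  have hT : HasFTaylorSeriesUpToOn (⊤ : ℕ∞) f (fun x j => D j x) V := by
    refine ⟨fun x hx => ?_, fun m _ x hx => (hDder m x hx).hasFDerivWithinAt,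
      fun m _ x hx => (hDder m x hx).continuousAt.continuousWithinAt⟩
    have h1 : Tendsto (fun k => (iteratedFDeriv ℝ 0 (u k) x).curry0) (hyperfilter ℕ)
        (𝓝 (D 0 x).curry0) :=
      ((continuousMultilinearCurryFin0 ℝ E ℂ).continuous.tendsto _).comp (hD 0 x hx).1
    refine tendsto_nhds_unique h1 ((hf x hx).mono_left ?_)
    exact Nat.hyperfilter_le_atTop
  refine ⟨hT.contDiffOn, fun j x hx => ?_⟩
  rw [← hT.eq_iteratedFDerivWithin_of_uniqueDiffOn
    (WithTop.coe_le_coe.2 le_top) hV.uniqueDiffOn hx]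
  exact (hD j x hx).2

lemma HasJet.mono {M : ℕ → ℝ} {C σ r C' σ' r' : ℝ} {u : ℝ → ℂ} {a : ℕ → ℂ}
    (h : HasJet M C σ r u a) (hM : IsWeightSeq M) (hC' : 0 ≤ C') (hC : C ≤ C') (hσ : 0 < σ)
    (hσ' : σ ≤ σ') (hr : r' ≤ r) : HasJet M C' σ' r' u a := by
  refine ⟨fun j => (h.1 j).trans ?_, fun N t ht htr => (h.2 N t ht (htr.trans hr)).trans ?_⟩
  · have := (hM.pos j).le
    gcongr
  · have := (hM.pos N).le
    gcongr

lemma exists_hasJet_of_isCMOnRn {n : ℕ} {M : ℕ → ℝ}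
    {g : EuclideanSpace ℝ (Fin n) → ℂ} {U : Set (EuclideanSpace ℝ (Fin n))} (hU : IsOpen U)
    (hg : IsCMOnRn n M g U) {r : ℝ} (hrU : Metric.closedBall 0 (2 * r) ⊆ U) :
    ∃ C ≥ 0, ∃ σ > 0, ∀ x ∈ Metric.closedBall 0 r, ∀ v, ‖v‖ ≤ 1 →
      ∃ a, HasJet M C σ r (fun t => g (x + t • v)) a := by
  obtain ⟨σ, hσ, C, hC, hb⟩ := hg.2 _ hrU (isCompact_closedBall _ _)
  refine ⟨C, hC, σ, hσ, fun x hx v hv => ?_⟩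
  rw [mem_closedBall_zero_iff] at hx
  have hmem : ∀ t ∈ Icc 0 r, x + t • v ∈ Metric.closedBall 0 (2 * r) := fun t ht => by
    rw [mem_closedBall_zero_iff]
    calc ‖x + t • v‖ ≤ ‖x‖ + t * ‖v‖ := (norm_add_le _ _).trans
          (by rw [norm_smul, Real.norm_of_nonneg ht.1])
      _ ≤ r + r * 1 := by gcongr; exacts [ht.1.trans ht.2, ht.2]
      _ = 2 * r := by ring
  have hdiag : ∀ j, ∀ y ∈ Metric.closedBall 0 (2 * r),
      ‖iteratedFDeriv ℝ j g y fun _ => v‖ ≤ C * σ ^ j * j.factorial * M j := fun j y hy => by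
    refine ((iteratedFDeriv ℝ j g y).le_opNorm _).trans ?_
    rw [← iteratedFDerivWithin_of_isOpen j hU (hrU hy)]
    refine (mul_le_of_le_one_right (norm_nonneg _) ?_).trans (hb j y hy)
    exact Finset.prod_le_one (fun _ _ => norm_nonneg _) fun _ _ => hv
  have hfac : ∀ j : ℕ, C * σ ^ j * j.factorial * M j / j.factorial = C * σ ^ j * M j :=
    fun j => by field_simp
  by_cases hr : 0 ≤ r
  · refine ⟨fun j => (iteratedFDeriv ℝ j g x fun _ => v) / j.factorial, fun j => ?_,
      fun N t ht htr => ?_⟩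
    · rw [norm_div, Complex.norm_natCast, ← hfac]
      gcongr
      exact hdiag j x (by simpa using hmem 0 ⟨le_rfl, hr⟩)
    · rw [← hfac]
      exact norm_sub_sum_iteratedFDeriv_le (fun s hs =>
        (contDiffAt_infty.1 (hg.1.contDiffAt (hU.mem_nhds (hrU (hmem s hs)))) N))
        (fun s hs => hdiag N _ (hmem s hs)) t ⟨ht, htr⟩
  · exact absurd ((norm_nonneg x).trans hx) hr

lemma continuousAt_of_pow_two_of_pow_three {X : Type*} [TopologicalSpace X] {f : X → ℂ} {x : X}
    (h2 : ContinuousAt (fun y => f y ^ 2) x) (h3 : ContinuousAt (fun y => f y ^ 3) x) :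
    ContinuousAt f x := by
  by_cases hx : f x = 0
  · have h := h2.norm.sqrt
    simp only [norm_pow, Real.sqrt_sq (norm_nonneg _)] at h
    have h' : Tendsto (fun y => ‖f y‖) (𝓝 x) (𝓝 0) := by simpa [ContinuousAt, hx] using h
    rw [ContinuousAt, hx]
    exact tendsto_zero_iff_norm_tendsto_zero.2 h'
  · have h := h3.div h2 (pow_ne_zero 2 hx)
    refine h.congr (Eventually.of_forall fun y => ?_)
    by_cases hy : f y = 0
    · simp [hy]
    · simp only [Pi.div_apply]; field_simp

/-- Mollification preserves uniform bounds on finite differences. -/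
lemma norm_altSum_convolution_le {E : Type*} [NormedAddCommGroup E] [NormedSpace ℝ E]
    [FiniteDimensional ℝ E] [MeasurableSpace E] [BorelSpace E] (μ : Measure E)
    [μ.IsAddHaarMeasure] (φ : ContDiffBump (0 : E)) {g : E → ℂ} (hg : Continuous g) {J : ℕ}
    {x : E} {w : ℕ → E} {B : ℝ}
    (hB : ∀ y, ‖y‖ ≤ φ.rOut → ‖altSum J fun k => g (x - y + w k)‖ ≤ B) :
    ‖altSum J fun k => convolution (φ.normed μ) g (ContinuousLinearMap.lsmul ℝ ℝ) μ (x + w k)‖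
      ≤ B := by
  have hintg : ∀ k, Integrable (fun y => φ.normed μ y • g (x + w k - y)) μ := fun k =>
    (φ.continuous_normed.smul
      (hg.comp (continuous_const.sub continuous_id))).integrable_of_hasCompactSupport
      φ.hasCompactSupport_normed.smul_right
  have heq : (altSum J fun k =>
      convolution (φ.normed μ) g (ContinuousLinearMap.lsmul ℝ ℝ) μ (x + w k)) =
      ∫ y, φ.normed μ y • altSum J (fun k => g (x - y + w k)) ∂μ := by
    simp only [altSum, convolution_def, ContinuousLinearMap.lsmul_apply, Finset.smul_sum]
    rw [integral_finsetSum]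
    · refine Finset.sum_congr rfl fun k _ => ?_
      rw [← integral_const_mul]
      congr 1 with y
      rw [mul_smul_comm, sub_add_eq_add_sub]
    · intro k _
      refine ((hintg k).const_mul ((-1) ^ (J - k) * (J.choose k : ℂ))).congr
        (Eventually.of_forall fun y => ?_)
      dsimp only
      rw [mul_smul_comm, sub_add_eq_add_sub]
  rw [heq]
  calc _ ≤ ∫ y, φ.normed μ y * B ∂μ := by
        refine norm_integral_le_of_norm_le (φ.integrable_normed.mul_const B)
          (Eventually.of_forall fun y => ?_)
        rw [norm_smul, Real.norm_of_nonneg (φ.nonneg_normed y)]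
        by_cases hy : φ.normed μ y = 0
        · simp [hy]
        · have : y ∈ Function.support (φ.normed μ) := hy
          rw [φ.support_normed_eq, mem_ball_zero_iff] at this
          exact mul_le_mul_of_nonneg_left (hB y this.le) (φ.nonneg_normed y)
    _ = B := by rw [integral_mul_const, φ.integral_normed, one_mul]

lemma exists_isCMOnRn_of_pow_two_of_pow_three {n : ℕ} {M : ℕ → ℝ} (hM : IsWeightSeq M)
    (hMG : ModerateGrowth M) {f : EuclideanSpace ℝ (Fin n) → ℂ}
    {U : Set (EuclideanSpace ℝ (Fin n))} (hU : IsOpen U) (hU0 : 0 ∈ U)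
    (h2 : IsCMOnRn n M (fun x => f x ^ 2) U) (h3 : IsCMOnRn n M (fun x => f x ^ 3) U) :
    ∃ V : Set (EuclideanSpace ℝ (Fin n)), IsOpen V ∧ 0 ∈ V ∧ IsCMOnRn n M f V := by
  obtain ⟨r, hr, hrU⟩ : ∃ r > 0, Metric.closedBall (0 : EuclideanSpace ℝ (Fin n)) (2 * r) ⊆ U := by
    obtain ⟨ρ, hρ, hρU⟩ := Metric.nhds_basis_closedBall.mem_iff.1 (hU.mem_nhds hU0)
    exact ⟨ρ / 2, by positivity, by rwa [mul_div_cancel₀ _ two_ne_zero]⟩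
  obtain ⟨C₂, hC₂, σ₂, hσ₂, hj₂⟩ := exists_hasJet_of_isCMOnRn hU h2 hrU
  obtain ⟨C₃, hC₃, σ₃, hσ₃, hj₃⟩ := exists_hasJet_of_isCMOnRn hU h3 hrU
  obtain ⟨C, hC1, hCC₂, hCC₃⟩ : ∃ C, 1 ≤ C ∧ C₂ ≤ C ∧ C₃ ≤ C :=
    ⟨max 1 (max C₂ C₃), by simp, by simp, by simp⟩
  obtain ⟨σ, hσr, hσσ₂, hσσ₃⟩ : ∃ σ, 1 / (2 * r) ≤ σ ∧ σ₂ ≤ σ ∧ σ₃ ≤ σ :=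
    ⟨max (1 / (2 * r)) (max σ₂ σ₃), by simp, by simp, by simp⟩
  have hC0 : 0 ≤ C := by linarith
  have hσ : 0 < σ := by linarith
  have hσr' : 1 ≤ 2 * σ * r := by
    rw [div_le_iff₀ (by positivity)] at hσr
    linarith
  obtain ⟨C', hC', σ', hσ', hA⟩ := exists_altSum_bound_of_hasJet hM hMG hC1 hσ hσr'
  obtain ⟨g, hg, hgf⟩ : ∃ g : EuclideanSpace ℝ (Fin n) → ℂ, Continuous g ∧
      ∀ x ∈ Metric.closedBall 0 (2 * r), g x = f x := by
    have hfc : ContinuousOn f (Metric.closedBall 0 (2 * r)) := fun x hx =>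
      (continuousAt_of_pow_two_of_pow_three
        (h2.1.contDiffAt (hU.mem_nhds (hrU hx))).continuousAt
        (h3.1.contDiffAt (hU.mem_nhds (hrU hx))).continuousAt).continuousWithinAt
    obtain ⟨g, hg⟩ := ContinuousMap.exists_restrict_eq Metric.isClosed_closedBall
      ⟨_, hfc.domRestrict⟩
    exact ⟨g, g.continuous, fun x hx => DFunLike.congr_fun hg ⟨x, hx⟩⟩
  have hjet : ∀ x ∈ Metric.closedBall 0 r, ∀ v, ‖v‖ ≤ 1 → ∃ a b,
      HasJet M C σ r (fun t => g (x + t • v) ^ 2) a ∧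
      HasJet M C σ r (fun t => g (x + t • v) ^ 3) b := by
    intro x hx v hv
    have hgx : ∀ t : ℝ, 0 ≤ t → t ≤ r → g (x + t • v) = f (x + t • v) := fun t ht htr => by
      refine hgf _ ?_
      rw [mem_closedBall_zero_iff] at hx ⊢
      calc ‖x + t • v‖ ≤ ‖x‖ + t * ‖v‖ := (norm_add_le _ _).trans
            (by rw [norm_smul, Real.norm_of_nonneg ht])
        _ ≤ r + r * 1 := by gcongr
        _ = 2 * r := by ring
    obtain ⟨a, ha⟩ := hj₂ x hx v hv
    obtain ⟨b, hb⟩ := hj₃ x hx v hv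
    replace ha := ha.mono hM hC0 hCC₂ hσ₂ hσσ₂ le_rfl
    replace hb := hb.mono hM hC0 hCC₃ hσ₃ hσσ₃ le_rfl
    exact ⟨a, b, ⟨ha.1, fun N t ht htr => by simpa only [hgx t ht htr] using ha.2 N t ht htr⟩,
      ⟨hb.1, fun N t ht htr => by simpa only [hgx t ht htr] using hb.2 N t ht htr⟩⟩
  have hdiff : ∀ J : ℕ, ∃ η > 0, ∀ x ∈ Metric.closedBall 0 r, ∀ v, ‖v‖ ≤ 1 → ∀ h : ℝ, 0 < h →
      h ≤ η → ‖altSum J fun k => g (x + (k * h) • v)‖ ≤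
        (C + C') * σ' ^ J * J.factorial * M J * h ^ J := by
    intro J
    rcases Nat.eq_zero_or_pos J with rfl | hJ
    · refine ⟨1, one_pos, fun x hx v hv h hh _ => ?_⟩
      obtain ⟨a, -, ha, -⟩ := hjet x hx v hv
      have h1 : ‖g x‖ ^ 2 ≤ C := by simpa using ha.norm_le hM le_rfl hr.le
      have h2 : ‖g x‖ ≤ C := by nlinarith [norm_nonneg (g x)]
      simp only [altSum, zero_add, Finset.range_one, Finset.sum_singleton, hM.2.2.1]
      simpa using h2.trans (by linarith)
    · obtain ⟨η, hη, hA⟩ := hA J hJ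
      refine ⟨η, hη, fun x hx v hv h hh hhη => ?_⟩
      obtain ⟨a, b, ha, hb⟩ := hjet x hx v hv
      refine (hA (fun t => g (x + t • v)) a b ha hb h hh hhη).trans ?_
      have := (hM.pos J).le
      gcongr
      linarith
  choose η hη hdiff using hdiff
  let φ : ℕ → ContDiffBump (0 : EuclideanSpace ℝ (Fin n)) := fun k =>
    { rIn := r / 2 / (k + 1) / 2
      rOut := r / 2 / (k + 1)
      rIn_pos := by positivity
      rIn_lt_rOut := half_lt_self (by positivity) }
  have hφ : ∀ k, (φ k).rOut ≤ r / 2 := fun k => div_le_self (by positivity) (by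
    have : (0 : ℝ) ≤ k := k.cast_nonneg
    linarith)
  have hφ0 : Tendsto (fun k => (φ k).rOut) atTop (𝓝 0) :=
    (tendsto_const_nhds.div_atTop (tendsto_atTop_add_const_right _ 1 tendsto_natCast_atTop_atTop))
  let u : ℕ → EuclideanSpace ℝ (Fin n) → ℂ := fun k =>
    convolution ((φ k).normed volume) g (ContinuousLinearMap.lsmul ℝ ℝ) volume
  have hu : ∀ k, ContDiff ℝ (⊤ : ℕ∞) (u k) := fun k =>
    (φ k).hasCompactSupport_normed.contDiff_convolution_left _ (φ k).contDiff_normed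
      hg.locallyIntegrable
  have hsub : Metric.ball (0 : EuclideanSpace ℝ (Fin n)) (r / 2) ⊆ Metric.closedBall 0 (2 * r) :=
    Metric.ball_subset_closedBall.trans (Metric.closedBall_subset_closedBall (by linarith))
  obtain ⟨hsmooth, hbound⟩ := contDiffOn_of_tendsto_of_iteratedFDeriv_le
    (Metric.isOpen_ball (x := (0 : EuclideanSpace ℝ (Fin n))) (ε := r / 2)) (convex_ball _ _) hu
    (B := fun j => (2 * Real.exp 1) ^ j * ((C + C') * σ' ^ j * j.factorial * M j)) (f := f)
    (fun k j x hx => by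
      refine ContinuousMultilinearMap.norm_le_of_symm_of_diag _
        (fun v τ => iteratedFDeriv_comp_perm_of_contDiff (hu k) x v τ) fun v hv => ?_
      refine norm_iteratedFDeriv_diag_le_of_altSum (hη j) (hu k).contDiffAt fun h hh hhη => ?_
      refine norm_altSum_convolution_le volume (φ k) hg fun y hy => ?_
      refine hdiff j (x - y) ?_ v hv h hh hhη
      rw [mem_ball_zero_iff] at hx
      rw [mem_closedBall_zero_iff]
      linarith [norm_sub_le x y, hφ k])
    (fun x hx => by
      rw [← hgf x (hsub hx)]
      exact ContDiffBump.convolution_tendsto_right_of_continuous hφ0 hg x)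
  refine ⟨_, Metric.isOpen_ball, Metric.mem_ball_self (by positivity), hsmooth, fun X hX _ =>
    ⟨2 * Real.exp 1 * σ', by positivity, C + C', by positivity, fun j x hx => ?_⟩⟩
  refine (hbound j x (hX hx)).trans_eq ?_
  rw [mul_pow]
  ring

namespace IsCMOnRn

variable {n : ℕ} {M : ℕ → ℝ} {f g : EuclideanSpace ℝ (Fin n) → ℂ}
  {U V : Set (EuclideanSpace ℝ (Fin n))}

lemma mono (hf : IsCMOnRn n M f U) (hU : IsOpen U) (hV : IsOpen V) (hVU : V ⊆ U) :
    IsCMOnRn n M f V := by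
  refine ⟨hf.1.mono hVU, fun X hX hXc => ?_⟩
  obtain ⟨σ, hσ, C, hC, h⟩ := hf.2 X (hX.trans hVU) hXc
  refine ⟨σ, hσ, C, hC, fun j x hx => ?_⟩
  rw [iteratedFDerivWithin_of_isOpen j hV (hX hx),
    ← iteratedFDerivWithin_of_isOpen j hU (hVU (hX hx))]
  exact h j x hx

lemma mul (hM : IsWeightSeq M) (hU : IsOpen U) (hf : IsCMOnRn n M f U) (hg : IsCMOnRn n M g U) :
    IsCMOnRn n M (fun x => f x * g x) U := by
  refine ⟨hf.1.mul hg.1, fun X hX hXc => ?_⟩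
  obtain ⟨σ₁, hσ₁, C₁, hC₁, h₁⟩ := hf.2 X hX hXc
  obtain ⟨σ₂, hσ₂, C₂, hC₂, h₂⟩ := hg.2 X hX hXc
  obtain ⟨σ, hσσ₁, hσσ₂⟩ : ∃ σ, σ₁ ≤ σ ∧ σ₂ ≤ σ := ⟨max σ₁ σ₂, by simp, by simp⟩
  have hσ : 0 < σ := hσ₁.trans_le hσσ₁
  refine ⟨2 * σ, by positivity, C₁ * C₂, by positivity, fun j x hx => ?_⟩
  have hM0 : ∀ i, 0 ≤ M i := fun i => (hM.pos i).le
  calc _ ≤ ∑ i ∈ Finset.range (j + 1), (j.choose i : ℝ) * ‖iteratedFDerivWithin ℝ i f U x‖ *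
        ‖iteratedFDerivWithin ℝ (j - i) g U x‖ :=
        norm_iteratedFDerivWithin_mul_le hf.1 hg.1 hU.uniqueDiffOn (hX hx)
          (WithTop.coe_le_coe.2 le_top)
    _ ≤ ∑ i ∈ Finset.range (j + 1), C₁ * C₂ * σ ^ j * j.factorial * M j := by
        refine Finset.sum_le_sum fun i hi => ?_
        obtain ⟨k, rfl⟩ := Nat.exists_eq_add_of_le (Nat.lt_succ_iff.1 (Finset.mem_range.1 hi))
        have hfac : ((i + k).choose i : ℝ) * i.factorial * k.factorial = (i + k).factorial := by
          have := Nat.choose_mul_factorial_mul_factorial (Nat.le_add_right i k)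
          rw [Nat.add_sub_cancel_left] at this
          exact_mod_cast this
        have := hM0 i
        have := hM0 k
        rw [Nat.add_sub_cancel_left]
        calc _ ≤ ((i + k).choose i : ℝ) * (C₁ * σ ^ i * i.factorial * M i) *
              (C₂ * σ ^ k * k.factorial * M k) := by
              gcongr
              · exact (h₁ i x hx).trans (by gcongr)
              · exact (h₂ k x hx).trans (by gcongr)
          _ = C₁ * C₂ * σ ^ (i + k) * (((i + k).choose i : ℝ) * i.factorial * k.factorial) *
              (M i * M k) := by ring
          _ ≤ _ := by
              rw [hfac]
              gcongr
              exact hM.mul_le_add i k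
    _ = (j + 1) * (C₁ * C₂ * σ ^ j * j.factorial * M j) := by simp
    _ ≤ 2 ^ j * (C₁ * C₂ * σ ^ j * j.factorial * M j) := by
        have := hM0 j
        gcongr
        exact_mod_cast j.lt_two_pow_self
    _ = _ := by rw [mul_pow]; ring

end IsCMOnRn

/-- The several-variables corollary of Joris's theorem for Denjoy–Carleman classes:
if `M` has moderate growth and is non-quasianalytic, `gcd p q = 1`, and `f^p`, `f^q`
are smooth of class `C_M` on a neighborhood `U` of the origin in `ℝⁿ`, then `f` is
smooth of class `C_M` on some neighborhood `V` of the origin. -/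
theorem joris_denjoy_carleman_several_variables
    (M : ℕ → ℝ) (hM : IsWeightSeq M) (hMG : ModerateGrowth M)
    (hNQ : NonQuasianalytic M)
    (n : ℕ) (f : EuclideanSpace ℝ (Fin n) → ℂ)
    (p q : ℕ) (hp : p ≠ 0) (hq : q ≠ 0) (hpq : Nat.gcd p q = 1)
    (U : Set (EuclideanSpace ℝ (Fin n))) (hU : IsOpen U) (hU0 : 0 ∈ U)
    (hfp : IsCMOnRn n M (fun x => f x ^ p) U)
    (hfq : IsCMOnRn n M (fun x => f x ^ q) U) :
    ∃ V : Set (EuclideanSpace ℝ (Fin n)), IsOpen V ∧ 0 ∈ V ∧ IsCMOnRn n M f V := by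
  let S : ℕ → Prop := fun m => ∃ V : Set (EuclideanSpace ℝ (Fin n)), IsOpen V ∧ 0 ∈ V ∧
    IsCMOnRn n M (fun x => f x ^ m) V
  have hadd : ∀ a b, S a → S b → S (a + b) := by
    rintro a b ⟨V, hV, hV0, ha⟩ ⟨W, hW, hW0, hb⟩
    refine ⟨V ∩ W, hV.inter hW, ⟨hV0, hW0⟩, ?_⟩
    simpa only [pow_add] using IsCMOnRn.mul hM (hV.inter hW)
      (ha.mono hV (hV.inter hW) inter_subset_left) (hb.mono hW (hV.inter hW) inter_subset_right)
  have hclosure : ∀ m ∈ AddSubmonoid.closure {p, q}, m = 0 ∨ S m := by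
    intro m hm
    induction hm using AddSubmonoid.closure_induction with
    | mem x hx =>
      rcases hx with rfl | rfl
      exacts [Or.inr ⟨U, hU, hU0, hfp⟩, Or.inr ⟨U, hU, hU0, hfq⟩]
    | zero => exact Or.inl rfl
    | add x y _ _ hx hy =>
      rcases hx with rfl | hx
      · simpa using hy
      · rcases hy with rfl | hy
        · exact Or.inr (by simpa using hx)
        · exact Or.inr (hadd x y hx hy)
  have hgcd : Nat.setGcd {p, q} = 1 := by
    rw [← Nat.dvd_one, ← hpq]
    exact Nat.dvd_gcd (Nat.setGcd_dvd_of_mem (by simp)) (Nat.setGcd_dvd_of_mem (by simp))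
  obtain ⟨N, hN⟩ : ∃ N, ∀ m ≥ N + 1, S m := by
    obtain ⟨N, hN⟩ := Nat.exists_mem_closure_of_ge {p, q}
    exact ⟨N, fun m hm => (hclosure m (hN m (by omega) (by simp [hgcd]))).resolve_left (by omega)⟩
  have hdesc : ∀ N, (∀ m ≥ N + 1, S m) → S 1 := by
    intro N
    induction N with
    | zero => exact fun h => h 1 le_rfl
    | succ N ih =>
      intro h
      refine ih fun m hm => ?_
      rcases Nat.lt_or_ge m (N + 2) with hlt | hge
      · obtain rfl : m = N + 1 := by omega
        obtain ⟨V, hV, hV0, h2⟩ := h ((N + 1) * 2) (by omega)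
        obtain ⟨W, hW, hW0, h3⟩ := h ((N + 1) * 3) (by omega)
        simp only [pow_mul] at h2 h3
        exact exists_isCMOnRn_of_pow_two_of_pow_three hM hMG (hV.inter hW) ⟨hV0, hW0⟩
          (h2.mono hV (hV.inter hW) inter_subset_left)
          (h3.mono hW (hV.inter hW) inter_subset_right)
      · exact h m hge
  simpa [S] using hdesc N hN
end

section
/- Let M be a weight sequence that is stable under derivation, i.e. there is A > 0 with M_{j+1} ≤ A^{j+1} M_j for all j ∈ ℕ. Then every function f in C_M([−1,1]) satisfies property (P_M): there exist positive constants K, c₁, c₂, ε₀ and a family (f_ε)_{0<ε≤ε₀} of continuous functions on ℂ such that for every ε ∈ (0,ε₀], f_ε is holomorphic in Ω_ε, |f_ε| ≤ K in Ω_ε, and |f − f_ε| ≤ c₁ h_M(c₂ ε) on [−1,1]. -/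
open Set Filter MeasureTheory Topology

/-- The function `h_M` associated with a weight sequence. -/
noncomputable def hFun (M : ℕ → ℝ) (t : ℝ) : ℝ :=
  if t = 0 then 0 else ⨅ j : ℕ, t ^ j * M j

/-- The open ellipse `Ω_ε = φ_ε(S)`, `φ_ε(z) = sin (ε z)`, `S = {|Im z| < 1}`. -/
noncomputable def OmegaE (ε : ℝ) : Set ℂ :=
  (fun z => Complex.sin (ε * z)) '' {z : ℂ | |z.im| < 1}

/-- `f` is smooth on `[-1,1]` and belongs to `C_M([-1,1])`. -/
def MemCMIcc (M : ℕ → ℝ) (f : ℝ → ℂ) : Prop :=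
  ContDiffOn ℝ (⊤ : ℕ∞) f (Icc (-1 : ℝ) 1) ∧
  ∃ σ > 0, ∃ C : ℝ, ∀ j : ℕ, ∀ x ∈ Icc (-1 : ℝ) 1,
    ‖iteratedDerivWithin j f (Icc (-1 : ℝ) 1) x‖ ≤ C * σ ^ j * (j.factorial : ℝ) * M j

/-- Property `(P_M)`: approximation by bounded holomorphic functions on the
ellipses `Ω_ε` with rate `h_M(c₂ ε)`. -/
def PropPM (M : ℕ → ℝ) (f : ℝ → ℂ) : Prop :=
  ∃ K > 0, ∃ c₁ > 0, ∃ c₂ > 0, ∃ ε₀ > 0, ∃ F : ℝ → ℂ → ℂ,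
    ∀ ε : ℝ, 0 < ε → ε ≤ ε₀ →
      Continuous (F ε) ∧
      DifferentiableOn ℂ (F ε) (OmegaE ε) ∧
      (∀ z ∈ OmegaE ε, ‖F ε z‖ ≤ K) ∧
      (∀ x ∈ Icc (-1 : ℝ) 1, ‖f x - F ε (x : ℂ)‖ ≤ c₁ * hFun M (c₂ * ε))

/-- The `n`-th Fourier coefficient of the `2π`-periodic function `θ ↦ u (cos θ)`. -/
noncomputable def cosFourierCoeff (u : ℝ → ℂ) (n : ℤ) : ℂ :=
  (1 / (2 * Real.pi) : ℝ) •
    ∫ θ in (0 : ℝ)..(2 * Real.pi), u (Real.cos θ) * Complex.exp (-(n * θ * Complex.I))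

theorem norm_cosFourierCoeff_le {u : ℝ → ℂ} {B : ℝ} (hB : ∀ x ∈ Icc (-1 : ℝ) 1, ‖u x‖ ≤ B)
    (n : ℤ) : ‖cosFourierCoeff u n‖ ≤ B := by
  have h2 : (0 : ℝ) < 2 * Real.pi := Real.two_pi_pos
  have h := intervalIntegral.norm_integral_le_of_norm_le_const (a := 0) (b := 2 * Real.pi) (C := B)
    (f := fun θ : ℝ => u (Real.cos θ) * Complex.exp (-(n * θ * Complex.I))) (by
      intro θ _
      have : ‖Complex.exp (-(n * θ * Complex.I))‖ = 1 := by
        rw [Complex.norm_exp]; simp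
      rw [norm_mul, this, mul_one]
      exact hB _ (Real.cos_mem_Icc θ))
  rw [sub_zero, abs_of_pos h2] at h
  rw [cosFourierCoeff, norm_smul, Real.norm_of_nonneg (by positivity), one_div,
    inv_mul_le_iff₀ h2]
  linarith

theorem continuous_comp_cos_mul_exp {u : ℝ → ℂ} (hu : ContinuousOn u (Icc (-1 : ℝ) 1)) (n : ℤ) :
    Continuous fun θ : ℝ => u (Real.cos θ) * Complex.exp (-(n * θ * Complex.I)) :=
  (hu.comp_continuous Real.continuous_cos Real.cos_mem_Icc).mul (by fun_prop)

/-- Integration by parts relates the coefficients of a function to those of its derivative. -/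
theorem two_mul_cosFourierCoeff {u u' : ℝ → ℂ}
    (hu : ∀ x ∈ Icc (-1 : ℝ) 1, HasDerivWithinAt u (u' x) (Icc (-1) 1) x)
    (hu' : ContinuousOn u' (Icc (-1 : ℝ) 1)) (n : ℤ) :
    2 * n * cosFourierCoeff u n = cosFourierCoeff u' (n - 1) - cosFourierCoeff u' (n + 1) := by
  have hcu : ContinuousOn u (Icc (-1 : ℝ) 1) := fun x hx => (hu x hx).continuousWithinAt
  have hi : ∀ {v : ℝ → ℂ}, ContinuousOn v (Icc (-1 : ℝ) 1) → ∀ m : ℤ,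
      IntervalIntegrable (fun θ : ℝ => v (Real.cos θ) * Complex.exp (-(m * θ * Complex.I)))
        volume 0 (2 * Real.pi) := fun hv m => (continuous_comp_cos_mul_exp hv m).intervalIntegrable _ _
  have hderiv : ∀ θ : ℝ, HasDerivAt
      (fun θ : ℝ => 2 * Complex.I * (u (Real.cos θ) * Complex.exp (-(n * θ * Complex.I))))
      (2 * n * (u (Real.cos θ) * Complex.exp (-(n * θ * Complex.I)))
        - (u' (Real.cos θ) * Complex.exp (-((n - 1 : ℤ) * θ * Complex.I))
          - u' (Real.cos θ) * Complex.exp (-((n + 1 : ℤ) * θ * Complex.I)))) θ := by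
    intro θ
    have h1 := HasDerivWithinAt.scomp_hasDerivAt θ (hu _ (Real.cos_mem_Icc θ))
      (Real.hasDerivAt_cos θ) Real.cos_mem_Icc
    have h2 : HasDerivAt (fun θ : ℝ => Complex.exp (-(n * θ * Complex.I)))
        (Complex.exp (-(n * θ * Complex.I)) * (-(n * 1 * Complex.I))) θ :=
      ((((hasDerivAt_id θ).ofReal_comp).const_mul (n : ℂ)).mul_const Complex.I).neg.cexp
    refine ((h1.mul h2).const_mul (2 * Complex.I)).congr_deriv ?_
    have e1 : Complex.exp (-((n - 1 : ℤ) * θ * Complex.I))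
        = Complex.exp (-(n * θ * Complex.I)) * (Real.cos θ + Real.sin θ * Complex.I) := by
      rw [Complex.ofReal_cos, Complex.ofReal_sin, ← Complex.exp_mul_I, ← Complex.exp_add]
      congr 1; push_cast; ring
    have e2 : Complex.exp (-((n + 1 : ℤ) * θ * Complex.I))
        = Complex.exp (-(n * θ * Complex.I)) * (Real.cos θ - Real.sin θ * Complex.I) := by
      have : (Real.cos θ - Real.sin θ * Complex.I : ℂ) = Complex.exp (-θ * Complex.I) := by
        rw [Complex.exp_mul_I, Complex.cos_neg, Complex.sin_neg, Complex.ofReal_cos,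
          Complex.ofReal_sin]; ring
      rw [this, ← Complex.exp_add]
      congr 1; push_cast; ring
    rw [e1, e2]
    simp only [Function.comp_apply, Complex.real_smul, Complex.ofReal_neg]
    linear_combination
      (-2 * n * u (Real.cos θ) * Complex.exp (-(n * θ * Complex.I))) * Complex.I_sq
  have hintegral := intervalIntegral.integral_eq_sub_of_hasDerivAt (a := 0) (b := 2 * Real.pi)
    (fun θ _ => hderiv θ)
    (((hi hcu n).const_mul _).sub ((hi hu' (n - 1)).sub (hi hu' (n + 1))))
  have hper : Complex.exp (-(n * (2 * Real.pi : ℝ) * Complex.I)) = 1 := by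
    rw [Complex.exp_eq_one_iff]
    exact ⟨-n, by push_cast; ring⟩
  rw [intervalIntegral.integral_sub ((hi hcu n).const_mul _)
    ((hi hu' (n - 1)).sub (hi hu' (n + 1))), intervalIntegral.integral_sub (hi hu' _) (hi hu' _),
    intervalIntegral.integral_const_mul, hper] at hintegral
  simp only [Real.cos_two_pi, Real.cos_zero, Complex.ofReal_zero, mul_zero, zero_mul, neg_zero,
    Complex.exp_zero, sub_self] at hintegral
  simp only [cosFourierCoeff, Complex.real_smul]
  linear_combination ((1 / (2 * Real.pi) : ℝ) : ℂ) * hintegral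

theorem norm_cosFourierCoeff_mul_descFactorial_le (j : ℕ) {u : ℝ → ℂ} {B : ℝ}
    (hu : ContDiffOn ℝ (⊤ : ℕ∞) u (Icc (-1 : ℝ) 1))
    (hB : ∀ x ∈ Icc (-1 : ℝ) 1, ‖iteratedDerivWithin j u (Icc (-1 : ℝ) 1) x‖ ≤ B) (n : ℤ) :
    ‖cosFourierCoeff u n‖ * (n.natAbs.descFactorial j : ℝ) ≤ B := by
  induction j generalizing u n with
  | zero => simpa using norm_cosFourierCoeff_le (by simpa using hB) n
  | succ j ih =>
    have hB0 : 0 ≤ B := (norm_nonneg _).trans (hB 0 (by simp))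
    obtain ⟨m, hm⟩ | h0 : (∃ m, n.natAbs = m + 1) ∨ n.natAbs = 0 := by
      rcases hn : n.natAbs with _ | m
      · exact Or.inr rfl
      · exact Or.inl ⟨m, rfl⟩
    swap
    · simpa [h0] using hB0
    have hI : UniqueDiffOn ℝ (Icc (-1 : ℝ) 1) := uniqueDiffOn_Icc (by norm_num)
    obtain ⟨hd, hu'⟩ := (contDiffOn_infty_iff_derivWithin hI).1 hu
    have hrec := two_mul_cosFourierCoeff (fun x hx => (hd x hx).hasDerivWithinAt)
      hu'.continuousOn n
    rw [iteratedDerivWithin_succ'] at hB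
    have key : ∀ k : ℤ, m ≤ k.natAbs →
        ‖cosFourierCoeff (derivWithin u (Icc (-1 : ℝ) 1)) k‖ * (m.descFactorial j : ℝ) ≤ B := by
      intro k hk
      refine le_trans ?_ (ih hu' hB k)
      gcongr
    have h1 := key (n - 1) (by omega)
    have h2 := key (n + 1) (by omega)
    have hnorm : 2 * ((m : ℝ) + 1) * ‖cosFourierCoeff u n‖ ≤
        ‖cosFourierCoeff (derivWithin u (Icc (-1 : ℝ) 1)) (n - 1)‖ +
        ‖cosFourierCoeff (derivWithin u (Icc (-1 : ℝ) 1)) (n + 1)‖ := by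
      have : ‖(n : ℂ)‖ = (m : ℝ) + 1 := by
        rw [Complex.norm_intCast, ← Int.cast_abs, Int.abs_eq_natAbs, hm]; push_cast; rfl
      calc _ = ‖2 * n * cosFourierCoeff u n‖ := by rw [norm_mul, norm_mul, this, Complex.norm_ofNat]
        _ ≤ _ := by rw [hrec]; exact norm_sub_le _ _
    rw [hm, Nat.succ_descFactorial_succ]
    push_cast
    have := mul_le_mul_of_nonneg_right hnorm (Nat.cast_nonneg (α := ℝ) (m.descFactorial j))
    linarith

/-- Expansion of `u` in Chebyshev polynomials, indexed by the integers. -/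
theorem hasSum_cosFourierCoeff_mul_chebyshev {u : ℝ → ℂ}
    (hu : ContinuousOn u (Icc (-1 : ℝ) 1)) (hs : Summable (cosFourierCoeff u))
    {x : ℝ} (hx : x ∈ Icc (-1 : ℝ) 1) :
    HasSum (fun n : ℤ => cosFourierCoeff u n * (Polynomial.Chebyshev.T ℂ n).eval (x : ℂ))
      (u x) := by
  have : Fact (0 < 2 * Real.pi) := ⟨Real.two_pi_pos⟩
  let g : C(AddCircle (2 * Real.pi), ℂ) :=
    ⟨fun θ => u (Real.Angle.cos θ), hu.comp_continuous Real.Angle.continuous_cos (by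
      intro θ
      induction θ using Real.Angle.induction_on with
      | h θ => rw [Real.Angle.cos_coe]; exact Real.cos_mem_Icc θ)⟩
  have hg : ∀ θ : ℝ, g (θ : AddCircle (2 * Real.pi)) = u (Real.cos θ) :=
    fun θ => congrArg u (Real.Angle.cos_coe θ)
  have hpi : (Real.pi : ℂ) ≠ 0 := by exact_mod_cast Real.pi_ne_zero
  have hcoe : ∀ (n : ℤ) (θ : ℝ), fourier n (θ : AddCircle (2 * Real.pi))
      = Complex.exp (n * θ * Complex.I) := by
    intro n θ
    rw [fourier_coe_apply]
    congr 1; push_cast; field_simp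
  have hcoef : fourierCoeff g = cosFourierCoeff u := by
    funext n
    rw [fourierCoeff_eq_intervalIntegral _ _ 0, cosFourierCoeff, zero_add]
    congr 1
    refine intervalIntegral.integral_congr fun θ _ => ?_
    simp only [hg, hcoe, smul_eq_mul]
    rw [mul_comm]; congr 2; push_cast; ring
  have hsum : ∀ θ : ℝ, HasSum (fun n : ℤ => cosFourierCoeff u n * Complex.exp (n * θ * Complex.I))
      (u (Real.cos θ)) := by
    intro θ
    have := has_pointwise_sum_fourier_series_of_summable (f := g) (by rwa [hcoef])
      (θ : AddCircle (2 * Real.pi))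
    simpa only [hcoef, hcoe, hg, smul_eq_mul] using this
  have h := ((hsum (Real.arccos x)).add (hsum (-Real.arccos x))).mul_left (1 / 2 : ℂ)
  rw [Real.cos_neg, Real.cos_arccos hx.1 hx.2] at h
  have hx' : 1 / 2 * (u x + u x) = u x := by ring
  rw [hx'] at h
  refine h.congr_fun fun n => ?_
  have hcos : (x : ℂ) = Complex.cos (Real.arccos x : ℝ) := by
    rw [← Complex.ofReal_cos, Real.cos_arccos hx.1 hx.2]
  conv_lhs => rw [hcos]
  rw [Polynomial.Chebyshev.T_complex_cos, Complex.cos, Complex.ofReal_neg,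
    show -((n : ℂ) * (Real.arccos x : ℝ)) * Complex.I
      = n * -(Real.arccos x : ℝ) * Complex.I by ring]
  ring

theorem norm_chebyshev_le_of_mem_OmegaE {ε : ℝ} (hε : 0 < ε) {z : ℂ} (hz : z ∈ OmegaE ε)
    (n : ℤ) : ‖(Polynomial.Chebyshev.T ℂ n).eval z‖ ≤ Real.exp (|(n : ℝ)| * ε) := by
  obtain ⟨w, hw, rfl⟩ := hz
  simp only [mem_ofPred_eq] at hw
  have hexp : ∀ s : ℝ, |s| = ε * |w.im| → Real.exp (n * s) ≤ Real.exp (|(n : ℝ)| * ε) := by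
    intro s hs
    apply Real.exp_le_exp.2
    calc (n : ℝ) * s ≤ |(n : ℝ) * s| := le_abs_self _
      _ = |(n : ℝ)| * (ε * |w.im|) := by rw [abs_mul, hs]
      _ ≤ _ := by
        gcongr
        nlinarith
  have h1 := hexp (ε * w.im) (by rw [abs_mul, abs_of_pos hε])
  have h2 := hexp (-(ε * w.im)) (by rw [abs_neg, abs_mul, abs_of_pos hε])
  simp only
  rw [← Complex.cos_pi_div_two_sub, Polynomial.Chebyshev.T_complex_cos, Complex.cos, norm_div]
  have h3 := norm_add_le (Complex.exp (n * (Real.pi / 2 - ε * w) * Complex.I))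
    (Complex.exp (-(n * (Real.pi / 2 - ε * w)) * Complex.I))
  rw [Complex.norm_exp, Complex.norm_exp] at h3
  have e1 : ((n : ℂ) * (Real.pi / 2 - ε * w) * Complex.I).re = n * (ε * w.im) := by
    simp [Complex.mul_re, Complex.mul_im, Complex.sub_re, Complex.sub_im, Complex.div_ofNat_im]
  have e2 : (-((n : ℂ) * (Real.pi / 2 - ε * w)) * Complex.I).re = n * -(ε * w.im) := by
    simp [Complex.mul_re, Complex.mul_im, Complex.sub_re, Complex.sub_im, Complex.div_ofNat_im]
  rw [e1, e2] at h3
  rw [Complex.norm_ofNat, div_le_iff₀ (by norm_num)]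
  linarith

theorem IsWeightSeq.one_le_s4 {M : ℕ → ℝ} (hM : IsWeightSeq M) (j : ℕ) : 1 ≤ M j :=
  hM.2.2.1 ▸ hM.2.1 (Nat.zero_le j)

theorem factorial_add_two_le (j : ℕ) :
    ((j + 2).factorial : ℝ) ≤ 2 * 3 ^ j * (j : ℝ) ^ j := by
  have h1 : (j + 2) * (j + 1) ≤ 2 * 3 ^ j := by
    induction j with
    | zero => norm_num
    | succ j ih => rw [pow_succ]; nlinarith
  have h2 : (j + 2).factorial ≤ 2 * 3 ^ j * j ^ j := by
    rw [Nat.factorial_succ, Nat.factorial_succ, ← mul_assoc]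
    exact Nat.mul_le_mul h1 (Nat.factorial_le_pow j)
  exact_mod_cast h2

/-- Passing from falling factorials to powers, with a gain of two powers of `m` paid for by
stability under derivation. -/
theorem mul_sq_le_of_mul_descFactorial_le {M : ℕ → ℝ} (hM : IsWeightSeq M) {A C σ d : ℝ}
    (hA : 1 ≤ A) (hDer : ∀ j : ℕ, M (j + 1) ≤ A ^ (j + 1) * M j) (hσ : 0 < σ) (hC : 0 ≤ C)
    (hd : 0 ≤ d) {m : ℕ} (hm : 0 < m)
    (h : ∀ k : ℕ, d * (m.descFactorial k : ℝ) ≤ C * σ ^ k * (k.factorial : ℝ) * M k) (j : ℕ) :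
    d * (m : ℝ) ^ 2 ≤
      (8 * C * σ ^ 2 * A ^ 3 + 9 * C) * ((6 * σ * A ^ 2 + 5) * (j / m)) ^ j * M j := by
  have hm' : (0 : ℝ) < m := by exact_mod_cast hm
  have hA0 : 0 < A := by linarith
  have large : ∀ i : ℕ, 2 * (i + 2) ≤ m → d * (m : ℝ) ^ 2 ≤
      8 * C * σ ^ 2 * A ^ 3 * ((6 * σ * A ^ 2) * (i / m)) ^ i * M i := by
    intro i hi
    have hMi := hM.1 i
    have h1 : ((m : ℝ) / 2) ^ (i + 2) ≤ (m.descFactorial (i + 2) : ℝ) := by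
      have h2 : ((m + 1 - (i + 2) : ℕ) : ℝ) ^ (i + 2) ≤ (m.descFactorial (i + 2) : ℝ) := by
        exact_mod_cast Nat.pow_sub_le_descFactorial m (i + 2)
      refine le_trans ?_ h2
      gcongr
      rw [div_le_iff₀ two_pos]
      have : m ≤ (m + 1 - (i + 2)) * 2 := by omega
      exact_mod_cast this
    have h2 : M (i + 2) ≤ A ^ (2 * i + 3) * M i := by
      calc M (i + 2) ≤ A ^ (i + 2) * M (i + 1) := hDer (i + 1)
        _ ≤ A ^ (i + 2) * (A ^ (i + 1) * M i) := by gcongr; exact hDer i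
        _ = _ := by ring
    have h3 : d * ((m : ℝ) / 2) ^ (i + 2) ≤
        C * σ ^ (i + 2) * (2 * 3 ^ i * (i : ℝ) ^ i) * (A ^ (2 * i + 3) * M i) :=
      calc d * ((m : ℝ) / 2) ^ (i + 2) ≤ d * (m.descFactorial (i + 2) : ℝ) := by gcongr
        _ ≤ _ := h (i + 2)
        _ ≤ _ := by
          have := (hM.1 (i + 2)).le
          gcongr
          exact factorial_add_two_le i
    rw [← mul_le_mul_iff_of_pos_right (show (0 : ℝ) < (m / 2) ^ i by positivity)]
    calc d * (m : ℝ) ^ 2 * (m / 2) ^ i = 4 * (d * ((m : ℝ) / 2) ^ (i + 2)) := by ring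
      _ ≤ 4 * (C * σ ^ (i + 2) * (2 * 3 ^ i * (i : ℝ) ^ i) * (A ^ (2 * i + 3) * M i)) := by gcongr
      _ = 8 * C * σ ^ 2 * A ^ 3 * (((6 * σ * A ^ 2) * (i / m)) * (m / 2)) ^ i * M i := by
        rw [show (6 * σ * A ^ 2) * (i / m) * ((m : ℝ) / 2) = σ * 3 * i * A ^ 2 by
          field_simp; ring]
        simp only [mul_pow, ← pow_mul]
        ring
      _ = _ := by rw [mul_pow _ ((m : ℝ) / 2)]; ring
  have base : d * (m : ℝ) ^ 2 ≤ 8 * C * σ ^ 2 * A ^ 3 + 9 * C := by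
    by_cases h4 : 4 ≤ m
    · have := large 0 (by omega)
      simp only [pow_zero, mul_one, hM.2.2.1] at this
      linarith
    · have hdC : d ≤ C := by simpa [hM.2.2.1] using h 0
      have hm3 : (m : ℝ) ≤ 3 := by exact_mod_cast (by omega : m ≤ 3)
      have : d * (m : ℝ) ^ 2 ≤ C * 3 ^ 2 := by gcongr
      have : 0 ≤ 8 * C * σ ^ 2 * A ^ 3 := by positivity
      linarith
  have hMj := hM.1 j
  by_cases hj : 2 * (j + 2) ≤ m
  · refine (large j hj).trans ?_
    gcongr <;> linarith
  · refine base.trans ?_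
    have h1 : 1 ≤ ((6 * σ * A ^ 2 + 5) * (j / m : ℝ)) ^ j := by
      rcases Nat.eq_zero_or_pos j with rfl | hj0
      · simp
      · apply one_le_pow₀
        have h5 : (m : ℝ) ≤ 5 * j := by exact_mod_cast (by omega : m ≤ 5 * j)
        have h6 : 1 ≤ 5 * (j / m : ℝ) := by rwa [← mul_div_assoc, one_le_div hm']
        have h7 : 0 ≤ 6 * σ * A ^ 2 * (j / m : ℝ) := by positivity
        linarith
    have h2 := one_le_mul_of_one_le_of_one_le h1 (hM.one_le_s4 j)
    rw [mul_assoc (8 * C * σ ^ 2 * A ^ 3 + 9 * C)]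
    exact le_mul_of_one_le_right (by positivity) h2

theorem norm_cosFourierCoeff_mul_sq_le {M : ℕ → ℝ} (hM : IsWeightSeq M)
    (hDer : ∃ A > 0, ∀ j : ℕ, M (j + 1) ≤ A ^ (j + 1) * M j) {f : ℝ → ℂ} (hf : MemCMIcc M f) :
    ∃ C > 0, ∃ κ > 0, ∀ n : ℤ, n ≠ 0 → ∀ j : ℕ,
      ‖cosFourierCoeff f n‖ * (n : ℝ) ^ 2 ≤ C * (κ * (j / |(n : ℝ)|)) ^ j * M j := by
  obtain ⟨A, hA, hDer⟩ := hDer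
  obtain ⟨hf, σ, hσ, C, hC⟩ := hf
  have hC0 : 0 ≤ C := by
    have := (norm_nonneg _).trans (hC 0 0 (by simp))
    simpa [hM.2.2.1] using this
  have hDer' : ∀ j : ℕ, M (j + 1) ≤ (max A 1) ^ (j + 1) * M j := fun j => by
    have := hM.1 j
    refine (hDer j).trans ?_
    gcongr
    exact le_max_left _ _
  have hA1 : 1 ≤ max A 1 := le_max_right _ _
  have hA0 : 0 < max A 1 := by linarith
  refine ⟨8 * C * σ ^ 2 * (max A 1) ^ 3 + 9 * C + 1, by positivity,
    6 * σ * (max A 1) ^ 2 + 5, by positivity, fun n hn j => ?_⟩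
  have h := mul_sq_le_of_mul_descFactorial_le hM hA1 hDer' hσ hC0
    (norm_nonneg (cosFourierCoeff f n)) (Int.natAbs_pos.2 hn)
    (fun k => norm_cosFourierCoeff_mul_descFactorial_le k hf (hC k) n) j
  rw [Nat.cast_natAbs, Int.cast_abs, sq_abs] at h
  have hMj := hM.1 j
  refine h.trans ?_
  gcongr ?_ * _ * _
  linarith

/-- The infimum defining `hFun M t` is attained at some `J`, and `t ^ j * M j ≤ 1` up to `J`. -/
theorem IsWeightSeq.exists_minimizer {M : ℕ → ℝ} (hM : IsWeightSeq M) {t : ℝ} (ht : 0 < t) :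
    ∃ J : ℕ, t ^ J * M J ≤ hFun M t ∧ ∀ j ≤ J, t ^ j * M j ≤ 1 := by
  obtain ⟨hpos, -, h0, hlog, htend⟩ := hM
  have hev : ∀ᶠ j : ℕ in atTop, 1 ≤ t ^ j * M j := by
    filter_upwards [htend.eventually_ge_atTop t⁻¹, eventually_ge_atTop 1] with j hj hj1
    have h1 : (t⁻¹) ^ j ≤ M j := by
      calc (t⁻¹) ^ j ≤ (M j ^ (1 / (j : ℝ))) ^ j := by gcongr
        _ = M j := by rw [one_div, Real.rpow_inv_natCast_pow (hpos j).le (by omega)]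
    rwa [inv_pow, inv_le_iff_one_le_mul₀' (by positivity)] at h1
  obtain ⟨N, hN⟩ := eventually_atTop.1 hev
  obtain ⟨J, -, hJ⟩ := Finset.exists_min_image (Finset.range (N + 1)) (fun j => t ^ j * M j)
    ⟨0, by simp⟩
  have hmin : ∀ j, t ^ J * M J ≤ t ^ j * M j := by
    intro j
    by_cases hj : j < N + 1
    · exact hJ j (Finset.mem_range.2 hj)
    · calc t ^ J * M J ≤ t ^ 0 * M 0 := hJ 0 (by simp)
        _ = 1 := by simp [h0]
        _ ≤ _ := hN j (by omega)
  have hratio : Monotone fun j => M (j + 1) / M j := monotone_nat_of_le_succ hlog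
  refine ⟨J, ?_, fun j hj => ?_⟩
  · rw [hFun, if_neg ht.ne']
    exact le_ciInf hmin
  · induction j with
    | zero => simp [h0]
    | succ j ih =>
      have hr : t * (M (j + 1) / M j) ≤ 1 := by
        obtain ⟨I, rfl⟩ : ∃ I, J = I + 1 := ⟨J - 1, by omega⟩
        have h1 : M (j + 1) / M j ≤ M (I + 1) / M I := hratio (by omega : j ≤ I)
        have h2 : t * (M (I + 1) / M I) ≤ 1 := by
          rw [← mul_div_assoc, div_le_one (hpos I)]
          have := hmin I
          rw [pow_succ, mul_assoc] at this
          exact le_of_mul_le_mul_left this (by positivity)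
        exact (mul_le_mul_of_nonneg_left h1 ht.le).trans h2
      calc t ^ (j + 1) * M (j + 1) = (t ^ j * M j) * (t * (M (j + 1) / M j)) := by
            have := (hpos j).ne'
            field_simp
            ring
        _ ≤ 1 * 1 := mul_le_mul (ih (by omega)) hr
            (mul_nonneg ht.le (div_nonneg (hpos _).le (hpos _).le)) zero_le_one
        _ = 1 := one_mul 1

/-- If the weight sequence `M` is stable under derivation, every element of
`C_M([-1,1])` satisfies property `(P_M)`. -/
theorem memCMIcc_propPM
    (M : ℕ → ℝ) (hM : IsWeightSeq M)
    (hDer : ∃ A > 0, ∀ j : ℕ, M (j + 1) ≤ A ^ (j + 1) * M j)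
    (f : ℝ → ℂ) (hf : MemCMIcc M f) :
    PropPM M f := by
  obtain ⟨C, hC, κ, hκ, hdecay⟩ := norm_cosFourierCoeff_mul_sq_le hM hDer hf
  have hzeta : Summable fun n : ℤ => 1 / (n : ℝ) ^ 2 := Real.summable_one_div_int_pow.2 one_lt_two
  set Z : ℝ := ∑' n : ℤ, 1 / (n : ℝ) ^ 2 with hZ
  have hZ0 : 0 ≤ Z := tsum_nonneg fun n => by positivity
  have hdiv : ∀ {n : ℤ} {a b : ℝ}, n ≠ 0 → a * (n : ℝ) ^ 2 ≤ b → a ≤ b * (1 / (n : ℝ) ^ 2) := by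
    intro n a b hn h
    have : (n : ℝ) ≠ 0 := by exact_mod_cast hn
    rwa [mul_one_div, le_div_iff₀ (by positivity)]
  have hsum : Summable (cosFourierCoeff f) := by
    refine Summable.of_norm_bounded_eventually (hzeta.mul_left C) ?_
    filter_upwards [(Set.finite_singleton (0 : ℤ)).compl_mem_cofinite] with n hn
    exact hdiv hn (by simpa [hM.2.2.1] using hdecay n hn 0)
  have hc₂ : 0 < κ * Real.exp 1 := by positivity
  have hex : ∀ ε : ℝ, ∃ P : Polynomial ℂ, 0 < ε →
      (∀ z ∈ OmegaE ε, ‖P.eval z‖ ≤ ‖cosFourierCoeff f 0‖ + C * Real.exp 1 * Z + 1) ∧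
      ∀ x ∈ Icc (-1 : ℝ) 1, ‖f x - P.eval (x : ℂ)‖ ≤
        (C * Z + 1) * hFun M (κ * Real.exp 1 * ε) := by
    intro ε
    by_cases hε : 0 < ε
    swap
    · exact ⟨0, fun h => absurd h hε⟩
    obtain ⟨J, hJmin, hJle⟩ := hM.exists_minimizer (mul_pos hc₂ hε)
    have hfin : {n : ℤ | |(n : ℝ)| * ε ≤ J}.Finite := by
      refine (Set.finite_Icc (-⌊J / ε⌋) ⌊J / ε⌋).subset fun n hn => ?_
      have hn' : |(n : ℝ)| ≤ J / ε := by rwa [le_div_iff₀ hε]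
      rw [← Int.cast_abs] at hn'
      exact abs_le.1 (Int.le_floor.2 hn')
    set S := hfin.toFinset with hS
    have hmemS : ∀ n : ℤ, n ∈ S ↔ |(n : ℝ)| * ε ≤ J := fun n => by simp [hS]
    have hpos : ∀ {n : ℤ}, n ≠ 0 → 0 < |(n : ℝ)| := fun hn => abs_pos.2 (by exact_mod_cast hn)
    have hlow : ∀ n ∈ S, n ≠ 0 →
        ‖cosFourierCoeff f n‖ * Real.exp (|(n : ℝ)| * ε) ≤ C * Real.exp 1 * (1 / (n : ℝ) ^ 2) := by
      intro n hn hn0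
      have hn1 := hpos hn0
      have hnε : 0 ≤ |(n : ℝ)| * ε := by positivity
      set j := ⌊|(n : ℝ)| * ε⌋₊ with hj
      have hjle : (j : ℝ) ≤ |(n : ℝ)| * ε := Nat.floor_le hnε
      have hjlt : |(n : ℝ)| * ε < j + 1 := Nat.lt_floor_add_one _
      have hjJ : j ≤ J := by exact_mod_cast hjle.trans ((hmemS n).1 hn)
      have hMj := hM.1 j
      have hratio : (j / |(n : ℝ)|) ≤ ε := by rwa [div_le_iff₀ hn1, mul_comm]
      refine hdiv hn0 ?_
      calc ‖cosFourierCoeff f n‖ * Real.exp (|(n : ℝ)| * ε) * (n : ℝ) ^ 2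
          = (‖cosFourierCoeff f n‖ * (n : ℝ) ^ 2) * Real.exp (|(n : ℝ)| * ε) := by ring
        _ ≤ (C * (κ * ε) ^ j * M j) * Real.exp (j + 1) := by
          gcongr ?_ * Real.exp ?_
          refine (hdecay n hn0 j).trans ?_
          gcongr
        _ = C * Real.exp 1 * ((κ * Real.exp 1 * ε) ^ j * M j) := by
          rw [Real.exp_add, Real.exp_one_pow j |>.symm]
          ring
        _ ≤ C * Real.exp 1 * 1 := by
          gcongr
          exact hJle j hjJ
        _ = _ := mul_one _
    have hh0 : 0 ≤ hFun M (κ * Real.exp 1 * ε) :=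
      le_trans (mul_nonneg (by positivity) (hM.1 J).le) hJmin
    have hhigh : ∀ n ∉ S,
        ‖cosFourierCoeff f n‖ ≤ C * hFun M (κ * Real.exp 1 * ε) * (1 / (n : ℝ) ^ 2) := by
      intro n hn
      rw [hmemS, not_le] at hn
      have hn0 : n ≠ 0 := by
        rintro rfl
        simp only [Int.cast_zero, abs_zero, zero_mul] at hn
        exact absurd hn (not_lt.2 (Nat.cast_nonneg J))
      have hn1 := hpos hn0
      have hMJ := hM.1 J
      have hratio : (J / |(n : ℝ)|) ≤ ε := by
        rw [div_le_iff₀ hn1, mul_comm]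
        exact hn.le
      refine hdiv hn0 ((hdecay n hn0 J).trans ?_)
      rw [mul_assoc]
      refine mul_le_mul_of_nonneg_left (le_trans ?_ hJmin) hC.le
      gcongr
      exact le_mul_of_one_le_right hκ.le (Real.one_le_exp zero_le_one)
    have heval : ∀ z : ℂ, (∑ n ∈ S, Polynomial.C (cosFourierCoeff f n) *
        Polynomial.Chebyshev.T ℂ n).eval z =
        ∑ n ∈ S, cosFourierCoeff f n * (Polynomial.Chebyshev.T ℂ n).eval z := fun z => by
      simp [Polynomial.eval_finsetSum]
    refine ⟨∑ n ∈ S, Polynomial.C (cosFourierCoeff f n) * Polynomial.Chebyshev.T ℂ n,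
      fun _ => ⟨fun z hz => ?_, fun x hx => ?_⟩⟩
    · rw [heval]
      have hterm : ∀ n ∈ S, ‖cosFourierCoeff f n * (Polynomial.Chebyshev.T ℂ n).eval z‖ ≤
          (if n = 0 then ‖cosFourierCoeff f 0‖ else 0) + C * Real.exp 1 * (1 / (n : ℝ) ^ 2) := by
        intro n hn
        by_cases hn0 : n = 0
        · subst hn0
          simp
        · rw [if_neg hn0, zero_add, norm_mul]
          refine le_trans ?_ (hlow n hn hn0)
          gcongr
          exact norm_chebyshev_le_of_mem_OmegaE hε hz n
      have h1 : ∑ n ∈ S, (if n = 0 then ‖cosFourierCoeff f 0‖ else 0) ≤ ‖cosFourierCoeff f 0‖ := by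
        rw [Finset.sum_ite_eq']
        split_ifs
        · exact le_rfl
        · exact norm_nonneg _
      have h2 : ∑ n ∈ S, 1 / (n : ℝ) ^ 2 ≤ Z :=
        hzeta.sum_le_tsum S fun n _ => by positivity
      calc _ ≤ _ := norm_sum_le_of_le S hterm
        _ ≤ ‖cosFourierCoeff f 0‖ + C * Real.exp 1 * Z := by
          rw [Finset.sum_add_distrib, ← Finset.mul_sum]
          gcongr
        _ ≤ _ := by linarith
    · rw [heval]
      have hfull := hasSum_cosFourierCoeff_mul_chebyshev hf.1.continuousOn hsum hx
      have hpart := hasSum_sum_of_ne_finset_zero (s := S) (L := .unconditional ℤ)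
        (f := fun n : ℤ => if n ∈ S then
          cosFourierCoeff f n * (Polynomial.Chebyshev.T ℂ n).eval (x : ℂ) else 0)
        fun n hn => if_neg hn
      rw [Finset.sum_congr rfl fun n hn => if_pos hn] at hpart
      have hT : ∀ n : ℤ, ‖(Polynomial.Chebyshev.T ℂ n).eval (x : ℂ)‖ ≤ 1 := by
        intro n
        rw [← Real.cos_arccos hx.1 hx.2, Complex.ofReal_cos, Polynomial.Chebyshev.T_complex_cos,
          ← Complex.ofReal_intCast, ← Complex.ofReal_mul, ← Complex.ofReal_cos, Complex.norm_real]
        exact Real.abs_cos_le_one _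
      have hbound := (hfull.sub hpart).norm_le_of_bounded
        (hzeta.hasSum.mul_left (C * hFun M (κ * Real.exp 1 * ε))) (fun n => by
          by_cases hn : n ∈ S
          · rw [if_pos hn, sub_self, norm_zero]
            positivity
          · rw [if_neg hn, sub_zero, norm_mul]
            exact (mul_le_of_le_one_right (norm_nonneg _) (hT n)).trans (hhigh n hn))
      refine hbound.trans ?_
      rw [← hZ]
      linarith
  choose P hP using hex
  refine ⟨‖cosFourierCoeff f 0‖ + C * Real.exp 1 * Z + 1, by positivity, C * Z + 1, by positivity,
    κ * Real.exp 1, hc₂, 1, one_pos, fun ε z => (P ε).eval z, fun ε hε _ => ?_⟩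
  exact ⟨(P ε).continuous, (P ε).differentiable.differentiableOn, (hP ε hε).1, (hP ε hε).2⟩
end
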